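/- If G is a graph in class 𝒜 (G contains no odd hole, no antihole of length at least 5, and no induced prism) and G is not a complete graph, then G has an even pair {x, y} such that the contraction G/xy is again a graph in class 𝒜. -/

import Mathlib

open SimpleGraph

/-- A walk is a *chordless (induced) path*: it is a path and the only edges of `G`
between its vertices are the edges of the walk. -/
def IsInducedPathW {V : Type*} (G : SimpleGraph V) {u v : V} (p : G.Walk u v) : Prop :=
  p.IsPath ∧ ∀ x y : V, x ∈ p.support → y ∈ p.support → G.Adj x y → p.toSubgraph.Adj x y

/-- A closed walk is a *hole*: an induced (chordless) cycle with at least 4 vertices. -/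
def IsHoleW {V : Type*} (G : SimpleGraph V) {v : V} (c : G.Walk v v) : Prop :=
  c.IsCycle ∧ 4 ≤ c.length ∧
    ∀ x y : V, x ∈ c.support → y ∈ c.support → G.Adj x y → c.toSubgraph.Adj x y

/-- `G` contains an odd hole. -/
def HasOddHole {V : Type*} (G : SimpleGraph V) : Prop :=
  ∃ (v : V) (c : G.Walk v v), IsHoleW G c ∧ Odd c.length

/-- Compatibility condition for two legs of a pyramid with apex `a`:
they meet only at `a`, and `bᵢbⱼ` is the only edge between them away from `a`. -/
def PyrPair {V : Type*} (G : SimpleGraph V) (a bi bj : V)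
    (Pi : G.Walk a bi) (Pj : G.Walk a bj) : Prop :=
  (∀ x : V, x ∈ Pi.support → x ∈ Pj.support → x = a) ∧
  (∀ x ∈ Pi.support, ∀ y ∈ Pj.support, x ≠ a → y ≠ a → G.Adj x y → x = bi ∧ y = bj)

/-- The three paths `P₁, P₂, P₃` form a *pyramid* of `G` with triangle `{b₁,b₂,b₃}`
and apex `a`. -/
def IsPyramid {V : Type*} (G : SimpleGraph V) (a b₁ b₂ b₃ : V)
    (P₁ : G.Walk a b₁) (P₂ : G.Walk a b₂) (P₃ : G.Walk a b₃) : Prop :=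
  IsInducedPathW G P₁ ∧ IsInducedPathW G P₂ ∧ IsInducedPathW G P₃ ∧
  G.Adj b₁ b₂ ∧ G.Adj b₂ b₃ ∧ G.Adj b₁ b₃ ∧
  ¬(G.Adj a b₁ ∧ G.Adj a b₂) ∧ ¬(G.Adj a b₁ ∧ G.Adj a b₃) ∧ ¬(G.Adj a b₂ ∧ G.Adj a b₃) ∧
  PyrPair G a b₁ b₂ P₁ P₂ ∧ PyrPair G a b₁ b₃ P₁ P₃ ∧ PyrPair G a b₂ b₃ P₂ P₃

/-- Compatibility condition for two paths of a prism: they are vertex-disjoint and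
the only edges between them are the two triangle edges `aᵢaⱼ` and `bᵢbⱼ`. -/
def PriPair {V : Type*} (G : SimpleGraph V) (ai bi aj bj : V)
    (Pi : G.Walk ai bi) (Pj : G.Walk aj bj) : Prop :=
  (∀ x : V, x ∈ Pi.support → x ∉ Pj.support) ∧
  (∀ x ∈ Pi.support, ∀ y ∈ Pj.support, G.Adj x y → (x = ai ∧ y = aj) ∨ (x = bi ∧ y = bj))

/-- The three paths `P₁, P₂, P₃` form a *prism* of `G` with triangles `{a₁,a₂,a₃}`
and `{b₁,b₂,b₃}`. -/
def IsPrism {V : Type*} (G : SimpleGraph V) (a₁ a₂ a₃ b₁ b₂ b₃ : V)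
    (P₁ : G.Walk a₁ b₁) (P₂ : G.Walk a₂ b₂) (P₃ : G.Walk a₃ b₃) : Prop :=
  IsInducedPathW G P₁ ∧ IsInducedPathW G P₂ ∧ IsInducedPathW G P₃ ∧
  G.Adj a₁ a₂ ∧ G.Adj a₂ a₃ ∧ G.Adj a₁ a₃ ∧
  G.Adj b₁ b₂ ∧ G.Adj b₂ b₃ ∧ G.Adj b₁ b₃ ∧
  a₁ ≠ b₁ ∧ a₂ ≠ b₂ ∧ a₃ ≠ b₃ ∧
  PriPair G a₁ b₁ a₂ b₂ P₁ P₂ ∧ PriPair G a₁ b₁ a₃ b₃ P₁ P₃ ∧ PriPair G a₂ b₂ a₃ b₃ P₂ P₃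

/-- `G` contains an induced pyramid. -/
def HasPyramid {V : Type*} (G : SimpleGraph V) : Prop :=
  ∃ (a b₁ b₂ b₃ : V) (P₁ : G.Walk a b₁) (P₂ : G.Walk a b₂) (P₃ : G.Walk a b₃),
    IsPyramid G a b₁ b₂ b₃ P₁ P₂ P₃

/-- `G` contains an induced prism. -/
def HasPrism {V : Type*} (G : SimpleGraph V) : Prop :=
  ∃ (a₁ a₂ a₃ b₁ b₂ b₃ : V) (P₁ : G.Walk a₁ b₁) (P₂ : G.Walk a₂ b₂) (P₃ : G.Walk a₃ b₃),
    IsPrism G a₁ a₂ a₃ b₁ b₂ b₃ P₁ P₂ P₃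

/-- `G` has an induced pyramid whose vertex set is exactly `S`. -/
def HasPyramidOn {V : Type*} [DecidableEq V] (G : SimpleGraph V) (S : Finset V) : Prop :=
  ∃ (a b₁ b₂ b₃ : V) (P₁ : G.Walk a b₁) (P₂ : G.Walk a b₂) (P₃ : G.Walk a b₃),
    IsPyramid G a b₁ b₂ b₃ P₁ P₂ P₃ ∧
    P₁.support.toFinset ∪ P₂.support.toFinset ∪ P₃.support.toFinset = S

/-- `G` has an induced prism whose vertex set is exactly `S`. -/
def HasPrismOn {V : Type*} [DecidableEq V] (G : SimpleGraph V) (S : Finset V) : Prop :=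
  ∃ (a₁ a₂ a₃ b₁ b₂ b₃ : V) (P₁ : G.Walk a₁ b₁) (P₂ : G.Walk a₂ b₂) (P₃ : G.Walk a₃ b₃),
    IsPrism G a₁ a₂ a₃ b₁ b₂ b₃ P₁ P₂ P₃ ∧
    P₁.support.toFinset ∪ P₂.support.toFinset ∪ P₃.support.toFinset = S

/-- `G` contains an antihole of length at least `5`, i.e. the complement of `G`
contains a hole of length at least `5`. -/
def HasAntiholeGE5 {V : Type*} (G : SimpleGraph V) : Prop :=
  ∃ (v : V) (c : Gᶜ.Walk v v), IsHoleW Gᶜ c ∧ 5 ≤ c.length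

/-- The class `𝒜`: graphs with no odd hole, no antihole of length at least `5`, and
no induced prism. -/
def InClassA {V : Type*} (G : SimpleGraph V) : Prop :=
  ¬ HasOddHole G ∧ ¬ HasAntiholeGE5 G ∧ ¬ HasPrism G

/-- `{x, y}` is an *even pair* of `G`: `x, y` are non-adjacent and every chordless
path between them has even length. -/
def EvenPair {V : Type*} (G : SimpleGraph V) (x y : V) : Prop :=
  x ≠ y ∧ ¬ G.Adj x y ∧ ∀ p : G.Walk x y, IsInducedPathW G p → Even p.length

/-- The contraction `G/xy` of the two (non-adjacent) vertices `x` and `y`, modelled on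
the vertex set `V ∖ {y}` with `x` playing the role of the contracted vertex: the
contracted vertex is adjacent to every vertex that was adjacent to `x` or to `y`. -/
def contractPair {V : Type*} (G : SimpleGraph V) (x y : V) :
    SimpleGraph {v : V // v ≠ y} :=
  SimpleGraph.fromRel (fun u v =>
    G.Adj u.1 v.1 ∨ (u.1 = x ∧ G.Adj y v.1) ∨ (v.1 = x ∧ G.Adj u.1 y))


namespace Artemis
variable {V : Type*} {G : SimpleGraph V}

/-- `p 0, …, p k` is an induced path. -/
def IsIP (G : SimpleGraph V) (p : ℕ → V) (k : ℕ) : Prop :=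
  ∀ i j, i < j → j ≤ k → p i ≠ p j ∧ (G.Adj (p i) (p j) ↔ j = i + 1)

/-- `S` is the vertex set of an induced path of length `k` from `x` to `y`. -/
def IPL (G : SimpleGraph V) (x y : V) (k : ℕ) (S : Set V) : Prop :=
  ∃ p : ℕ → V, IsIP G p k ∧ p 0 = x ∧ p k = y ∧ S = {v | ∃ i, i ≤ k ∧ p i = v}

theorem IsIP.mono {p : ℕ → V} {k m : ℕ} (h : IsIP G p k) (hm : m ≤ k) : IsIP G p m :=
  fun i j hij hj => h i j hij (hj.trans hm)

theorem IsIP.shift {p : ℕ → V} {k : ℕ} (h : IsIP G p k) (a : ℕ) :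
    IsIP G (fun n => p (a + n)) (k - a) := by
  intro i j hij hj
  have := h (a + i) (a + j) (by omega) (by omega)
  refine ⟨this.1, this.2.trans ?_⟩
  omega

theorem IsIP.rev {p : ℕ → V} {k : ℕ} (h : IsIP G p k) :
    IsIP G (fun n => p (k - n)) k := by
  intro i j hij hj
  have := h (k - j) (k - i) (by omega) (by omega)
  refine ⟨this.1.symm, ?_⟩
  rw [G.adj_comm, this.2]
  omega

theorem IsIP.inj {p : ℕ → V} {k : ℕ} (h : IsIP G p k) {i j : ℕ} (hi : i ≤ k) (hj : j ≤ k)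
    (e : p i = p j) : i = j := by
  rcases lt_trichotomy i j with h1 | h1 | h1
  · exact absurd e (h i j h1 hj).1
  · exact h1
  · exact absurd e.symm (h j i h1 hi).1

theorem IsIP.adj {p : ℕ → V} {k : ℕ} (h : IsIP G p k) {i j : ℕ} (hi : i ≤ k) (hj : j ≤ k) :
    G.Adj (p i) (p j) ↔ (j = i + 1 ∨ i = j + 1) := by
  rcases lt_trichotomy i j with h1 | h1 | h1
  · rw [(h i j h1 hj).2]; omega
  · subst h1; simp
  · rw [G.adj_comm, (h j i h1 hi).2]; omega

theorem IsIP.ipl {p : ℕ → V} {k : ℕ} (h : IsIP G p k) {a b : ℕ} (hab : a ≤ b) (hb : b ≤ k) :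
    IPL G (p a) (p b) (b - a) {v | ∃ i, a ≤ i ∧ i ≤ b ∧ p i = v} := by
  refine ⟨fun n => p (a + n), (h.mono hb).shift a, rfl, ?_, ?_⟩
  · show p (a + (b - a)) = p b
    congr 1; omega
  · ext v
    constructor
    · rintro ⟨i, h1, h2, rfl⟩
      exact ⟨i - a, by omega, by show p _ = _; congr 1; omega⟩
    · rintro ⟨i, h1, rfl⟩
      exact ⟨a + i, by omega, by omega, rfl⟩

theorem IPL.symm {x y : V} {k : ℕ} {S : Set V} (h : IPL G x y k S) : IPL G y x k S := by
  obtain ⟨p, hp, rfl, rfl, rfl⟩ := h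
  refine ⟨_, hp.rev, by simp, by simp, ?_⟩
  ext v
  constructor
  · rintro ⟨i, h1, rfl⟩
    exact ⟨k - i, by omega, by show p _ = _; congr 1; omega⟩
  · rintro ⟨i, h1, rfl⟩
    exact ⟨k - i, by omega, rfl⟩

theorem IPL.left {x y : V} {k : ℕ} {S : Set V} (h : IPL G x y k S) : x ∈ S := by
  obtain ⟨p, hp, rfl, rfl, rfl⟩ := h
  exact ⟨0, by omega, rfl⟩

theorem IPL.right {x y : V} {k : ℕ} {S : Set V} (h : IPL G x y k S) : y ∈ S := h.symm.left

theorem IPL.single (G : SimpleGraph V) (x : V) : IPL G x x 0 {x} := by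
  refine ⟨fun _ => x, ?_, rfl, rfl, ?_⟩
  · intro i j h1 h2; omega
  · ext v
    constructor
    · rintro rfl; exact ⟨0, le_rfl, rfl⟩
    · rintro ⟨i, -, rfl⟩; rfl

theorem IPL.zero {x y : V} {S : Set V} (h : IPL G x y 0 S) : x = y ∧ S = {x} := by
  obtain ⟨p, hp, rfl, h2, rfl⟩ := h
  refine ⟨h2, ?_⟩
  ext v
  constructor
  · rintro ⟨i, h1, rfl⟩
    obtain rfl : i = 0 := by omega
    rfl
  · rintro rfl; exact ⟨0, le_rfl, rfl⟩

theorem IPL.zero_iff {x y : V} {k : ℕ} {S : Set V} (h : IPL G x y k S) : k = 0 ↔ x = y := by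
  constructor
  · rintro rfl; exact h.zero.1
  · obtain ⟨p, hp, rfl, rfl, rfl⟩ := h
    intro e
    exact (hp.inj (by omega) le_rfl e).symm

theorem IPL.one_iff {x y : V} {k : ℕ} {S : Set V} (h : IPL G x y k S) : k = 1 ↔ G.Adj x y := by
  obtain ⟨p, hp, rfl, rfl, rfl⟩ := h
  rw [hp.adj (by omega) le_rfl]
  omega

theorem IPL.one {x y : V} {S : Set V} (h : IPL G x y 1 S) : S = {x, y} := by
  obtain ⟨p, hp, rfl, rfl, rfl⟩ := h
  ext v
  constructor
  · rintro ⟨i, h1, rfl⟩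
    have : i = 0 ∨ i = 1 := by omega
    rcases this with rfl | rfl <;> simp
  · rintro (rfl | rfl)
    · exact ⟨0, by omega, rfl⟩
    · exact ⟨1, by omega, rfl⟩

theorem IsIP.append {p q : ℕ → V} {k m : ℕ} (hp : IsIP G p k) (hq : IsIP G q m)
    (hadj : G.Adj (p k) (q 0))
    (hdis : ∀ i j, i ≤ k → j ≤ m → p i ≠ q j)
    (hed : ∀ i j, i ≤ k → j ≤ m → G.Adj (p i) (q j) → i = k ∧ j = 0) :
    IsIP G (fun n => if n ≤ k then p n else q (n - k - 1)) (k + m + 1) := by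
  intro i j hij hj
  by_cases h1 : j ≤ k
  · have h2 : i ≤ k := by omega
    simp only [h1, h2, if_true]
    exact hp i j hij h1
  · by_cases h2 : i ≤ k
    · simp only [h1, h2, if_true, if_false]
      refine ⟨hdis _ _ h2 (by omega), ?_⟩
      constructor
      · intro h
        have := hed _ _ h2 (by omega) h
        omega
      · intro h
        have e1 : i = k := by omega
        have e2 : j - k - 1 = 0 := by omega
        rw [e2, e1]; exact hadj
    · simp only [h1, h2, if_false]
      have := hq (i - k - 1) (j - k - 1) (by omega) (by omega)
      refine ⟨this.1, this.2.trans ?_⟩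
      omega

theorem IPL.append {x y x' y' : V} {k m : ℕ} {S S' : Set V} (h : IPL G x y k S)
    (h' : IPL G x' y' m S') (hadj : G.Adj y x') (hdis : ∀ u ∈ S, u ∉ S')
    (hed : ∀ u ∈ S, ∀ v ∈ S', G.Adj u v → u = y ∧ v = x') :
    IPL G x y' (k + m + 1) (S ∪ S') := by
  obtain ⟨p, hp, rfl, rfl, rfl⟩ := h
  obtain ⟨q, hq, rfl, rfl, rfl⟩ := h'
  refine ⟨_, hp.append hq hadj ?_ ?_, ?_, ?_, ?_⟩
  · intro i j hi hj e
    exact hdis _ ⟨i, hi, rfl⟩ ⟨j, hj, e.symm⟩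
  · intro i j hi hj e
    have := hed _ ⟨i, hi, rfl⟩ _ ⟨j, hj, rfl⟩ e
    exact ⟨hp.inj hi le_rfl this.1, hq.inj hj (by omega) this.2⟩
  · simp
  · have : ¬ (k + m + 1 ≤ k) := by omega
    simp only [this, if_false]
    congr 1; omega
  · ext v
    constructor
    · rintro (⟨i, h1, rfl⟩ | ⟨i, h1, rfl⟩)
      · exact ⟨i, by omega, by simp [h1]⟩
      · refine ⟨k + 1 + i, by omega, ?_⟩
        have : ¬ (k + 1 + i ≤ k) := by omega
        simp only [this, if_false]
        congr 1; omega
    · rintro ⟨i, h1, rfl⟩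
      by_cases h2 : i ≤ k
      · left; exact ⟨i, h2, by simp [h2]⟩
      · right; exact ⟨i - k - 1, by omega, by simp [h2]⟩

theorem IPL.cons {x x' y' : V} {m : ℕ} {S' : Set V}
    (h' : IPL G x' y' m S') (hadj : G.Adj x x') (hdis : x ∉ S')
    (hed : ∀ v ∈ S', G.Adj x v → v = x') :
    IPL G x y' (m + 1) (insert x S') := by
  have := (IPL.single G x).append h' hadj (by rintro u rfl; exact hdis)
    (by rintro u rfl v hv h; exact ⟨rfl, hed v hv h⟩)
  rw [Set.singleton_union] at this
  convert this using 1
  omega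

theorem IPL.snoc {x y z : V} {m : ℕ} {S : Set V}
    (h : IPL G x y m S) (hadj : G.Adj y z) (hdis : z ∉ S)
    (hed : ∀ v ∈ S, G.Adj z v → v = y) :
    IPL G x z (m + 1) (insert z S) :=
  (h.symm.cons hadj.symm hdis hed).symm

/-- Cut a path after a vertex `w`. -/
theorem IPL.cut {x y w : V} {k : ℕ} {S : Set V} (h : IPL G x y k S) (hw : w ∈ S) (hwy : w ≠ y) :
    ∃ i w' S1 S2, i < k ∧ IPL G x w i S1 ∧ IPL G w' y (k - i - 1) S2 ∧ S = S1 ∪ S2 ∧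
      (∀ u ∈ S1, u ∉ S2) ∧ G.Adj w w' ∧ (∀ u ∈ S1, ∀ v ∈ S2, G.Adj u v → u = w ∧ v = w') := by
  obtain ⟨p, hp, rfl, rfl, rfl⟩ := h
  obtain ⟨i, hi, rfl⟩ := hw
  have hik : i < k := by
    rcases Nat.lt_or_ge i k with h | h
    · exact h
    · exact absurd (congrArg p (by omega)) hwy
  refine ⟨i, p (i + 1), _, {v | ∃ j, i + 1 ≤ j ∧ j ≤ k ∧ p j = v}, hik, hp.ipl (Nat.zero_le i) hi,
    ?_, ?_, ?_, ?_, ?_⟩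
  · have := hp.ipl (a := i + 1) (b := k) hik le_rfl
    convert this using 1
    omega
  · ext v
    constructor
    · rintro ⟨j, hj, rfl⟩
      by_cases h2 : j ≤ i
      · left; exact ⟨j, by omega, h2, rfl⟩
      · right; exact ⟨j, by omega, hj, rfl⟩
    · rintro (⟨j, h1, h2, rfl⟩ | ⟨j, h1, h2, rfl⟩)
      · exact ⟨j, by omega, rfl⟩
      · exact ⟨j, by omega, rfl⟩
  · rintro u ⟨j, h1, h2, rfl⟩ ⟨l, h3, h4, e⟩
    have := hp.inj (by omega) (by omega) e
    omega
  · rw [hp.adj (by omega) (by omega)]; omega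
  · rintro u ⟨j, h1, h2, rfl⟩ v ⟨l, h3, h4, rfl⟩ e
    rw [hp.adj (by omega) (by omega)] at e
    have e1 : j = i := by omega
    have e2 : l = i + 1 := by omega
    subst e1; subst e2; exact ⟨rfl, rfl⟩

/-- Split at a vertex. -/
theorem IPL.split {x y w : V} {k : ℕ} {S : Set V} (h : IPL G x y k S) (hw : w ∈ S) :
    ∃ i j S1 S2, i + j = k ∧ IPL G x w i S1 ∧ IPL G w y j S2 ∧ S = S1 ∪ S2 ∧
      (∀ u ∈ S1, u ∈ S2 → u = w) ∧ (∀ u ∈ S1, ∀ v ∈ S2, G.Adj u v → u = w ∨ v = w) := by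
  obtain ⟨p, hp, rfl, rfl, rfl⟩ := h
  obtain ⟨i, hi, rfl⟩ := hw
  refine ⟨i, k - i, _, _, by omega, hp.ipl (Nat.zero_le i) hi, hp.ipl hi le_rfl, ?_, ?_, ?_⟩
  · ext v
    constructor
    · rintro ⟨j, hj, rfl⟩
      by_cases h2 : j ≤ i
      · left; exact ⟨j, by omega, h2, rfl⟩
      · right; exact ⟨j, by omega, hj, rfl⟩
    · rintro (⟨j, h1, h2, rfl⟩ | ⟨j, h1, h2, rfl⟩)
      · exact ⟨j, by omega, rfl⟩
      · exact ⟨j, by omega, rfl⟩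
  · rintro u ⟨j, h1, h2, rfl⟩ ⟨l, h3, h4, e⟩
    have := hp.inj (by omega) (by omega) e
    congr 1; omega
  · rintro u ⟨j, h1, h2, rfl⟩ v ⟨l, h3, h4, rfl⟩ e
    rw [hp.adj (by omega) (by omega)] at e
    have : j = i ∨ l = i := by omega
    rcases this with rfl | rfl <;> simp

/-- First vertex with property `P`. -/
theorem IPL.first {x y : V} {k : ℕ} {S : Set V} (h : IPL G x y k S) (P : V → Prop)
    (hP : ∃ w ∈ S, P w) :
    ∃ w i j S1 S2, i + j = k ∧ P w ∧ IPL G x w i S1 ∧ IPL G w y j S2 ∧ S = S1 ∪ S2 ∧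
      (∀ u ∈ S1, P u → u = w) ∧
      (∀ u ∈ S1, u ∈ S2 → u = w) ∧ (∀ u ∈ S1, ∀ v ∈ S2, G.Adj u v → u = w ∨ v = w) := by
  classical
  have key : ∃ w, ∃ i j S1 S2, i + j = k ∧ P w ∧ IPL G x w i S1 ∧ IPL G w y j S2 ∧ S = S1 ∪ S2 ∧
      (∀ u ∈ S1, u ∈ S2 → u = w) ∧ (∀ u ∈ S1, ∀ v ∈ S2, G.Adj u v → u = w ∨ v = w) := by
    obtain ⟨w, hw, hPw⟩ := hP
    obtain ⟨i, j, S1, S2, h1, h2⟩ := h.split hw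
    exact ⟨w, i, j, S1, S2, h1, hPw, h2⟩
  have key2 : ∃ i, ∃ w j S1 S2, i + j = k ∧ P w ∧ IPL G x w i S1 ∧ IPL G w y j S2 ∧ S = S1 ∪ S2 ∧
      (∀ u ∈ S1, u ∈ S2 → u = w) ∧ (∀ u ∈ S1, ∀ v ∈ S2, G.Adj u v → u = w ∨ v = w) := by
    obtain ⟨w, i, j, S1, S2, h⟩ := key
    exact ⟨i, w, j, S1, S2, h⟩
  clear key
  obtain ⟨p, hp, rfl, rfl, rfl⟩ := h
  have hex : ∃ i, i ≤ k ∧ P (p i) := by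
    obtain ⟨w, ⟨i, hi, rfl⟩, hw⟩ := hP
    exact ⟨i, hi, hw⟩
  obtain ⟨hi, hPi⟩ := Nat.find_spec hex
  have hmin := fun m (hm : m < Nat.find hex) => Nat.find_min hex hm
  set i := Nat.find hex with hidef
  refine ⟨p i, i, k - i, _, _, by omega, hPi, hp.ipl (Nat.zero_le i) hi, hp.ipl hi le_rfl, ?_, ?_, ?_, ?_⟩
  · ext v
    constructor
    · rintro ⟨j, hj, rfl⟩
      by_cases h2 : j ≤ i
      · left; exact ⟨j, by omega, h2, rfl⟩
      · right; exact ⟨j, by omega, hj, rfl⟩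
    · rintro (⟨j, h1, h2, rfl⟩ | ⟨j, h1, h2, rfl⟩)
      · exact ⟨j, by omega, rfl⟩
      · exact ⟨j, by omega, rfl⟩
  · rintro u ⟨j, h1, h2, rfl⟩ hu
    by_contra hne
    have : j < i := lt_of_le_of_ne h2 (fun e => hne (by rw [e]))
    exact hmin j this ⟨by omega, hu⟩
  · rintro u ⟨j, h1, h2, rfl⟩ ⟨l, h3, h4, e⟩
    have := hp.inj (by omega) (by omega) e
    congr 1; omega
  · rintro u ⟨j, h1, h2, rfl⟩ v ⟨l, h3, h4, rfl⟩ e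
    rw [hp.adj (by omega) (by omega)] at e
    have : j = i ∨ l = i := by omega
    rcases this with e | e <;> subst e <;> simp

/-- The three possibilities for the extreme `P`-vertices of a path. -/
theorem IPL.trich {x y : V} {k : ℕ} {S : Set V} (h : IPL G x y k S) (P : V → Prop)
    (hP : ∃ w ∈ S, P w) :
    (∃ w i j S1 S2, i + j = k ∧ P w ∧ IPL G x w i S1 ∧ IPL G w y j S2 ∧ S = S1 ∪ S2 ∧
      (∀ u ∈ S1, u ∈ S2 → u = w) ∧ (∀ u ∈ S1, ∀ v ∈ S2, G.Adj u v → u = w ∨ v = w) ∧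
      (∀ u ∈ S, P u → u = w)) ∨
    (∃ w w' i j S1 S2, i + j + 1 = k ∧ P w ∧ P w' ∧ G.Adj w w' ∧ IPL G x w i S1 ∧
      IPL G w' y j S2 ∧ S = S1 ∪ S2 ∧ (∀ u ∈ S1, u ∉ S2) ∧
      (∀ u ∈ S1, ∀ v ∈ S2, G.Adj u v → u = w ∧ v = w') ∧
      (∀ u ∈ S1, P u → u = w) ∧ (∀ u ∈ S2, P u → u = w')) ∨
    (∃ w w' i j S1 S2, i + j + 2 ≤ k ∧ P w ∧ P w' ∧ IPL G x w i S1 ∧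
      IPL G w' y j S2 ∧ S1 ∪ S2 ⊆ S ∧ (∀ u ∈ S1, u ∉ S2) ∧
      (∀ u ∈ S1, ∀ v ∈ S2, ¬ G.Adj u v) ∧
      (∀ u ∈ S1, P u → u = w) ∧ (∀ u ∈ S2, P u → u = w')) := by
  classical
  obtain ⟨p, hp, rfl, rfl, rfl⟩ := h
  have hex : ∃ i, i ≤ k ∧ P (p i) := by
    obtain ⟨w, ⟨i, hi, rfl⟩, hw⟩ := hP
    exact ⟨i, hi, hw⟩
  have hex2 : ∃ i, i ≤ k ∧ P (p (k - i)) := by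
    obtain ⟨i, hi, hw⟩ := hex
    exact ⟨k - i, by omega, by rwa [show k - (k - i) = i by omega]⟩
  obtain ⟨hi, hPi⟩ := Nat.find_spec hex
  have hmin := fun m (hm : m < Nat.find hex) => Nat.find_min hex hm
  set i := Nat.find hex with hidef
  obtain ⟨hj', hPj⟩ := Nat.find_spec hex2
  have hmax' := fun m (hm : m < Nat.find hex2) => Nat.find_min hex2 hm
  set j' := Nat.find hex2 with hjdef
  obtain ⟨j, hj⟩ : ∃ j, j = k - j' := ⟨_, rfl⟩
  rw [← hj] at hPj
  have hmax : ∀ m, j < m → m ≤ k → ¬ P (p m) := by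
    intro m h1 h2 h3
    refine hmax' (k - m) (by omega) ⟨by omega, ?_⟩
    rwa [show k - (k - m) = m by omega]
  have hij : i ≤ j := by
    by_contra hlt
    exact hmin j (by omega) ⟨by omega, hPj⟩
  have hjk : j ≤ k := by omega
  clear_value i j'
  have hunL : ∀ a, a ≤ i → P (p a) → a = i := by
    intro a h1 h2
    by_contra hne
    exact hmin a (by omega) ⟨by omega, h2⟩
  have hunR : ∀ a, j ≤ a → a ≤ k → P (p a) → a = j := by
    intro a h1 h2 h3
    by_contra hne
    exact hmax a (by omega) h2 h3
  rcases Nat.eq_or_lt_of_le hij with e | hlt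
  · subst e
    left
    refine ⟨p i, i, k - i, _, _, by omega, hPi, hp.ipl (Nat.zero_le i) hi, hp.ipl hi le_rfl,
      ?_, ?_, ?_, ?_⟩
    · ext v
      constructor
      · rintro ⟨j, hj, rfl⟩
        by_cases h2 : j ≤ i
        · left; exact ⟨j, by omega, h2, rfl⟩
        · right; exact ⟨j, by omega, hj, rfl⟩
      · rintro (⟨j, h1, h2, rfl⟩ | ⟨j, h1, h2, rfl⟩)
        · exact ⟨j, by omega, rfl⟩
        · exact ⟨j, by omega, rfl⟩
    · rintro u ⟨j, h1, h2, rfl⟩ ⟨l, h3, h4, e⟩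
      have := hp.inj (by omega) (by omega) e
      congr 1; omega
    · rintro u ⟨j, h1, h2, rfl⟩ v ⟨l, h3, h4, rfl⟩ e
      rw [hp.adj (by omega) (by omega)] at e
      have : j = i ∨ l = i := by omega
      rcases this with e | e <;> subst e <;> simp
    · rintro u ⟨a, ha, rfl⟩ hu
      rcases Nat.le_total a i with h1 | h1
      · rw [hunL a h1 hu]
      · rw [hunR a h1 ha hu]
  · right
    have common1 : ∀ u ∈ {v | ∃ a, 0 ≤ a ∧ a ≤ i ∧ p a = v}, u ∉ {v | ∃ a, j ≤ a ∧ a ≤ k ∧ p a = v} := by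
      rintro u ⟨a, h1, h2, rfl⟩ ⟨l, h3, h4, e⟩
      have := hp.inj (by omega) (by omega) e
      omega
    have common2 : ∀ u ∈ {v | ∃ a, 0 ≤ a ∧ a ≤ i ∧ p a = v}, P u → u = p i := by
      rintro u ⟨a, -, h2, rfl⟩ hu
      rw [hunL a h2 hu]
    have common3 : ∀ u ∈ {v | ∃ a, j ≤ a ∧ a ≤ k ∧ p a = v}, P u → u = p j := by
      rintro u ⟨a, h1, h2, rfl⟩ hu
      rw [hunR a h1 h2 hu]
    by_cases h1 : j = i + 1
    · left
      refine ⟨p i, p j, i, k - j, _, _, by omega, hPi, hPj, ?_, hp.ipl (Nat.zero_le i) hi,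
        hp.ipl hjk le_rfl, ?_, common1, ?_, common2, common3⟩
      · rw [hp.adj hi hjk]; omega
      · ext v
        constructor
        · rintro ⟨a, ha, rfl⟩
          by_cases h2 : a ≤ i
          · left; exact ⟨a, by omega, h2, rfl⟩
          · right; exact ⟨a, by omega, ha, rfl⟩
        · rintro (⟨j, h1, h2, rfl⟩ | ⟨j, h1, h2, rfl⟩)
          · exact ⟨j, by omega, rfl⟩
          · exact ⟨j, by omega, rfl⟩
      · rintro u ⟨a, h1, h2, rfl⟩ v ⟨l, h3, h4, rfl⟩ e
        rw [hp.adj (by omega) (by omega)] at e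
        have e1 : a = i := by omega
        have e2 : l = j := by omega
        rw [e1, e2]; exact ⟨rfl, rfl⟩
    · right
      refine ⟨p i, p j, i, k - j, _, _, by omega, hPi, hPj, hp.ipl (Nat.zero_le i) hi,
        hp.ipl hjk le_rfl, ?_, common1, ?_, common2, common3⟩
      · rintro v (⟨j, h1, h2, rfl⟩ | ⟨j, h1, h2, rfl⟩)
        · exact ⟨j, by omega, rfl⟩
        · exact ⟨j, by omega, rfl⟩
      · rintro u ⟨a, h1, h2, rfl⟩ v ⟨l, h3, h4, rfl⟩ e
        rw [hp.adj (by omega) (by omega)] at e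
        omega

/-- Join two paths at a shared vertex. -/
theorem IPL.join {x y z : V} {k m : ℕ} {S S' : Set V} (h : IPL G x y k S)
    (h' : IPL G y z m S') (hdis : ∀ u ∈ S, u ∈ S' → u = y)
    (hed : ∀ u ∈ S, ∀ v ∈ S', G.Adj u v → u = y ∨ v = y) :
    IPL G x z (k + m) (S ∪ S') := by
  by_cases hyz : y = z
  · subst hyz
    have : m = 0 := h'.zero_iff.2 rfl
    subst this
    rw [h'.zero.2]
    have : S ∪ {y} = S := by
      ext v; constructor
      · rintro (h1 | rfl)
        · exact h1
        · exact h.right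
      · exact Or.inl
    rw [this]; exact h
  · obtain ⟨i, w', S1, S2, hi, h1, h2, e, hd, ha, he⟩ := h'.cut h'.left hyz
    have : i = 0 := h1.zero_iff.2 rfl
    subst this
    have hS1 := h1.zero.2
    subst hS1; subst e
    have := h.append h2 ha ?_ ?_
    · convert this using 1
      · omega
      · ext v; constructor
        · rintro (h3 | h3 | h3)
          · exact Or.inl h3
          · rw [h3]; exact Or.inl h.right
          · exact Or.inr h3
        · rintro (h3 | h3)
          · exact Or.inl h3
          · exact Or.inr (Or.inr h3)
    · intro u hu hu'
      have := hdis u hu (Or.inr hu')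
      subst this
      exact hd u rfl hu'
    · intro u hu v hv huv
      have h3 : v ≠ y := by rintro rfl; exact hd v rfl hv
      have h4 := (hed u hu v (Or.inr hv) huv).resolve_right h3
      subst h4
      exact ⟨rfl, (he u rfl v hv huv).2⟩

/-- Remove the first vertex. -/
theorem IPL.tail {x y : V} {k : ℕ} {S : Set V} (h : IPL G x y k S) (hk : x ≠ y) :
    ∃ w' S2, IPL G w' y (k - 1) S2 ∧ S = insert x S2 ∧ x ∉ S2 ∧ G.Adj x w' ∧
      (∀ v ∈ S2, G.Adj x v → v = w') := by
  obtain ⟨i, w', S1, S2, hi, h1, h2, e, hd, ha, he⟩ := h.cut h.left hk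
  have : i = 0 := h1.zero_iff.2 rfl
  subst this
  have hS1 := h1.zero.2
  subst hS1
  exact ⟨w', S2, by simpa using h2, by rw [e]; rfl, hd x rfl, ha, fun v hv hv' => (he x rfl v hv hv').2⟩

theorem IPL.two_of_common {x y w : V} {k : ℕ} {S : Set V} (h : IPL G x y k S) (hw : w ∈ S)
    (h1 : G.Adj w x) (h2 : G.Adj w y) : k ≤ 2 := by
  obtain ⟨p, hp, rfl, rfl, rfl⟩ := h
  obtain ⟨i, hi, rfl⟩ := hw
  rw [hp.adj hi (by omega)] at h1
  rw [hp.adj hi (by omega)] at h2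
  omega

/-- Connected set. -/
def Conn (G : SimpleGraph V) (F : Set V) : Prop :=
  ∀ x ∈ F, ∀ y ∈ F, Relation.ReflTransGen (fun u v => G.Adj u v ∧ v ∈ F) x y

theorem Conn.single (G : SimpleGraph V) (x : V) : Conn G {x} := by
  rintro a rfl b rfl; exact Relation.ReflTransGen.refl

theorem rtg_mono {F F' : Set V} (h : F ⊆ F') {x y : V}
    (hr : Relation.ReflTransGen (fun u v => G.Adj u v ∧ v ∈ F) x y) :
    Relation.ReflTransGen (fun u v => G.Adj u v ∧ v ∈ F') x y :=
  Relation.ReflTransGen.mono (fun _ _ h1 => ⟨h1.1, h h1.2⟩) _ _ hr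

theorem Conn.union {F F' : Set V} (h : Conn G F) (h' : Conn G F')
    (ht : ∃ u ∈ F, ∃ v ∈ F', u = v ∨ G.Adj u v) : Conn G (F ∪ F') := by
  obtain ⟨u, hu, v, hv, huv⟩ := ht
  have e1 : Relation.ReflTransGen (fun u v => G.Adj u v ∧ v ∈ F ∪ F') u v := by
    rcases huv with rfl | huv
    · exact Relation.ReflTransGen.refl
    · exact Relation.ReflTransGen.single ⟨huv, Or.inr hv⟩
  have e2 : Relation.ReflTransGen (fun u v => G.Adj u v ∧ v ∈ F ∪ F') v u := by
    rcases huv with rfl | huv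
    · exact Relation.ReflTransGen.refl
    · exact Relation.ReflTransGen.single ⟨huv.symm, Or.inl hu⟩
  rintro a (ha | ha) b (hb | hb)
  · exact rtg_mono Set.subset_union_left (h a ha b hb)
  · exact ((rtg_mono Set.subset_union_left (h a ha u hu)).trans e1).trans
      (rtg_mono Set.subset_union_right (h' v hv b hb))
  · exact ((rtg_mono Set.subset_union_right (h' a ha v hv)).trans e2).trans
      (rtg_mono Set.subset_union_left (h u hu b hb))
  · exact rtg_mono Set.subset_union_right (h' a ha b hb)

theorem Conn.ins {F : Set V} (h : Conn G F) {x : V}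
    (ht : ∃ v ∈ F, G.Adj x v) : Conn G (insert x F) := by
  rw [← Set.singleton_union]
  obtain ⟨v, hv, hxv⟩ := ht
  exact (Conn.single G x).union h ⟨x, rfl, v, hv, Or.inr hxv⟩

theorem isIP_conn {p : ℕ → V} (a b : ℕ) (hp : ∀ i, a ≤ i → i < b → G.Adj (p i) (p (i + 1))) :
    Conn G {v | ∃ i, a ≤ i ∧ i ≤ b ∧ p i = v} := by
  have key : ∀ n i, a ≤ i → i + n ≤ b →
      Relation.ReflTransGen (fun u v => G.Adj u v ∧ v ∈ {v | ∃ i, a ≤ i ∧ i ≤ b ∧ p i = v}) (p i) (p (i + n)) ∧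
      Relation.ReflTransGen (fun u v => G.Adj u v ∧ v ∈ {v | ∃ i, a ≤ i ∧ i ≤ b ∧ p i = v}) (p (i + n)) (p i) := by
    intro n
    induction n with
    | zero => intro i _ _; exact ⟨Relation.ReflTransGen.refl, Relation.ReflTransGen.refl⟩
    | succ n ih =>
      intro i h1 h2
      obtain ⟨e1, e2⟩ := ih i h1 (by omega)
      have := hp (i + n) (by omega) (by omega)
      exact ⟨e1.tail ⟨this, ⟨i + (n + 1), by omega, by omega, rfl⟩⟩,
        Relation.ReflTransGen.head ⟨this.symm, ⟨i + n, by omega, by omega, rfl⟩⟩ e2⟩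
  rintro x ⟨i, h1, h2, rfl⟩ y ⟨j, h3, h4, rfl⟩
  rcases Nat.le_total i j with h | h
  · obtain ⟨n, rfl⟩ := Nat.exists_eq_add_of_le h
    exact (key n i h1 (by omega)).1
  · obtain ⟨n, rfl⟩ := Nat.exists_eq_add_of_le h
    exact (key n j h3 (by omega)).2

theorem IPL.conn {x y : V} {k : ℕ} {S : Set V} (h : IPL G x y k S) : Conn G S := by
  obtain ⟨p, hp, rfl, rfl, rfl⟩ := h
  have := isIP_conn (G := G) (p := p) 0 k (fun i _ h2 => (hp.adj (by omega) (by omega)).2 (Or.inl rfl))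
  simpa using this

/-- shortest path inside a connected set. -/
theorem Conn.path {F : Set V} (h : Conn G F) {x y : V} (hx : x ∈ F) (hy : y ∈ F) (P Q : V → Prop)
    (hP : P x) (hQ : Q y) :
    ∃ u v k S, IPL G u v k S ∧ S ⊆ F ∧ P u ∧ Q v ∧ (∀ w ∈ S, P w → w = u) ∧
      (∀ w ∈ S, Q w → w = v) := by
  classical
  have hex : ∃ k, ∃ p : ℕ → V, P (p 0) ∧ Q (p k) ∧ (∀ i, i ≤ k → p i ∈ F) ∧
      ∀ i, i < k → G.Adj (p i) (p (i + 1)) := by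
    have key : ∀ z, Relation.ReflTransGen (fun u v => G.Adj u v ∧ v ∈ F) x z →
      ∃ k, ∃ p : ℕ → V, p 0 = x ∧ p k = z ∧ (∀ i, i ≤ k → p i ∈ F) ∧
      ∀ i, i < k → G.Adj (p i) (p (i + 1)) := by
      intro z hz
      induction hz with
      | refl => exact ⟨0, fun _ => x, rfl, rfl, fun _ _ => hx, fun i hi => by omega⟩
      | tail h1 h2 ih =>
        obtain ⟨k, p, h3, h4, h5, h6⟩ := ih
        rename_i b c
        refine ⟨k + 1, fun n => if n ≤ k then p n else c, by simp [h3], by simp, ?_, ?_⟩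
        · intro i hi
          by_cases h : i ≤ k
          · simp only [h, if_true]; exact h5 i h
          · simp only [h, if_false]; exact h2.2
        · intro i hi
          by_cases h : i + 1 ≤ k
          · have h' : i ≤ k := by omega
            simp only [h, h', if_true]; exact h6 i (by omega)
          · obtain rfl : i = k := by omega
            simp [h4, h2.1]
    obtain ⟨k, p, h1, h2, h3⟩ := key y (h x hx y hy)
    exact ⟨k, p, by rwa [h1], by rwa [h2], h3⟩
  obtain ⟨p, h1, h2, h3, h4⟩ := Nat.find_spec hex
  have hmin := fun m (hm : m < Nat.find hex) => Nat.find_min hex hm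
  set k := Nat.find hex with hk
  clear_value k
  have skip : ∀ i j, i + 1 < j → j ≤ k → ¬ G.Adj (p i) (p j) := by
    intro i j hij hj hadj
    refine hmin (k - (j - i - 1)) (by omega) ⟨fun n => if n ≤ i then p n else p (n + (j - i - 1)), ?_, ?_, ?_, ?_⟩
    · simpa using h1
    · have : ¬ (k - (j - i - 1) ≤ i) := by omega
      simp only [this, if_false]
      rwa [show k - (j - i - 1) + (j - i - 1) = k by omega]
    · intro n hn
      by_cases h : n ≤ i
      · simp only [h, if_true]; exact h3 n (by omega)
      · simp only [h, if_false]; exact h3 _ (by omega)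
    · intro n hn
      by_cases h : n + 1 ≤ i
      · have h' : n ≤ i := by omega
        simp only [h, h', if_true]; exact h4 n (by omega)
      · by_cases h' : n ≤ i
        · simp only [h, h', if_true, if_false]
          obtain rfl : n = i := by omega
          rwa [show n + 1 + (j - n - 1) = j by omega]
        · simp only [h, h', if_false]
          have := h4 (n + (j - i - 1)) (by omega)
          rwa [show n + 1 + (j - i - 1) = n + (j - i - 1) + 1 by omega]
  have hP' : ∀ i, 0 < i → i ≤ k → ¬ P (p i) := by
    intro i h0 hi hPi
    refine hmin (k - i) (by omega) ⟨fun n => p (i + n), by simpa using hPi, ?_, ?_, ?_⟩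
    · show Q (p (i + (k - i)))
      rwa [show i + (k - i) = k by omega]
    · intro n hn; exact h3 _ (by omega)
    · intro n hn; exact h4 _ (by omega)
  have hQ' : ∀ i, i < k → ¬ Q (p i) := by
    intro i hi hQi
    exact hmin i hi ⟨p, h1, hQi, fun n hn => h3 n (by omega), fun n hn => h4 n (by omega)⟩
  have hne : ∀ i j, i < j → j ≤ k → p i ≠ p j := by
    intro i j hij hj e
    by_cases hjk : j = k
    · subst hjk
      exact hQ' i hij (by rwa [e])
    · have := h4 j (by omega)
      rw [← e] at this
      exact skip i (j + 1) (by omega) (by omega) this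
  have hip : IsIP G p k := by
    intro i j hij hj
    refine ⟨hne i j hij hj, ?_, ?_⟩
    · intro ha
      by_contra hh
      exact skip i j (by omega) hj ha
    · rintro rfl; exact h4 i (by omega)
  refine ⟨p 0, p k, k, _, ⟨p, hip, rfl, rfl, rfl⟩, ?_, h1, h2, ?_, ?_⟩
  · rintro v ⟨i, hi, rfl⟩; exact h3 i hi
  · rintro v ⟨i, hi, rfl⟩ hv
    rcases Nat.eq_zero_or_pos i with rfl | h0
    · rfl
    · exact absurd hv (hP' i h0 hi)
  · rintro v ⟨i, hi, rfl⟩ hv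
    rcases Nat.eq_or_lt_of_le hi with rfl | h0
    · rfl
    · exact absurd hv (hQ' i h0)

theorem Conn.noncut [Finite V] {H : SimpleGraph V} {T : Set V} (h : Conn H T) {r : V} (hr : r ∈ T)
    (h2 : ∃ t ∈ T, t ≠ r) : ∃ t ∈ T, t ≠ r ∧ Conn H (T \ {t}) := by
  classical
  have hfin : {M : Set V | Conn H M ∧ r ∈ M ∧ M ⊆ T ∧ M ≠ T}.Finite := Set.toFinite _
  have hne : {M : Set V | Conn H M ∧ r ∈ M ∧ M ⊆ T ∧ M ≠ T}.Nonempty := by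
    refine ⟨{r}, Conn.single H r, rfl, by simpa using hr, ?_⟩
    rintro rfl
    obtain ⟨t, ht, hne⟩ := h2
    exact hne ht
  obtain ⟨M, hM⟩ := hfin.exists_maximal hne
  obtain ⟨⟨hc, hrM, hMT, hMne⟩, hmax⟩ := hM
  have : ∃ t ∈ T, t ∉ M ∧ ∃ m ∈ M, H.Adj t m := by
    by_contra hcon
    push Not at hcon
    apply hMne
    apply Set.Subset.antisymm hMT
    intro z hz
    have key : ∀ z, Relation.ReflTransGen (fun u v => H.Adj u v ∧ v ∈ T) r z → z ∈ M := by
      intro z hz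
      induction hz with
      | refl => exact hrM
      | tail h1 h2 ih =>
        by_contra hh
        exact hcon _ h2.2 hh _ ih h2.1.symm
    exact key z (h r hr z hz)
  obtain ⟨t, htT, htM, m, hm, hadj⟩ := this
  have hc' : Conn H (insert t M) := hc.ins ⟨m, hm, hadj⟩
  have heq : insert t M = T := by
    by_contra hne'
    have := hmax (y := insert t M) ⟨hc', Or.inr hrM, Set.insert_subset htT hMT, hne'⟩ (Set.subset_insert _ _)
    exact htM (this (Or.inl rfl))
  refine ⟨t, htT, ?_, ?_⟩
  · rintro rfl; exact htM hrM
  · rw [← heq]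
    simpa [htM] using hc

end Artemis

namespace Artemis
variable {V : Type*} {G : SimpleGraph V}

/-- `p 0, …, p k` is a hole (in this cyclic order), on `k + 1` vertices. -/
def HoleF (G : SimpleGraph V) (p : ℕ → V) (k : ℕ) : Prop :=
  3 ≤ k ∧ ∀ i j, i < j → j ≤ k → p i ≠ p j ∧ (G.Adj (p i) (p j) ↔ j = i + 1 ∨ (i = 0 ∧ j = k))

/-- Only the edges `ai aj` and `bi bj` between `Si` and `Sj`. -/
def TwoE (G : SimpleGraph V) (ai bi aj bj : V) (Si Sj : Set V) : Prop :=
  (∀ u ∈ Si, u ∉ Sj) ∧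
    ∀ u ∈ Si, ∀ v ∈ Sj, G.Adj u v → (u = ai ∧ v = aj) ∨ (u = bi ∧ v = bj)

/-- Prism in terms of vertex sets of paths. -/
def PrismF (G : SimpleGraph V) : Prop :=
  ∃ (a1 a2 a3 b1 b2 b3 : V) (k1 k2 k3 : ℕ) (S1 S2 S3 : Set V),
    IPL G a1 b1 k1 S1 ∧ IPL G a2 b2 k2 S2 ∧ IPL G a3 b3 k3 S3 ∧
    G.Adj a1 a2 ∧ G.Adj a2 a3 ∧ G.Adj a1 a3 ∧ G.Adj b1 b2 ∧ G.Adj b2 b3 ∧ G.Adj b1 b3 ∧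
    a1 ≠ b1 ∧ a2 ≠ b2 ∧ a3 ≠ b3 ∧
    TwoE G a1 b1 a2 b2 S1 S2 ∧ TwoE G a1 b1 a3 b3 S1 S3 ∧ TwoE G a2 b2 a3 b3 S2 S3

theorem exists_walk {p : ℕ → V} {k : ℕ} (h : ∀ i, i < k → G.Adj (p i) (p (i + 1))) :
    ∃ w : G.Walk (p 0) (p k), w.length = k ∧ ∀ i, i ≤ k → w.getVert i = p i := by
  induction k with
  | zero => exact ⟨Walk.nil, rfl, fun i hi => by obtain rfl : i = 0 := by omega
                                                 simp⟩
  | succ k ih =>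
    obtain ⟨w, hw, hg⟩ := ih (fun i hi => h i (by omega))
    refine ⟨w.concat (h k (by omega)), by simp [hw], ?_⟩
    intro i hi
    rw [Walk.concat_eq_append, Walk.getVert_append]
    by_cases hlt : i < w.length
    · simp only [hlt, if_true]; exact hg i (by omega)
    · simp only [hlt, if_false]
      have : i - w.length = 0 ∨ i - w.length = 1 := by omega
      rcases this with e | e
      · rw [e]; simp; congr 1; omega
      · rw [e]; simp; congr 1; omega

theorem IPL.walk {x y : V} {k : ℕ} {S : Set V} (h : IPL G x y k S) :
    ∃ w : G.Walk x y, IsInducedPathW G w ∧ w.length = k ∧ ∀ v, v ∈ w.support ↔ v ∈ S := by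
  obtain ⟨p, hp, rfl, rfl, rfl⟩ := h
  obtain ⟨w, hw, hg⟩ := exists_walk (G := G) (p := p) (k := k)
    (fun i hi => (hp.adj (by omega) (by omega)).2 (Or.inl rfl))
  have hs : ∀ v, v ∈ w.support ↔ ∃ i, i ≤ k ∧ p i = v := by
    intro v
    rw [Walk.mem_support_iff_exists_getVert]
    constructor
    · rintro ⟨n, h1, h2⟩
      exact ⟨n, by omega, by rw [← hg n (by omega)]; exact h1⟩
    · rintro ⟨n, h1, h2⟩
      exact ⟨n, by rw [hg n h1]; exact h2, by omega⟩
  refine ⟨w, ⟨?_, ?_⟩, hw, hs⟩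
  · rw [← Walk.IsPath.getVert_injOn_iff]
    intro i hi j hj e
    simp only [Set.mem_ofPred_eq] at hi hj
    rw [hg i (by omega), hg j (by omega)] at e
    exact hp.inj (by omega) (by omega) e
  · intro x y hx hy hxy
    rw [hs] at hx hy
    obtain ⟨i, hi, rfl⟩ := hx
    obtain ⟨j, hj, rfl⟩ := hy
    rw [hp.adj hi hj] at hxy
    rw [Walk.toSubgraph_adj_iff]
    rcases hxy with rfl | rfl
    · exact ⟨i, by rw [hg i (by omega), hg (i+1) (by omega)], by omega⟩
    · exact ⟨j, by rw [hg j (by omega), hg (j+1) (by omega)]; exact Sym2.eq_swap, by omega⟩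

theorem IPL.of_walk {x y : V} {w : G.Walk x y} (h : IsInducedPathW G w) :
    IPL G x y w.length {v | v ∈ w.support} := by
  obtain ⟨h1, h2⟩ := h
  refine ⟨w.getVert, ?_, by simp, by simp, ?_⟩
  · have hinj := h1.getVert_injOn
    intro i j hij hj
    refine ⟨fun e => ?_, ?_, ?_⟩
    · have := hinj (show i ≤ w.length by omega) (show j ≤ w.length by omega) e
      omega
    · intro ha
      have := h2 _ _ (w.getVert_mem_support i) (w.getVert_mem_support j) ha
      rw [Walk.toSubgraph_adj_iff] at this
      obtain ⟨n, h3, h4⟩ := this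
      rw [Sym2.eq_iff] at h3
      rcases h3 with ⟨e1, e2⟩ | ⟨e1, e2⟩
      · have := hinj (show _ ≤ w.length by omega) (show _ ≤ w.length by omega) e1
        have := hinj (show _ ≤ w.length by omega) (show _ ≤ w.length by omega) e2
        omega
      · have := hinj (show _ ≤ w.length by omega) (show _ ≤ w.length by omega) e1
        have := hinj (show _ ≤ w.length by omega) (show _ ≤ w.length by omega) e2
        omega
    · rintro rfl
      exact w.adj_getVert_succ (by omega)
  · ext v
    simp only [Set.mem_ofPred_eq]
    rw [Walk.mem_support_iff_exists_getVert]
    constructor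
    · rintro ⟨n, h3, h4⟩; exact ⟨n, h4, h3⟩
    · rintro ⟨n, h3, h4⟩; exact ⟨n, h4, h3⟩

theorem HoleF.walk {p : ℕ → V} {k : ℕ} (h : HoleF G p k) :
    ∃ (v : V) (c : G.Walk v v), IsHoleW G c ∧ c.length = k + 1 := by
  obtain ⟨hk, h⟩ := h
  obtain ⟨w, hw, hg⟩ := exists_walk (G := G) (p := p) (k := k)
    (fun i hi => (h i (i+1) (by omega) (by omega)).2.2 (Or.inl rfl))
  have hinj : ∀ i j, i ≤ k → j ≤ k → p i = p j → i = j := by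
    intro i j hi hj e
    rcases lt_trichotomy i j with h1 | h1 | h1
    · exact absurd e (h i j h1 hj).1
    · exact h1
    · exact absurd e.symm (h j i h1 hi).1
  have hs : ∀ v, v ∈ w.support ↔ ∃ i, i ≤ k ∧ p i = v := by
    intro v
    rw [Walk.mem_support_iff_exists_getVert]
    constructor
    · rintro ⟨n, h1, h2⟩
      exact ⟨n, by omega, by rw [← hg n (by omega)]; exact h1⟩
    · rintro ⟨n, h1, h2⟩
      exact ⟨n, by rw [hg n h1]; exact h2, by omega⟩
  have hadj : G.Adj (p k) (p 0) := ((h 0 k (by omega) le_rfl).2.2 (Or.inr ⟨rfl, rfl⟩)).symm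
  have hpath : w.IsPath := by
    rw [← Walk.IsPath.getVert_injOn_iff]
    intro i hi j hj e
    simp only [Set.mem_ofPred_eq] at hi hj
    rw [hg i (by omega), hg j (by omega)] at e
    exact hinj _ _ (by omega) (by omega) e
  refine ⟨p k, Walk.cons hadj w, ⟨?_, by simp [hw]; omega, ?_⟩, by simp [hw]⟩
  · rw [Walk.cons_isCycle_iff]
    refine ⟨hpath, ?_⟩
    intro hmem
    rw [← Walk.mem_edges_toSubgraph, Subgraph.mem_edgeSet, Walk.toSubgraph_adj_iff] at hmem
    obtain ⟨n, h3, h4⟩ := hmem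
    rw [hg n (by omega), hg (n+1) (by omega), Sym2.eq_iff] at h3
    rcases h3 with ⟨e1, e2⟩ | ⟨e1, e2⟩
    · have := hinj _ _ (by omega) (by omega) e1
      omega
    · have := hinj _ _ (by omega) (by omega) e1
      have := hinj _ _ (by omega) (by omega) e2
      omega
  · have key : ∀ i j, i < j → j ≤ k → G.Adj (p i) (p j) → (Walk.cons hadj w).toSubgraph.Adj (p i) (p j) := by
      intro i j hij hj ha
      rw [(h i j hij hj).2] at ha
      show (G.subgraphOfAdj hadj ⊔ w.toSubgraph).Adj _ _
      rw [Subgraph.sup_adj]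
      rcases ha with rfl | ⟨rfl, rfl⟩
      · right
        rw [Walk.toSubgraph_adj_iff]
        exact ⟨i, by rw [hg i (by omega), hg (i+1) (by omega)], by omega⟩
      · left
        simp
    intro x y hx hy hxy
    have hx' : ∃ i, i ≤ k ∧ p i = x := by
      rw [Walk.support_cons, List.mem_cons] at hx
      rcases hx with rfl | hx
      · exact ⟨k, le_rfl, rfl⟩
      · exact (hs x).1 hx
    have hy' : ∃ i, i ≤ k ∧ p i = y := by
      rw [Walk.support_cons, List.mem_cons] at hy
      rcases hy with rfl | hy
      · exact ⟨k, le_rfl, rfl⟩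
      · exact (hs y).1 hy
    obtain ⟨i, hi, rfl⟩ := hx'
    obtain ⟨j, hj, rfl⟩ := hy'
    rcases lt_trichotomy i j with h1 | h1 | h1
    · exact key i j h1 hj hxy
    · subst h1; exact absurd hxy (G.irrefl)
    · exact (key j i h1 hi hxy.symm).symm

theorem HoleF.of_walk {v : V} {c : G.Walk v v} (h : IsHoleW G c) :
    HoleF G c.getVert (c.length - 1) := by
  obtain ⟨hc, hl, hi⟩ := h
  have hinj := hc.getVert_injOn'
  have h0 : c.getVert c.length = c.getVert 0 := by simp
  refine ⟨by omega, ?_⟩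
  intro i j hij hj
  refine ⟨fun e => ?_, ?_, ?_⟩
  · have := hinj (show i ≤ c.length - 1 by omega) (show j ≤ c.length - 1 by omega) e
    omega
  · intro ha
    have := hi _ _ (c.getVert_mem_support i) (c.getVert_mem_support j) ha
    rw [Walk.toSubgraph_adj_iff] at this
    obtain ⟨n, h3, h4⟩ := this
    rw [Sym2.eq_iff] at h3
    by_cases hn : n + 1 = c.length
    · rw [hn, h0] at h3
      rcases h3 with ⟨e1, e2⟩ | ⟨e1, e2⟩
      · have := hinj (show _ ≤ c.length - 1 by omega) (show _ ≤ c.length - 1 by omega) e1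
        have := hinj (show _ ≤ c.length - 1 by omega) (show _ ≤ c.length - 1 by omega) e2
        omega
      · have := hinj (show _ ≤ c.length - 1 by omega) (show _ ≤ c.length - 1 by omega) e1
        have := hinj (show _ ≤ c.length - 1 by omega) (show _ ≤ c.length - 1 by omega) e2
        omega
    · rcases h3 with ⟨e1, e2⟩ | ⟨e1, e2⟩
      · have := hinj (show _ ≤ c.length - 1 by omega) (show _ ≤ c.length - 1 by omega) e1
        have := hinj (show _ ≤ c.length - 1 by omega) (show _ ≤ c.length - 1 by omega) e2
        omega
      · have := hinj (show _ ≤ c.length - 1 by omega) (show _ ≤ c.length - 1 by omega) e1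
        have := hinj (show _ ≤ c.length - 1 by omega) (show _ ≤ c.length - 1 by omega) e2
        omega
  · rintro (rfl | ⟨rfl, rfl⟩)
    · exact c.adj_getVert_succ (by omega)
    · have := c.adj_getVert_succ (i := c.length - 1) (by omega)
      rw [show c.length - 1 + 1 = c.length by omega, h0] at this
      exact this.symm

theorem prism_of_prismF (h : PrismF G) : HasPrism G := by
  obtain ⟨a1, a2, a3, b1, b2, b3, k1, k2, k3, S1, S2, S3, h1, h2, h3, h⟩ := h
  obtain ⟨w1, i1, -, s1⟩ := h1.walk
  obtain ⟨w2, i2, -, s2⟩ := h2.walk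
  obtain ⟨w3, i3, -, s3⟩ := h3.walk
  obtain ⟨c1, c2, c3, c4, c5, c6, c7, c8, c9, t1, t2, t3⟩ := h
  refine ⟨a1, a2, a3, b1, b2, b3, w1, w2, w3, i1, i2, i3, c1, c2, c3, c4, c5, c6, c7, c8, c9, ?_, ?_, ?_⟩
  · unfold PriPair; simp only [s1, s2]; exact t1
  · unfold PriPair; simp only [s1, s3]; exact t2
  · unfold PriPair; simp only [s2, s3]; exact t3

theorem prismF_of_prism (h : HasPrism G) : PrismF G := by
  obtain ⟨a1, a2, a3, b1, b2, b3, w1, w2, w3, i1, i2, i3, h⟩ := h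
  exact ⟨a1, a2, a3, b1, b2, b3, _, _, _, _, _, _, IPL.of_walk i1, IPL.of_walk i2, IPL.of_walk i3, h⟩

/-- The class in function form. -/
structure AF (G : SimpleGraph V) : Prop where
  hole : ∀ p k, HoleF G p k → Odd k
  anti : ∀ p k, HoleF Gᶜ p k → k ≤ 3
  prism : ¬ PrismF G

theorem AF.of_classA (h : InClassA G) : AF G := by
  obtain ⟨h1, h2, h3⟩ := h
  refine ⟨?_, ?_, fun h => h3 (prism_of_prismF h)⟩
  · intro p k hp
    by_contra hodd
    obtain ⟨v, c, hc, hl⟩ := hp.walk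
    refine h1 ⟨v, c, hc, ?_⟩
    rw [hl]
    rw [Nat.not_odd_iff_even] at hodd
    exact hodd.add_one
  · intro p k hp
    by_contra hk
    obtain ⟨v, c, hc, hl⟩ := hp.walk
    exact h2 ⟨v, c, hc, by omega⟩

theorem AF.classA (h : AF G) : InClassA G := by
  refine ⟨?_, ?_, fun h' => h.prism (prismF_of_prism h')⟩
  · rintro ⟨v, c, hc, hl⟩
    have := h.hole _ _ (HoleF.of_walk hc)
    have h4 := hc.2.1
    rw [Nat.odd_iff] at *
    omega
  · rintro ⟨v, c, hc, hl⟩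
    have := h.anti _ _ (HoleF.of_walk hc)
    omega

theorem holeF_of_ipl {x y x' y' : V} {k m : ℕ} {S S' : Set V}
    (h : IPL G x y k S) (h' : IPL G x' y' m S') (hx : G.Adj x x') (hy : G.Adj y y')
    (ht : TwoE G x y x' y' S S') (hkm : 2 ≤ k + m) : ∃ p, HoleF G p (k + m + 1) := by
  obtain ⟨p, hp, rfl, rfl, rfl⟩ := h
  obtain ⟨q, hq, rfl, rfl, rfl⟩ := h'
  obtain ⟨hd, he⟩ := ht
  have hd' : ∀ i j, i ≤ k → j ≤ m → p i ≠ q j :=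
    fun i j hi hj e => hd _ ⟨i, hi, rfl⟩ ⟨j, hj, e.symm⟩
  have he' : ∀ i j, i ≤ k → j ≤ m → (G.Adj (p i) (q j) ↔ (i = 0 ∧ j = 0) ∨ (i = k ∧ j = m)) := by
    intro i j hi hj
    constructor
    · intro e
      rcases he _ ⟨i, hi, rfl⟩ _ ⟨j, hj, rfl⟩ e with ⟨h1, h2⟩ | ⟨h1, h2⟩
      · left; exact ⟨hp.inj hi (by omega) h1, hq.inj hj (by omega) h2⟩
      · right; exact ⟨hp.inj hi (by omega) h1, hq.inj hj (by omega) h2⟩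
    · rintro (⟨rfl, rfl⟩ | ⟨rfl, rfl⟩)
      · exact hx
      · exact hy
  refine ⟨fun n => if n ≤ k then p (k - n) else q (n - k - 1), by omega, ?_⟩
  intro i j hij hj
  by_cases h1 : j ≤ k
  · have h2 : i ≤ k := by omega
    simp only [h1, h2, if_true]
    refine ⟨fun e => ?_, ?_⟩
    · have := hp.inj (by omega) (by omega) e
      omega
    · rw [hp.adj (by omega) (by omega)]; omega
  · by_cases h2 : i ≤ k
    · simp only [h1, h2, if_true, if_false]
      refine ⟨hd' _ _ (by omega) (by omega), ?_⟩
      rw [he' _ _ (by omega) (by omega)]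
      omega
    · simp only [h1, h2, if_false]
      refine ⟨fun e => ?_, ?_⟩
      · have := hq.inj (by omega) (by omega) e
        omega
      · rw [hq.adj (by omega) (by omega)]; omega

theorem AF.even (hA : AF G) {x y x' y' : V} {k m : ℕ} {S S' : Set V}
    (h : IPL G x y k S) (h' : IPL G x' y' m S') (hx : G.Adj x x') (hy : G.Adj y y')
    (ht : TwoE G x y x' y' S S') (hkm : 2 ≤ k + m) : Even (k + m) := by
  obtain ⟨p, hp⟩ := holeF_of_ipl h h' hx hy ht hkm
  have := hA.hole _ _ hp
  rw [Nat.odd_iff] at this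
  rw [Nat.even_iff]; omega

theorem AF.noanti (hA : AF G) {x y x' y' : V} {k m : ℕ} {S S' : Set V}
    (h : IPL Gᶜ x y k S) (h' : IPL Gᶜ x' y' m S') (hx : Gᶜ.Adj x x') (hy : Gᶜ.Adj y y')
    (ht : TwoE Gᶜ x y x' y' S S') (hkm : 3 ≤ k + m) : False := by
  obtain ⟨p, hp⟩ := holeF_of_ipl h h' hx hy ht (by omega)
  have := hA.anti _ _ hp
  omega

end Artemis

namespace Artemis
variable {V : Type*} {G : SimpleGraph V}

/-- Only the edge `ai aj` between `Si` and `Sj`. -/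
def OneE (G : SimpleGraph V) (ai aj : V) (Si Sj : Set V) : Prop :=
  (∀ u ∈ Si, u ∉ Sj) ∧ ∀ u ∈ Si, ∀ v ∈ Sj, G.Adj u v → u = ai ∧ v = aj

/-- No edges between `Si` and `Sj`. -/
def NoE (G : SimpleGraph V) (Si Sj : Set V) : Prop :=
  (∀ u ∈ Si, u ∉ Sj) ∧ ∀ u ∈ Si, ∀ v ∈ Sj, ¬ G.Adj u v

theorem TwoE.mono {a b c d : V} {S S' R R' : Set V} (h : TwoE G a b c d S S') (h1 : R ⊆ S)
    (h2 : R' ⊆ S') : TwoE G a b c d R R' :=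
  ⟨fun u hu hu' => h.1 u (h1 hu) (h2 hu'), fun u hu v hv => h.2 u (h1 hu) v (h2 hv)⟩

theorem OneE.mono {a b : V} {S S' R R' : Set V} (h : OneE G a b S S') (h1 : R ⊆ S)
    (h2 : R' ⊆ S') : OneE G a b R R' :=
  ⟨fun u hu hu' => h.1 u (h1 hu) (h2 hu'), fun u hu v hv => h.2 u (h1 hu) v (h2 hv)⟩

theorem NoE.mono {S S' R R' : Set V} (h : NoE G S S') (h1 : R ⊆ S)
    (h2 : R' ⊆ S') : NoE G R R' :=
  ⟨fun u hu hu' => h.1 u (h1 hu) (h2 hu'), fun u hu v hv => h.2 u (h1 hu) v (h2 hv)⟩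

theorem TwoE.symm {a b c d : V} {S S' : Set V} (h : TwoE G a b c d S S') : TwoE G c d a b S' S :=
  ⟨fun u hu hu' => h.1 u hu' hu, fun u hu v hv e => by
    rcases h.2 v hv u hu e.symm with h | h
    · exact Or.inl ⟨h.2, h.1⟩
    · exact Or.inr ⟨h.2, h.1⟩⟩

theorem TwoE.swap {a b c d : V} {S S' : Set V} (h : TwoE G a b c d S S') : TwoE G b a d c S S' :=
  ⟨h.1, fun u hu v hv e => (h.2 u hu v hv e).symm⟩

theorem OneE.symm {a b : V} {S S' : Set V} (h : OneE G a b S S') : OneE G b a S' S :=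
  ⟨fun u hu hu' => h.1 u hu' hu, fun u hu v hv e => (h.2 v hv u hu e.symm).symm⟩

theorem NoE.symm {S S' : Set V} (h : NoE G S S') : NoE G S' S :=
  ⟨fun u hu hu' => h.1 u hu' hu, fun u hu v hv e => h.2 v hv u hu e.symm⟩

theorem Conn.ipl {F : Set V} (h : Conn G F) {x y : V} (hx : x ∈ F) (hy : y ∈ F) :
    ∃ k S, IPL G x y k S ∧ S ⊆ F := by
  obtain ⟨u, v, k, S, h1, h2, rfl, rfl, -⟩ := h.path hx hy (fun z => z = x) (fun z => z = y) rfl rfl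
  exact ⟨k, S, h1, h2⟩

/-- path from a fixed vertex `x` to the `Q`-vertices. -/
theorem Conn.pathFrom {F : Set V} (h : Conn G F) {x y : V} (hx : x ∈ F) (hy : y ∈ F)
    (Q : V → Prop) (hQ : Q y) :
    ∃ v k S, IPL G x v k S ∧ S ⊆ F ∧ Q v ∧ (∀ w ∈ S, Q w → w = v) := by
  obtain ⟨u, v, k, S, h1, h2, rfl, h3, -, h4⟩ := h.path hx hy (fun z => z = x) Q rfl hQ
  exact ⟨v, k, S, h1, h2, h3, h4⟩

theorem AF.spr (hA : AF G) {x1 x2 x3 y1 y2 y3 : V} {F1 F2 F3 : Set V}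
    (h1 : Conn G F1) (h2 : Conn G F2) (h3 : Conn G F3)
    (hx1 : x1 ∈ F1) (hx2 : x2 ∈ F2) (hx3 : x3 ∈ F3)
    (hy1 : y1 ∈ F1) (hy2 : y2 ∈ F2) (hy3 : y3 ∈ F3)
    (a12 : G.Adj x1 x2) (a23 : G.Adj x2 x3) (a13 : G.Adj x1 x3)
    (b12 : G.Adj y1 y2) (b23 : G.Adj y2 y3) (b13 : G.Adj y1 y3)
    (n1 : x1 ≠ y1) (n2 : x2 ≠ y2) (n3 : x3 ≠ y3)
    (t12 : TwoE G x1 y1 x2 y2 F1 F2) (t13 : TwoE G x1 y1 x3 y3 F1 F3)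
    (t23 : TwoE G x2 y2 x3 y3 F2 F3) : False := by
  obtain ⟨k1, S1, i1, s1⟩ := h1.ipl hx1 hy1
  obtain ⟨k2, S2, i2, s2⟩ := h2.ipl hx2 hy2
  obtain ⟨k3, S3, i3, s3⟩ := h3.ipl hx3 hy3
  exact hA.prism ⟨x1, x2, x3, y1, y2, y3, k1, k2, k3, S1, S2, S3, i1, i2, i3, a12, a23, a13, b12, b23,
    b13, n1, n2, n3, t12.mono s1 s2, t13.mono s1 s3, t23.mono s2 s3⟩

theorem AF.sp_aux (hA : AF G) {x y u v t : V} {k m : ℕ} {S S' : Set V} (h : IPL G x u k S)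
    (h' : IPL G y v m S') (hxy : G.Adj x y) (ho : OneE G x y S S')
    (htS : t ∉ S) (htS' : t ∉ S') (hu : G.Adj t u) (hv : G.Adj t v)
    (hu' : ∀ w ∈ S, G.Adj t w → w = u) (hv' : ∀ w ∈ S', G.Adj t w → w = v)
    (hkm : 1 ≤ k + m) : (k + m) % 2 = 1 := by
  have hp := h.symm.append h' hxy ho.1 ho.2
  have := hA.even hp (IPL.single G t) hu.symm hv.symm ⟨?_, ?_⟩ (by omega)
  · rw [Nat.even_iff] at this; omega
  · rintro w (hw | hw) rfl
    · exact htS hw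
    · exact htS' hw
  · rintro w (hw | hw) t' rfl e
    · exact Or.inl ⟨hu' w hw e.symm, rfl⟩
    · exact Or.inr ⟨hv' w hw e.symm, rfl⟩

theorem AF.sp (hA : AF G) {x1 x2 x3 t : V} {F1 F2 F3 : Set V}
    (h1 : Conn G F1) (h2 : Conn G F2) (h3 : Conn G F3)
    (hx1 : x1 ∈ F1) (hx2 : x2 ∈ F2) (hx3 : x3 ∈ F3)
    (a12 : G.Adj x1 x2) (a23 : G.Adj x2 x3) (a13 : G.Adj x1 x3)
    (t12 : OneE G x1 x2 F1 F2) (t13 : OneE G x1 x3 F1 F3)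
    (t23 : OneE G x2 x3 F2 F3)
    (n1 : t ∉ F1) (n2 : t ∉ F2) (n3 : t ∉ F3)
    (m1 : ∃ w ∈ F1, G.Adj t w) (m2 : ∃ w ∈ F2, G.Adj t w) (m3 : ∃ w ∈ F3, G.Adj t w) :
    (G.Adj t x1 ∧ G.Adj t x2) ∨ (G.Adj t x1 ∧ G.Adj t x3) ∨ (G.Adj t x2 ∧ G.Adj t x3) := by
  obtain ⟨w1, hw1, e1⟩ := m1
  obtain ⟨w2, hw2, e2⟩ := m2
  obtain ⟨w3, hw3, e3⟩ := m3
  obtain ⟨u1, k1, S1, i1, s1, c1, d1⟩ := h1.pathFrom hx1 hw1 (fun w => G.Adj t w) e1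
  obtain ⟨u2, k2, S2, i2, s2, c2, d2⟩ := h2.pathFrom hx2 hw2 (fun w => G.Adj t w) e2
  obtain ⟨u3, k3, S3, i3, s3, c3, d3⟩ := h3.pathFrom hx3 hw3 (fun w => G.Adj t w) e3
  have p12 := hA.sp_aux i1 i2 a12 (t12.mono s1 s2) (fun h => n1 (s1 h)) (fun h => n2 (s2 h)) c1 c2 d1 d2
  have p13 := hA.sp_aux i1 i3 a13 (t13.mono s1 s3) (fun h => n1 (s1 h)) (fun h => n3 (s3 h)) c1 c3 d1 d3
  have p23 := hA.sp_aux i2 i3 a23 (t23.mono s2 s3) (fun h => n2 (s2 h)) (fun h => n3 (s3 h)) c2 c3 d2 d3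
  have z1 := i1.zero_iff
  have z2 := i2.zero_iff
  have z3 := i3.zero_iff
  by_cases k1z : k1 = 0
  · rw [z1] at k1z; subst k1z
    by_cases k2z : k2 = 0
    · rw [z2] at k2z; subst k2z; exact Or.inl ⟨c1, c2⟩
    · by_cases k3z : k3 = 0
      · rw [z3] at k3z; subst k3z; exact Or.inr (Or.inl ⟨c1, c3⟩)
      · omega
  · by_cases k2z : k2 = 0
    · by_cases k3z : k3 = 0
      · rw [z2] at k2z; rw [z3] at k3z; subst k2z; subst k3z; exact Or.inr (Or.inr ⟨c2, c3⟩)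
      · omega
    · omega

/-- Complete vertices. -/
def Cs (G : SimpleGraph V) (T : Set V) : Set V := {v | ∀ t ∈ T, G.Adj v t}

theorem Cs.notMem {T : Set V} {v : V} (h : v ∈ Cs G T) : v ∉ T := fun h' => G.irrefl (h v h')

theorem AF.lab (hA : AF G) {T : Set V} (hT : Conn Gᶜ T) {x x' d : V} (hxx : G.Adj x x')
    (hxT : x ∉ T) (hxT' : x' ∉ T) (hx : x ∉ Cs G T) (hx' : x' ∉ Cs G T)
    (hcov : ∀ t ∈ T, G.Adj x t ∨ G.Adj x' t) (hd : d ∈ Cs G T) (hdx : ¬ G.Adj d x)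
    (hdx' : ¬ G.Adj d x') : False := by
  have hx1 : ∃ t ∈ T, ¬ G.Adj x t := by
    by_contra h; push Not at h; exact hx h
  have hx1' : ∃ t ∈ T, ¬ G.Adj x' t := by
    by_contra h; push Not at h; exact hx' h
  obtain ⟨t, ht, e⟩ := hx1
  obtain ⟨t', ht', e'⟩ := hx1'
  obtain ⟨u, v, k, S, h1, h2, h3, h4, h5, h6⟩ :=
    hT.path ht ht' (fun t => ¬ G.Adj x t) (fun t => ¬ G.Adj x' t) e e'
  have hnx : d ≠ x := by rintro rfl; exact hx hd
  have hnx' : d ≠ x' := by rintro rfl; exact hx' hd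
  have hk : k ≠ 0 := by
    rw [Ne, h1.zero_iff]
    rintro rfl
    rcases hcov u (h2 h1.left) with h | h
    · exact h3 h
    · exact h4 h
  have hp : IPL Gᶜ x x' (0 + 1 + 1) (insert x (insert d {x'})) := by
    refine ((IPL.single Gᶜ x').cons (x := d) ?_ ?_ ?_).cons (x := x) ?_ ?_ ?_
    · rw [compl_adj]; exact ⟨hnx', hdx'⟩
    · exact hnx'
    · intro v hv _; exact hv
    · rw [compl_adj]; exact ⟨hnx.symm, fun h => hdx h.symm⟩
    · rintro (h | h)
      · exact hnx h.symm
      · exact hxx.ne h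
    · rintro v (h | h) h'
      · exact h
      · rw [compl_adj] at h'
        rw [h] at h'
        exact absurd hxx h'.2
  refine hA.noanti h1 hp ?_ ?_ ⟨?_, ?_⟩ (by omega)
  · rw [compl_adj]
    refine ⟨?_, fun h => h3 h.symm⟩
    rintro rfl; exact hxT (h2 h1.left)
  · rw [compl_adj]
    refine ⟨?_, fun h => h4 h.symm⟩
    rintro rfl; exact hxT' (h2 h1.right)
  · rintro w hw (rfl | rfl | rfl)
    · exact hxT (h2 hw)
    · exact Cs.notMem hd (h2 hw)
    · exact hxT' (h2 hw)
  · rintro w hw z (rfl | rfl | rfl) h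
    · left; exact ⟨h5 w hw (fun h' => h.2 h'.symm), rfl⟩
    · exact absurd (hd w (h2 hw)).symm h.2
    · right; exact ⟨h6 w hw (fun h' => h.2 h'.symm), rfl⟩

end Artemis

namespace Artemis
variable {V : Type*} {G : SimpleGraph V}

open Classical in
/-- number of `C`-edges among the first `n` edges -/
noncomputable def cn (C : Set V) (p : ℕ → V) : ℕ → ℕ
  | 0 => 0
  | n + 1 => cn C p n + if p n ∈ C ∧ p (n + 1) ∈ C then 1 else 0

theorem cn_succ_pos {C : Set V} {p : ℕ → V} {n : ℕ} (h : p n ∈ C) (h' : p (n + 1) ∈ C) :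
    cn C p (n + 1) = cn C p n + 1 := by
  simp [cn, h, h']

theorem cn_succ_neg {C : Set V} {p : ℕ → V} {n : ℕ} (h : ¬ (p n ∈ C ∧ p (n + 1) ∈ C)) :
    cn C p (n + 1) = cn C p n := by
  simp [cn, h]

theorem cn_const {C : Set V} {p : ℕ → V} {a b : ℕ} (hab : a ≤ b)
    (h : ∀ i, a ≤ i → i < b → ¬ (p i ∈ C ∧ p (i + 1) ∈ C)) : cn C p b = cn C p a := by
  induction b, hab using Nat.le_induction with
  | base => rfl
  | succ n hn ih =>
    rw [cn_succ_neg (h n hn (by omega)), ih (fun i h1 h2 => h i h1 (by omega))]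

theorem cn_shift {C : Set V} {p : ℕ → V} (a n : ℕ) :
    cn C p (a + n) = cn C p a + cn C (fun i => p (a + i)) n := by
  induction n with
  | zero => simp [cn]
  | succ n ih =>
    rw [← Nat.add_assoc]
    by_cases h : p (a + n) ∈ C ∧ p (a + n + 1) ∈ C
    · rw [cn_succ_pos h.1 h.2, cn_succ_pos (n := n) h.1 h.2, ih]; rfl
    · rw [cn_succ_neg h, cn_succ_neg (n := n) h, ih]

/-- The Roussel–Rubio property, weak form. -/
def RR1 (G : SimpleGraph V) (T : Set V) : Prop :=
  ∀ x y k S, IPL G x y k S → x ∈ Cs G T → y ∈ Cs G T →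
    (∀ v ∈ S, v ∈ Cs G T → v = x ∨ v = y) → k ≠ 1 → Even k

theorem RR1.count {T : Set V} (h : RR1 G T) : ∀ (k : ℕ) (p : ℕ → V), IsIP G p k → p 0 ∈ Cs G T →
    p k ∈ Cs G T → cn (Cs G T) p k % 2 = k % 2 := by
  classical
  intro k
  induction k using Nat.strong_induction_on with
  | _ k ih =>
    intro p hp h0 hk
    rcases Nat.eq_zero_or_pos k with rfl | hpos
    · rfl
    have hex : ∃ n, n < k ∧ p (k - 1 - n) ∈ Cs G T := ⟨k - 1, by omega, by simpa using h0⟩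
    obtain ⟨h1, h2⟩ := Nat.find_spec hex
    have hmin := fun m (hm : m < Nat.find hex) => Nat.find_min hex hm
    set n := Nat.find hex
    clear_value n
    obtain ⟨i, hi⟩ : ∃ i, i = k - 1 - n := ⟨_, rfl⟩
    rw [← hi] at h2
    have hno : ∀ j, i < j → j < k → p j ∉ Cs G T := by
      intro j h3 h4 h5
      refine hmin (k - 1 - j) (by omega) ⟨by omega, ?_⟩
      rwa [show k - 1 - (k - 1 - j) = j by omega]
    have e1 := ih i (by omega) p (hp.mono (by omega)) h0 h2
    by_cases hik : k = i + 1
    · subst hik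
      rw [cn_succ_pos h2 hk]; omega
    · have e2 : cn (Cs G T) p k = cn (Cs G T) p i := by
        apply cn_const (by omega)
        intro j h3 h4 h5
        by_cases h6 : j = i
        · exact hno (j + 1) (by omega) (by omega) h5.2
        · exact hno j (by omega) (by omega) h5.1
      have := h _ _ _ _ (hp.ipl (a := i) (b := k) (by omega) le_rfl) h2 hk ?_ (by omega)
      · rw [Nat.even_iff] at this; omega
      · rintro v ⟨j, h3, h4, rfl⟩ h5
        by_cases h6 : j = i
        · left; rw [h6]
        · by_cases h7 : j = k
          · right; rw [h7]
          · exact absurd h5 (hno j (by omega) (by omega))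

section
variable (hA : AF G) {T : Set V} {p : ℕ → V} {k : ℕ}

/-- evenness of the number of `S`-edges in an interval between consecutive neighbours of `t`. -/
theorem AF.rr_interval (hA : AF G) {S : Set V} (hS : RR1 G S) {t e : V} {k : ℕ} {p : ℕ → V}
    (hp : IsIP G p k) {v v' : ℕ} (hvv : v + 2 ≤ v') (hv' : v' ≤ k) (htP : ∀ i, i ≤ k → p i ≠ t)
    (h1 : G.Adj t (p v)) (h2 : G.Adj t (p v')) (h3 : ∀ i, v < i → i < v' → ¬ G.Adj t (p i))
    (heC : e ∈ Cs G S) (het : G.Adj e t) (htS : t ∉ Cs G S)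
    (heP : ∀ i, v ≤ i → i ≤ v' → e ≠ p i ∧ ¬ G.Adj e (p i)) :
    cn (Cs G S) p v' % 2 = cn (Cs G S) p v % 2 := by
  classical
  have hpar : (v' - v) % 2 = 0 := by
    have := hA.even (hp.ipl (a := v) (b := v') (by omega) hv') (IPL.single G t) h1.symm h2.symm
      ⟨?_, ?_⟩ (by omega)
    · rw [Nat.even_iff] at this; omega
    · rintro u ⟨i, h4, h5, rfl⟩ h6
      exact htP i (by omega) h6
    · rintro u ⟨i, h4, h5, rfl⟩ w rfl h6
      by_cases h7 : i = v
      · left; exact ⟨by rw [h7], rfl⟩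
      · by_cases h8 : i = v'
        · right; exact ⟨by rw [h8], rfl⟩
        · exact absurd h6.symm (h3 i (by omega) (by omega))
  by_cases hex : ∃ w, v ≤ w ∧ w ≤ v' ∧ p w ∈ Cs G S
  · -- min
    obtain ⟨w1, hw1, hmin⟩ : ∃ w, (v ≤ w ∧ w ≤ v' ∧ p w ∈ Cs G S) ∧
        ∀ i, v ≤ i → i < w → p i ∉ Cs G S := by
      refine ⟨Nat.find hex, Nat.find_spec hex, ?_⟩
      intro i hi hi' hC
      have hle := (Nat.find_spec hex).2.1
      exact Nat.find_min hex hi' ⟨hi, by omega, hC⟩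
    obtain ⟨w2, hw2, hmax⟩ : ∃ w, (v ≤ w ∧ w ≤ v' ∧ p w ∈ Cs G S) ∧
        ∀ i, w < i → i ≤ v' → p i ∉ Cs G S := by
      have hex2 : ∃ n, n ≤ v' - v ∧ p (v' - n) ∈ Cs G S := by
        obtain ⟨w, a, b, c⟩ := hex
        exact ⟨v' - w, by omega, by rwa [show v' - (v' - w) = w by omega]⟩
      have hsp := Nat.find_spec hex2
      refine ⟨v' - Nat.find hex2, ⟨by omega, by omega, hsp.2⟩, ?_⟩
      intro i hi hi' hC
      refine Nat.find_min hex2 (m := v' - i) (by omega) ⟨by omega, ?_⟩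
      rwa [show v' - (v' - i) = i by omega]
    have h12 : w1 ≤ w2 := by
      by_contra hlt
      exact hmin w2 hw2.1 (by omega) hw2.2.2
    have c1 : cn (Cs G S) p w1 = cn (Cs G S) p v :=
      cn_const hw1.1 (fun i h4 h5 h6 => hmin i h4 h5 h6.1)
    have c2 : cn (Cs G S) p v' = cn (Cs G S) p w2 :=
      cn_const hw2.2.1 (fun i h4 h5 h6 => hmax (i + 1) (by omega) (by omega) h6.2)
    rcases Nat.eq_or_lt_of_le h12 with e12 | hlt
    · rw [c2, ← e12, c1]
    · have q1 : Even (w1 - v + 1 + 1) := by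
        refine hS _ _ _ _ (((hp.ipl hw1.1 (by omega)).cons (x := t) h1 ?_ ?_).cons (x := e) het ?_ ?_)
          heC hw1.2.2 ?_ (by omega)
        · rintro ⟨i, h4, h5, h6⟩; exact htP i (by omega) h6
        · rintro u ⟨i, h4, h5, rfl⟩ h6
          by_cases h7 : i = v
          · rw [h7]
          · exact absurd h6 (h3 i (by omega) (by omega))
        · rintro (h4 | ⟨i, h4, h5, h6⟩)
          · exact het.ne h4
          · exact (heP i h4 (by omega)).1 h6.symm
        · rintro u (h4 | ⟨i, h4, h5, rfl⟩) h6
          · exact h4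
          · exact absurd h6 (heP i h4 (by omega)).2
        · rintro u (h4 | h4 | ⟨i, h4, h5, rfl⟩) h6
          · exact Or.inl h4
          · rw [h4] at h6; exact absurd h6 htS
          · right
            by_contra hne
            have : i ≠ w1 := fun h => hne (by rw [h])
            exact hmin i h4 (by omega) h6
      have q2 : Even (v' - w2 + 1 + 1) := by
        refine hS _ _ _ _ ((((hp.ipl hw2.2.1 (by omega)).symm).cons (x := t) h2 ?_ ?_).cons (x := e) het ?_ ?_)
          heC hw2.2.2 ?_ (by omega)
        · rintro ⟨i, h4, h5, h6⟩; exact htP i (by omega) h6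
        · rintro u ⟨i, h4, h5, rfl⟩ h6
          by_cases h7 : i = v'
          · rw [h7]
          · exact absurd h6 (h3 i (by omega) (by omega))
        · rintro (h4 | ⟨i, h4, h5, h6⟩)
          · exact het.ne h4
          · exact (heP i (by omega) (by omega)).1 h6.symm
        · rintro u (h4 | ⟨i, h4, h5, rfl⟩) h6
          · exact h4
          · exact absurd h6 (heP i (by omega) (by omega)).2
        · rintro u (h4 | h4 | ⟨i, h4, h5, rfl⟩) h6
          · exact Or.inl h4
          · rw [h4] at h6; exact absurd h6 htS
          · right
            by_contra hne
            have : i ≠ w2 := fun h => hne (by rw [h])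
            exact hmax i (by omega) (by omega) h6
      have q3 := hS.count (w2 - w1) (fun n => p (w1 + n)) ((hp.mono (by omega)).shift w1)
        hw1.2.2 (by show p (w1 + (w2 - w1)) ∈ _; rw [show w1 + (w2 - w1) = w2 by omega]; exact hw2.2.2)
      have q4 := cn_shift (C := Cs G S) (p := p) w1 (w2 - w1)
      rw [show w1 + (w2 - w1) = w2 by omega] at q4
      rw [Nat.even_iff] at q1 q2
      omega
  · have : cn (Cs G S) p v' = cn (Cs G S) p v :=
      cn_const (by omega) (fun i h4 h5 h6 => hex ⟨i, h4, by omega, h6.1⟩)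
    rw [this]

/-- For a non-cut `t`, the neighbourhood on an odd outer path is very restricted. -/
theorem AF.rr_type (hA : AF G) {S : Set V} (hS : RR1 G S) {t : V} {k : ℕ} {p : ℕ → V}
    (hp : IsIP G p k) (hk : 3 ≤ k) (hodd : k % 2 = 1) (htP : ∀ i, i ≤ k → p i ≠ t)
    (h0 : G.Adj t (p 0)) (h1 : G.Adj t (p k)) (hc0 : p 0 ∈ Cs G S) (hck : p k ∈ Cs G S)
    (htS : t ∉ Cs G S)
    (hintr : ∀ i, 0 < i → i < k → G.Adj t (p i) → p i ∉ Cs G S) :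
    (G.Adj t (p 1) ∧ ∀ i, 1 < i → i < k → ¬ G.Adj t (p i)) ∨
    (G.Adj t (p (k-1)) ∧ ∀ i, 0 < i → i < k-1 → ¬ G.Adj t (p i)) := by
  classical
  by_contra hcon
  push Not at hcon
  obtain ⟨hn1, hn2⟩ := hcon
  have key : ∀ v', v' ≤ k → G.Adj t (p v') → cn (Cs G S) p v' % 2 = 0 := by
    intro v'
    induction v' using Nat.strong_induction_on with
    | _ v' ih =>
      intro hv' hadj
      rcases Nat.eq_zero_or_pos v' with rfl | hpos
      · rfl
      have hex : ∃ n, n < v' ∧ G.Adj t (p (v' - 1 - n)) := ⟨v' - 1, by omega, by simpa using h0⟩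
      obtain ⟨v, hv, hvadj, hvno⟩ : ∃ v, v < v' ∧ G.Adj t (p v) ∧
          ∀ i, v < i → i < v' → ¬ G.Adj t (p i) := by
        have hsp := Nat.find_spec hex
        refine ⟨v' - 1 - Nat.find hex, by omega, hsp.2, ?_⟩
        intro i hi hi' hC
        refine Nat.find_min hex (m := v' - 1 - i) (by omega) ⟨by omega, ?_⟩
        rwa [show v' - 1 - (v' - 1 - i) = i by omega]
      have e1 := ih v hv (by omega) hvadj
      by_cases hadj1 : v' = v + 1
      · subst hadj1
        rw [cn_succ_neg, e1]
        rintro ⟨hC1, hC2⟩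
        by_cases hv0 : v = 0
        · exact hintr (v + 1) (by omega) (by omega) hadj hC2
        · exact hintr v (by omega) (by omega) hvadj hC1
      · have hpar : (v' - v) % 2 = 0 := by
          have := hA.even (hp.ipl (a := v) (b := v') (by omega) hv') (IPL.single G t) hvadj.symm hadj.symm
            ⟨?_, ?_⟩ (by omega)
          · rw [Nat.even_iff] at this; omega
          · rintro u ⟨i, h4, h5, rfl⟩ h6
            exact htP i (by omega) h6
          · rintro u ⟨i, h4, h5, rfl⟩ w rfl h6
            by_cases h7 : i = v
            · left; exact ⟨by rw [h7], rfl⟩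
            · by_cases h8 : i = v'
              · right; exact ⟨by rw [h8], rfl⟩
              · exact absurd h6.symm (hvno i (by omega) (by omega))
        have hcase : 2 ≤ v ∨ v' + 2 ≤ k := by
          by_contra hh
          push Not at hh
          have : v = 0 ∨ v = 1 := by omega
          rcases this with rfl | rfl
          · have : v' = k - 1 := by omega
            subst this
            obtain ⟨i, a, b, c⟩ := hn2 hadj
            exact hvno i a b c
          · have : v' = k := by omega
            subst this
            obtain ⟨i, a, b, c⟩ := hn1 hvadj
            exact hvno i a b c
        rw [← e1]
        rcases hcase with hc | hc
        · refine hA.rr_interval hS hp (by omega) hv' htP hvadj hadj hvno hc0 h0.symm htS ?_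
          intro i h4 h5
          refine ⟨fun e => ?_, fun e => ?_⟩
          · have := hp.inj (by omega) (by omega) e
            omega
          · rw [hp.adj (by omega) (by omega)] at e
            omega
        · refine hA.rr_interval hS hp (by omega) hv' htP hvadj hadj hvno hck h1.symm htS ?_
          intro i h4 h5
          refine ⟨fun e => ?_, fun e => ?_⟩
          · have := hp.inj (by omega) (by omega) e
            omega
          · rw [hp.adj (by omega) (by omega)] at e
            omega
  have := key k le_rfl h1
  have := hS.count k p hp hc0 hck
  omega

theorem cn_pos_exists {C : Set V} {p : ℕ → V} {k : ℕ} (h : cn C p k ≠ 0) :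
    ∃ i, i < k ∧ p i ∈ C ∧ p (i + 1) ∈ C := by
  by_contra hcon
  push Not at hcon
  exact h (cn_const (Nat.zero_le k) (fun i _ h2 h3 => hcon i h2 h3.1 h3.2))

/-- final contradiction with two non-cut vertices of different types. -/
theorem AF.rr_final (hA : AF G) {T : Set V} (hT : Conn Gᶜ T) {t1 t2 : V} {k : ℕ} {p : ℕ → V}
    (hp : IsIP G p k) (hk : 3 ≤ k) (hodd : k % 2 = 1) (hTP : ∀ i, i ≤ k → p i ∉ T)
    (ht1 : t1 ∈ T) (ht2 : t2 ∈ T) (h12 : t1 ≠ t2)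
    (hc0 : p 0 ∈ Cs G T) (hck : p k ∈ Cs G T)
    (a1 : G.Adj t1 (p 1)) (a2 : ∀ i, 1 < i → i < k → ¬ G.Adj t1 (p i))
    (b1 : G.Adj t2 (p (k-1))) (b2 : ∀ i, 0 < i → i < k-1 → ¬ G.Adj t2 (p i))
    (c1 : ∀ t ∈ T, t ≠ t1 → G.Adj (p (k-1)) t) (c2 : ∀ t ∈ T, t ≠ t2 → G.Adj (p 1) t) : False := by
  have d1 : p (k-1) ∉ T := hTP _ (by omega)
  have d2 : p 1 ∉ T := hTP _ (by omega)
  have d3 : p 0 ∉ T := hTP _ (by omega)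
  have d4 : p k ∉ T := hTP _ (by omega)
  by_cases hadj : G.Adj t1 t2
  · obtain ⟨m, Q, hQ, hQT⟩ := hT.ipl ht1 ht2
    have hm : 2 ≤ m := by
      have z0 := hQ.zero_iff
      have z1 := hQ.one_iff
      have : ¬ Gᶜ.Adj t1 t2 := fun h => h.2 hadj
      by_contra hlt
      have : m = 0 ∨ m = 1 := by omega
      tauto
    have n1 : ¬ G.Adj t1 (p (k-1)) := a2 _ (by omega) (by omega)
    have n2 : ¬ G.Adj t2 (p 1) := b2 _ (by omega) (by omega)
    have e1 : Gᶜ.Adj t1 (p (k-1)) := ⟨fun h => d1 (h ▸ ht1), n1⟩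
    have e2 : Gᶜ.Adj t2 (p 1) := ⟨fun h => d2 (h ▸ ht2), n2⟩
    by_cases hk5 : k = 3
    · subst hk5
      have f03 : Gᶜ.Adj (p 0) (p 3) := ⟨(hp 0 3 (by omega) (by omega)).1, by
        rw [hp.adj (by omega) (by omega)]; omega⟩
      have f02 : Gᶜ.Adj (p 2) (p 0) := ⟨(hp 0 2 (by omega) (by omega)).1.symm, by
        rw [hp.adj (by omega) (by omega)]; omega⟩
      have f13 : Gᶜ.Adj (p 3) (p 1) := ⟨(hp 1 3 (by omega) (by omega)).1.symm, by
        rw [hp.adj (by omega) (by omega)]; omega⟩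
      have g01 : G.Adj (p 0) (p 1) := by rw [hp.adj (by omega) (by omega)]; omega
      have g12 : G.Adj (p 2) (p 1) := by rw [hp.adj (by omega) (by omega)]; omega
      have g23 : G.Adj (p 2) (p 3) := by rw [hp.adj (by omega) (by omega)]; omega
      have hR : IPL Gᶜ (p 2) (p 1) (0+1+1+1) (insert (p 2) (insert (p 0) (insert (p 3) {p 1}))) := by
        refine (((IPL.single Gᶜ (p 1)).cons f13 ?_ ?_).cons f03 ?_ ?_).cons f02 ?_ ?_
        · exact f13.ne
        · rintro v rfl _; rfl
        · rintro (h | h)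
          · exact f03.ne h
          · exact g01.ne h
        · rintro v (h | h) h'
          · exact h
          · rw [h] at h'; exact absurd g01 h'.2
        · rintro (h | h | h)
          · exact f02.ne h
          · exact g23.ne h
          · exact g12.ne h
        · rintro v (h | h | h) h'
          · exact h
          · rw [h] at h'; exact absurd g23 h'.2
          · rw [h] at h'; exact absurd g12 h'.2
      refine hA.noanti hQ hR e1 e2 ⟨?_, ?_⟩ (by omega)
      · rintro u hu (rfl | rfl | rfl | rfl)
        · exact d1 (hQT hu)
        · exact d3 (hQT hu)
        · exact d4 (hQT hu)
        · exact d2 (hQT hu)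
      · rintro u hu v (rfl | rfl | rfl | rfl) h
        · left
          by_contra hne
          exact h.2 (c1 u (hQT hu) (fun e => hne ⟨e, rfl⟩)).symm
        · exact absurd (hc0 u (hQT hu)).symm h.2
        · exact absurd (hck u (hQT hu)).symm h.2
        · right
          by_contra hne
          exact h.2 (c2 u (hQT hu) (fun e => hne ⟨e, rfl⟩)).symm
    · have f : Gᶜ.Adj (p (k-1)) (p 1) := ⟨(hp 1 (k-1) (by omega) (by omega)).1.symm, by
        rw [hp.adj (by omega) (by omega)]; omega⟩
      have hR : IPL Gᶜ (p (k-1)) (p 1) (0+1) (insert (p (k-1)) {p 1}) := by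
        refine (IPL.single Gᶜ (p 1)).cons f ?_ ?_
        · exact f.ne
        · rintro v rfl _; rfl
      refine hA.noanti hQ hR e1 e2 ⟨?_, ?_⟩ (by omega)
      · rintro u hu (rfl | rfl)
        · exact d1 (hQT hu)
        · exact d2 (hQT hu)
      · rintro u hu v (rfl | rfl) h
        · left
          by_contra hne
          exact h.2 (c1 u (hQT hu) (fun e => hne ⟨e, rfl⟩)).symm
        · right
          by_contra hne
          exact h.2 (c2 u (hQT hu) (fun e => hne ⟨e, rfl⟩)).symm
  · have g01 : G.Adj (p 0) (p 1) := by rw [hp.adj (by omega) (by omega)]; omega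
    have gk : G.Adj (p k) (p (k-1)) := by rw [hp.adj (by omega) (by omega)]; omega
    have g0k : ¬ G.Adj (p 0) (p k) := by rw [hp.adj (by omega) (by omega)]; omega
    have n0k : p 0 ≠ p k := (hp 0 k (by omega) le_rfl).1
    have t1k : G.Adj t1 (p k) := (hck t1 ht1).symm
    have t2k : G.Adj t2 (p k) := (hck t2 ht2).symm
    have t10 : G.Adj t1 (p 0) := (hc0 t1 ht1).symm
    have t20 : G.Adj t2 (p 0) := (hc0 t2 ht2).symm
    have hC1 : Conn G {t1, p k} := (Conn.single G (p k)).ins ⟨p k, rfl, t1k⟩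
    have hC2 : Conn G {p 0, t2} := (Conn.single G t2).ins ⟨t2, rfl, t20.symm⟩
    have hC3 := (hp.ipl (a := 1) (b := k-1) (by omega) (by omega)).conn
    refine hA.spr (x1 := t1) (x2 := p 0) (x3 := p 1) (y1 := p k) (y2 := t2) (y3 := p (k-1))
      hC1 hC2 hC3 (Or.inl rfl) (Or.inl rfl) ⟨1, by omega, by omega, rfl⟩ (Or.inr rfl) (Or.inr rfl)
      ⟨k-1, by omega, by omega, rfl⟩ t10 g01 a1 t2k.symm b1 gk t1k.ne t20.ne.symm
      (hp 1 (k-1) (by omega) (by omega)).1 ⟨?_, ?_⟩ ⟨?_, ?_⟩ ⟨?_, ?_⟩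
    · rintro u (rfl | rfl) (h | h)
      · exact d3 (h ▸ ht1)
      · exact h12 h
      · exact n0k h.symm
      · exact d4 (h ▸ ht2)
    · rintro u (rfl | rfl) v (rfl | rfl) h
      · exact Or.inl ⟨rfl, rfl⟩
      · exact absurd h hadj
      · exact absurd h.symm g0k
      · exact Or.inr ⟨rfl, rfl⟩
    · rintro u (rfl | rfl) ⟨i, h1, h2, h3⟩
      · exact hTP i (by omega) (h3 ▸ ht1)
      · have := hp.inj (by omega) (by omega) h3
        omega
    · rintro u (rfl | rfl) v ⟨i, h1, h2, rfl⟩ h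
      · by_cases hi : i = 1
        · left; rw [hi]; exact ⟨rfl, rfl⟩
        · exact absurd h (a2 i (by omega) (by omega))
      · rw [hp.adj (by omega) (by omega)] at h
        right
        rw [show i = k - 1 by omega]; exact ⟨rfl, rfl⟩
    · rintro u (rfl | rfl) ⟨i, h1, h2, h3⟩
      · have := hp.inj (by omega) (by omega) h3
        omega
      · exact hTP i (by omega) (h3 ▸ ht2)
    · rintro u (rfl | rfl) v ⟨i, h1, h2, rfl⟩ h
      · rw [hp.adj (by omega) (by omega)] at h
        left
        rw [show i = 1 by omega]; exact ⟨rfl, rfl⟩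
      · by_cases hi : i = k - 1
        · right; rw [hi]; exact ⟨rfl, rfl⟩
        · exact absurd h (b2 i (by omega) (by omega))

theorem AF.rr1 [Finite V] (hA : AF G) : ∀ (n : ℕ) (T : Set V), T.ncard = n → T.Nonempty →
    Conn Gᶜ T → RR1 G T := by
  intro n
  induction n using Nat.strong_induction_on with
  | _ n ih =>
    intro T hn hne hT x y k S hP hx hy hintr hk1
    obtain ⟨p, hp, rfl, rfl, rfl⟩ := hP
    by_contra hev
    rw [Nat.not_even_iff] at hev
    have hk : 3 ≤ k := by omega
    have hTP : ∀ i, i ≤ k → p i ∉ T := by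
      intro i hi hiT
      have e1 := hx _ hiT
      have e2 := hy _ hiT
      rw [hp.adj (by omega) hi] at e1
      rw [hp.adj (by omega) hi] at e2
      omega
    have hintr' : ∀ i, 0 < i → i < k → p i ∉ Cs G T := by
      intro i h1 h2 h3
      rcases hintr _ ⟨i, by omega, rfl⟩ h3 with e | e
      · have := hp.inj (by omega) (by omega) e
        omega
      · have := hp.inj (by omega) (by omega) e
        omega
    obtain ⟨r, hr⟩ := hne
    by_cases hone : ∃ t ∈ T, t ≠ r
    · obtain ⟨t1, ht1, hne1, hcn1⟩ := hT.noncut hr hone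
      obtain ⟨t2, ht2, hne2, hcn2⟩ := hT.noncut ht1 ⟨r, hr, hne1.symm⟩
      -- properties for a noncut vertex
      have hprop : ∀ t ∈ T, (∃ s ∈ T, s ≠ t) → Conn Gᶜ (T \ {t}) →
          (cn (Cs G (T \ {t})) p k % 2 = 1) ∧
          ((G.Adj t (p 1) ∧ ∀ i, 1 < i → i < k → ¬ G.Adj t (p i)) ∨
          (G.Adj t (p (k-1)) ∧ ∀ i, 0 < i → i < k-1 → ¬ G.Adj t (p i))) := by
        intro t ht hex hc
        have hlt : (T \ {t}).ncard < n := by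
          rw [← hn]; exact Set.ncard_sdiff_singleton_lt_of_mem ht (Set.toFinite _)
        obtain ⟨s, hs, hst⟩ := hex
        have hS := ih _ hlt (T \ {t}) rfl ⟨s, hs, hst⟩ hc
        have hsub : Cs G T ⊆ Cs G (T \ {t}) := fun v hv u hu => hv u hu.1
        have htS : t ∉ Cs G (T \ {t}) := by
          intro hall
          have := hT t ht s hs
          rw [Relation.ReflTransGen.cases_head_iff] at this
          rcases this with e | ⟨c, ⟨h1, h2⟩, -⟩
          · exact hst e.symm
          · exact h1.2 (hall c ⟨h2, h1.ne.symm⟩)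
        refine ⟨?_, ?_⟩
        · have := hS.count k p hp (hsub hx) (hsub hy)
          omega
        · refine hA.rr_type hS hp hk hev (fun i hi e => hTP i hi (e ▸ ht)) (hx t ht).symm (hy t ht).symm
            (hsub hx) (hsub hy) htS ?_
          intro i h1 h2 h3 h4
          apply hintr' i h1 h2
          intro u hu
          by_cases hut : u = t
          · rw [hut]; exact h3.symm
          · exact h4 u ⟨hu, hut⟩
      obtain ⟨o1, ty1⟩ := hprop t1 ht1 ⟨t2, ht2, hne2⟩ hcn1
      obtain ⟨o2, ty2⟩ := hprop t2 ht2 ⟨t1, ht1, hne2.symm⟩ hcn2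
      obtain ⟨i1, hi1, u1, u1'⟩ := cn_pos_exists (C := Cs G (T \ {t1})) (p := p) (k := k) (by omega)
      obtain ⟨i2, hi2, u2, u2'⟩ := cn_pos_exists (C := Cs G (T \ {t2})) (p := p) (k := k) (by omega)
      have v1 : G.Adj t2 (p i1) := (u1 t2 ⟨ht2, hne2⟩).symm
      have v1' : G.Adj t2 (p (i1 + 1)) := (u1' t2 ⟨ht2, hne2⟩).symm
      have v2 : G.Adj t1 (p i2) := (u2 t1 ⟨ht1, hne2.symm⟩).symm
      have v2' : G.Adj t1 (p (i2 + 1)) := (u2' t1 ⟨ht1, hne2.symm⟩).symm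
      -- extend completeness
      have hext : ∀ j, 0 < j → j < k → p j ∈ Cs G (T \ {t1}) → ¬ G.Adj t1 (p j) := by
        intro j h1 h2 h3 h4
        apply hintr' j h1 h2
        intro u hu
        by_cases hut : u = t1
        · rw [hut]; exact h4.symm
        · exact h3 u ⟨hu, hut⟩
      have toC1 : ∀ j, p j ∈ Cs G (T \ {t1}) → ∀ t ∈ T, t ≠ t1 → G.Adj (p j) t :=
        fun j h t ht hne => h t ⟨ht, hne⟩
      have toC2 : ∀ j, p j ∈ Cs G (T \ {t2}) → ∀ t ∈ T, t ≠ t2 → G.Adj (p j) t :=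
        fun j h t ht hne => h t ⟨ht, hne⟩
      rcases ty1 with ⟨a1, a2⟩ | ⟨a1, a2⟩ <;> rcases ty2 with ⟨b1, b2⟩ | ⟨b1, b2⟩
      · -- both type 1
        have : i1 = 0 := by
          by_contra h0
          by_cases h1 : i1 = 1
          · exact b2 (i1 + 1) (by omega) (by omega) v1'
          · exact b2 i1 (by omega) (by omega) v1
        subst this
        exact hext 1 (by omega) (by omega) u1' a1
      · -- t1 type 1, t2 type 2
        have e1 : i1 = k - 1 := by
          by_contra h0
          by_cases h1 : i1 = 0
          · exact b2 (i1 + 1) (by omega) (by omega) v1'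
          · exact b2 i1 (by omega) (by omega) v1
        have e2 : i2 = 0 := by
          by_contra h0
          by_cases h1 : i2 = 1
          · exact a2 (i2 + 1) (by omega) (by omega) v2'
          · exact a2 i2 (by omega) (by omega) v2
        subst e1; subst e2
        exact hA.rr_final hT hp hk hev hTP ht1 ht2 hne2.symm hx hy a1 a2 b1 b2 (toC1 _ u1) (toC2 _ u2')
      · have e2 : i2 = k - 1 := by
          by_contra h0
          by_cases h1 : i2 = 0
          · exact a2 (i2 + 1) (by omega) (by omega) v2'
          · exact a2 i2 (by omega) (by omega) v2
        have e1 : i1 = 0 := by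
          by_contra h0
          by_cases h1 : i1 = 1
          · exact b2 (i1 + 1) (by omega) (by omega) v1'
          · exact b2 i1 (by omega) (by omega) v1
        subst e1; subst e2
        exact hA.rr_final hT hp hk hev hTP ht2 ht1 hne2 hx hy b1 b2 a1 a2 (toC2 _ u2) (toC1 _ u1')
      · have e1 : i1 = k - 1 := by
          by_contra h0
          by_cases h1 : i1 = 0
          · exact b2 (i1 + 1) (by omega) (by omega) v1'
          · exact b2 i1 (by omega) (by omega) v1
        subst e1
        exact hext (k-1) (by omega) (by omega) u1 a1
    · push Not at hone
      have hTr : ∀ v, (∀ t ∈ T, G.Adj v t) ↔ G.Adj v r := by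
        intro v; constructor
        · exact fun h => h r hr
        · intro h t ht; rw [hone t ht]; exact h
      have := hA.even (hp.ipl (a := 0) (b := k) (by omega) le_rfl) (IPL.single G r) (hx r hr) (hy r hr)
        ⟨?_, ?_⟩ (by omega)
      · rw [Nat.even_iff] at this; omega
      · rintro u ⟨i, h4, h5, rfl⟩ h6
        exact hTP i h5 (h6 ▸ hr)
      · rintro u ⟨i, h4, h5, rfl⟩ w rfl h6
        by_cases h7 : i = 0
        · left; exact ⟨by rw [h7], rfl⟩
        · by_cases h8 : i = k
          · right; exact ⟨by rw [h8], rfl⟩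
          · exact absurd ((hTr _).2 h6) (hintr' i (by omega) (by omega))

theorem AF.rr [Finite V] (hA : AF G) {T : Set V} (hne : T.Nonempty) (hT : Conn Gᶜ T) : RR1 G T :=
  hA.rr1 _ T rfl hne hT
end

end Artemis

namespace Artemis
variable {V : Type*} {G : SimpleGraph V}

/-- a maximal interesting set (only the properties needed) -/
structure Base (G : SimpleGraph V) (T : Set V) : Prop where
  hA : AF G
  ne : T.Nonempty
  anti : Conn Gᶜ T
  rr : RR1 G T
  hmax : ∀ u, u ∉ T → u ∉ Cs G T → ∀ v ∈ Cs G T, ∀ w ∈ Cs G T, G.Adj u v → G.Adj u w → v ≠ w →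
    G.Adj v w

set_option maxHeartbeats 4000000 in
theorem Base.lemE {T : Set V} (hB : Base G T) {c c' f0 fl b y : V} {l r : ℕ} {H Y : Set V}
    (hc : c ∈ Cs G T) (hc' : c' ∈ Cs G T) (hcc : G.Adj c c') (hH : IPL G f0 fl l H)
    (hHC : ∀ v ∈ H, v ∉ Cs G T ∧ v ∉ T) (hcH : ∀ v ∈ H, (G.Adj c v ↔ v = f0))
    (hcH' : ∀ v ∈ H, (G.Adj c' v ↔ v = fl)) (hl : 1 ≤ l)
    (hb : b ∈ Cs G T)
    (hY : IPL G b y r Y) (hYC : ∀ v ∈ Y, v ≠ b → v ∉ Cs G T ∧ v ∉ T) (hYH : ∀ v ∈ Y, v ∉ H)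
    (hYadj : ∀ u ∈ Y, ∀ v ∈ H, G.Adj u v → u = y) (hy : ∃ v ∈ H, G.Adj y v)
    (hYc : ∀ u ∈ Y, ¬ G.Adj u c ∧ ¬ G.Adj u c') : False := by
  have hA := hB.hA
  have hccne := hcc.ne
  have hcnH : c ∉ H := fun h => (hHC c h).1 hc
  have hcnH' : c' ∉ H := fun h => (hHC c' h).1 hc'
  have hbc := hYc b hY.left
  have hbnc : b ≠ c := by rintro rfl; exact hbc.2 hcc
  have hbnc' : b ≠ c' := by rintro rfl; exact hbc.1 hcc.symm
  have hcY : c ∉ Y := fun h => (hYc c h).2 hcc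
  have hcY' : c' ∉ Y := fun h => (hYc c' h).1 hcc.symm
  have hlodd : l % 2 = 1 := by
    have hcc1 : IPL G c c' (0+1) {c, c'} := (IPL.single G c').cons hcc hcc.ne (by grind)
    have := hA.even hH hcc1 ((hcH f0 hH.left).2 rfl).symm ((hcH' fl hH.right).2 rfl).symm
      ⟨by grind, by grind [G.adj_comm]⟩ (by omega)
    rw [Nat.even_iff] at this; omega
  have outer : ∀ (c f0 w : V) (i : ℕ) (S1 : Set V), c ∈ Cs G T → c ∉ Y → c ∉ H → b ≠ c → (∀ u ∈ Y, ¬ G.Adj u c) →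
      (∀ v ∈ H, (G.Adj c v ↔ v = f0)) → IPL G f0 w i S1 → S1 ⊆ H →
      G.Adj y w → (∀ u ∈ S1, G.Adj y u → u = w) → (r + i) % 2 = 0 := by
    intro c f0 w i S1 hc hcY hcnH hbnc hYc hcH h1 hs hyw hu
    have q : IPL G b c (r + i + 1 + 1) (insert c (Y ∪ S1)) := by
      refine (hY.append h1.symm hyw ?_ ?_).snoc ?_ ?_ ?_
      · grind
      · grind
      · exact ((hcH f0 (hs h1.left)).2 rfl).symm
      · grind
      · grind [G.adj_comm]
    have := hB.rr _ _ _ _ q hb hc (by grind) (by omega)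
    rw [Nat.even_iff] at this; omega
  rcases hH.trich (fun v => G.Adj y v) hy with ⟨w, i, j, S1, S2, hij, hw, h1, h2, rfl, hd, he, hu⟩ |
    ⟨w, w', i, j, S1, S2, hij, hw, hw', hww, h1, h2, rfl, hd, he, hu, hu'⟩ |
    ⟨w, w', i, j, S1, S2, hij, hw, hw', h1, h2, hs, hd, he, hu, hu'⟩
  · have e1 := outer c f0 w i S1 hc hcY hcnH hbnc (fun u h => (hYc u h).1) hcH h1 (by grind) hw (by grind)
    have e2 := outer c' fl w j S2 hc' hcY' hcnH' hbnc' (fun u h => (hYc u h).2) hcH' h2.symm (by grind) hw (by grind)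
    omega
  · have e1 := outer c f0 w i S1 hc hcY hcnH hbnc (fun u h => (hYc u h).1) hcH h1 (by grind) hw (by grind)
    have e2 := outer c' fl w' j S2 hc' hcY' hcnH' hbnc' (fun u h => (hYc u h).2) hcH' h2.symm (by grind) hw' (by grind)
    have cS2 : ∀ v ∈ S2, ¬ G.Adj c v := by
      intro v hv h
      have := (hcH v (Or.inr hv)).1 h
      exact hd v (this ▸ h1.left) hv
    have cS1 : ∀ v ∈ S1, ¬ G.Adj c' v := by
      intro v hv h
      have := (hcH' v (Or.inl hv)).1 h
      exact hd v hv (this ▸ h2.right)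
    have kc1 : Conn G (insert c S1) := h1.conn.ins ⟨f0, h1.left, (hcH f0 (Or.inl h1.left)).2 rfl⟩
    have kc2 : Conn G (insert c' S2) := h2.conn.ins ⟨fl, h2.right, (hcH' fl (Or.inr h2.right)).2 rfl⟩
    have hw1 := h1.right
    have hw2 := h2.left
    have hyY := hY.right
    have hTn : ∀ t ∈ T, t ∉ S1 ∧ t ∉ S2 ∧ t ∉ Y ∧ t ≠ c ∧ t ≠ c' := by
      intro t ht
      refine ⟨fun h => (hHC t (Or.inl h)).2 ht, fun h => (hHC t (Or.inr h)).2 ht, fun h => ?_,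
        (hc t ht).ne.symm, (hc' t ht).ne.symm⟩
      exact (hYC t h (hb t ht).ne.symm).2 ht
    have h2of3 : ∀ t ∈ T, G.Adj w t ∨ G.Adj w' t := by
      intro t ht
      obtain ⟨n1, n2, n3, n4, n5⟩ := hTn t ht
      have tb := (hb t ht).symm
      have tc := (hc t ht).symm
      have tc' := (hc' t ht).symm
      by_cases g1 : ∃ v ∈ S1, G.Adj t v
      · have := hA.sp (t := t) (x1 := w) (x2 := w') (x3 := y) h1.conn kc2 hY.conn hw1 (Or.inr hw2) hyY
          hww hw'.symm hw.symm ⟨by grind, by grind [G.adj_comm]⟩ ⟨by grind, by grind [G.adj_comm]⟩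
          ⟨by grind, by grind [G.adj_comm]⟩ n1 (by grind) n3 g1 ⟨c', by grind, tc'⟩ ⟨b, hY.left, tb⟩
        grind [G.adj_comm]
      by_cases g2 : ∃ v ∈ S2, G.Adj t v
      · have := hA.sp (t := t) (x1 := w) (x2 := w') (x3 := y) kc1 h2.conn hY.conn (Or.inr hw1) hw2 hyY
          hww hw'.symm hw.symm ⟨by grind, by grind [G.adj_comm]⟩ ⟨by grind, by grind [G.adj_comm]⟩
          ⟨by grind, by grind [G.adj_comm]⟩ (by grind) n2 n3 ⟨c, by grind, tc⟩ g2 ⟨b, hY.left, tb⟩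
        grind [G.adj_comm]
      exfalso
      have kt : Conn G (insert t Y) := hY.conn.ins ⟨b, hY.left, tb⟩
      exact hA.spr (x1 := y) (x2 := w) (x3 := w') (y1 := t) (y2 := c) (y3 := c') kt kc1 kc2 
        (Or.inr hyY) (Or.inr hw1) (Or.inr hw2) (Or.inl rfl) (Or.inl rfl) (Or.inl rfl)
        hw hww hw' tc hcc tc' (by grind) (by grind) (by grind)
        ⟨by grind, by grind [G.adj_comm]⟩ ⟨by grind, by grind [G.adj_comm]⟩
          ⟨by grind, by grind [G.adj_comm]⟩
    have w1 := hHC w (Or.inl hw1)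
    have w2 := hHC w' (Or.inr hw2)
    by_cases hr : r = 0
    · have : b = y := hY.zero_iff.1 hr
      subst this
      refine hA.lab hB.anti hww w1.2 w2.2 w1.1 w2.1 h2of3 hc ?_ (cS2 _ hw2)
      intro h
      exact hbc.1 (hB.hmax w w1.2 w1.1 b hb c hc hw.symm h.symm hbnc)
    · have hby : b ≠ y := fun h => hr (hY.zero_iff.2 h)
      exact hA.lab hB.anti hww w1.2 w2.2 w1.1 w2.1 h2of3 hb
        (fun h => hby (hYadj b hY.left w (Or.inl hw1) h)) (fun h => hby (hYadj b hY.left w' (Or.inr hw2) h))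
  · have e1 := outer c f0 w i S1 hc hcY hcnH hbnc (fun u h => (hYc u h).1) hcH h1 (by grind) hw (by grind)
    have e2 := outer c' fl w' j S2 hc' hcY' hcnH' hbnc' (fun u h => (hYc u h).2) hcH' h2.symm (by grind) hw' (by grind)
    have q1 : IPL G w c (i + 1) (insert c S1) := h1.symm.snoc ((hcH f0 (hs (Or.inl h1.left))).2 rfl).symm
      (by grind) (by grind)
    have q2 : IPL G c' w' (j + 1) (insert c' S2) := h2.symm.cons ((hcH' fl (hs (Or.inr h2.right))).2 rfl)
      (by grind) (by grind)
    have hf0 := h1.left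
    have hfl := h2.right
    have q3 := q1.append q2 hcc (by grind) (by grind [G.adj_comm])
    have hyY := hY.right
    have := hA.even q3 (IPL.single G y) hw.symm hw'.symm ⟨by grind, by grind [G.adj_comm]⟩ (by omega)
    rw [Nat.even_iff] at this; omega

end Artemis

namespace Artemis
variable {V : Type*} {G : SimpleGraph V}

/-- vertices of `C(T)` whose only neighbour in `Z` is `z1`. -/
def SA (G : SimpleGraph V) (T : Set V) (z1 : V) (Z : Set V) : Set V :=
  {v | v ∈ Cs G T ∧ ∀ u ∈ Z, (G.Adj v u ↔ u = z1)}

/-- a shortest outer path, with interior `Z`. -/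
structure Setting (G : SimpleGraph V) (T : Set V) (z1 zn : V) (n : ℕ) (Z : Set V) : Prop
    extends Base G T where
  hZ : IPL G z1 zn n Z
  n2 : 2 ≤ n
  nev : n % 2 = 0
  hZC : ∀ v ∈ Z, v ∉ Cs G T ∧ v ∉ T
  hAne : ∃ a, a ∈ SA G T z1 Z
  hBne : ∃ a, a ∈ SA G T zn Z
  hshort : ∀ x y k S, IPL G x y k S → x ∈ Cs G T → y ∈ Cs G T → 2 ≤ k →
    (∀ v ∈ S, v ∈ Cs G T → v = x ∨ v = y) → (∀ v ∈ S, v ∉ T) → n + 2 ≤ k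

variable {T : Set V} {z1 zn : V} {n : ℕ} {Z : Set V}

theorem Setting.symm (h : Setting G T z1 zn n Z) : Setting G T zn z1 n Z :=
  { h with hZ := h.hZ.symm, hAne := h.hBne, hBne := h.hAne }

/-- common neighbours of two far vertices -/
theorem notT {x y : V} {k : ℕ} {S : Set V} (h : IPL G x y k S) (hx : x ∈ Cs G T)
    (hy : y ∈ Cs G T) (hk : 3 ≤ k) : ∀ v ∈ S, v ∉ T := by
  intro v hv ht
  have := h.two_of_common hv (hx v ht).symm (hy v ht).symm
  omega

theorem Setting.outer (h : Setting G T z1 zn n Z) {x y : V} {k : ℕ} {S : Set V}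
    (hp : IPL G x y k S) (hx : x ∈ Cs G T)
    (hy : y ∈ Cs G T) (hk : 3 ≤ k) (hS : ∀ v ∈ S, v ∈ Cs G T → v = x ∨ v = y) :
    n + 2 ≤ k ∧ k % 2 = 0 := by
  refine ⟨h.hshort x y k S hp hx hy (by omega) hS (notT hp hx hy hk), ?_⟩
  exact Nat.even_iff.1 (h.rr x y k S hp hx hy hS (by omega))

theorem Setting.zne (h : Setting G T z1 zn n Z) : z1 ≠ zn := by
  intro e
  have := h.hZ.zero_iff.2 e
  have := h.n2
  omega

theorem Setting.clique (h : Setting G T z1 zn n Z) {a a' : V} (ha : a ∈ SA G T z1 Z)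
    (ha' : a' ∈ SA G T z1 Z) (hne : a ≠ a') : G.Adj a a' := by
  have hz := h.hZC z1 h.hZ.left
  exact h.hmax z1 hz.2 hz.1 a ha.1 a' ha'.1 ((ha.2 z1 h.hZ.left).2 rfl).symm
    ((ha'.2 z1 h.hZ.left).2 rfl).symm hne

theorem Setting.ab_ne (h : Setting G T z1 zn n Z) {a b : V} (ha : a ∈ SA G T z1 Z)
    (hb : b ∈ SA G T zn Z) : a ≠ b := by
  rintro rfl
  exact h.zne ((hb.2 z1 h.hZ.left).1 ((ha.2 z1 h.hZ.left).2 rfl))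

theorem Setting.SA_notZ (h : Setting G T z1 zn n Z) {w a : V} (ha : a ∈ SA G T w Z) : a ∉ Z :=
  fun h' => (h.hZC a h').1 ha.1

theorem Setting.ab_nadj (h : Setting G T z1 zn n Z) {a b : V} (ha : a ∈ SA G T z1 Z)
    (hb : b ∈ SA G T zn Z) : ¬ G.Adj a b := by
  intro hab
  have q : IPL G a b (0+1) {a, b} := (IPL.single G b).cons hab hab.ne (by grind)
  have h1 := h.SA_notZ ha
  have h2 := h.SA_notZ hb
  have ha2 := ha.2
  have hb2 := hb.2
  have := h.hA.even h.hZ q ((ha.2 z1 h.hZ.left).2 rfl).symm ((hb.2 zn h.hZ.right).2 rfl).symm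
    ⟨by grind, by grind [G.adj_comm]⟩ (by have := h.n2; omega)
  rw [Nat.even_iff] at this
  have := h.nev
  omega

theorem Setting.touch (h : Setting G T z1 zn n Z) {a c : V} (ha : a ∈ SA G T z1 Z)
    (hc : c ∈ Cs G T) (ht : ∃ u ∈ Z, G.Adj c u) (hne : c ≠ a) (hna : ¬ G.Adj c a) :
    c ∈ SA G T zn Z := by
  obtain ⟨w, i, j, S1, S2, hij, hw, h1, h2, hS, hu, hd, he⟩ := h.hZ.first _ ht
  have hs1 : S1 ⊆ Z := by rw [hS]; exact Set.subset_union_left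
  have ha2 := ha.2
  have hZC := h.hZC
  have hcZ : c ∉ Z := fun h' => (h.hZC c h').1 hc
  have haZ := h.SA_notZ ha
  have haC := ha.1
  have q : IPL G a c (i + 1 + 1) (insert c (insert a S1)) := by
    refine (h1.cons ((ha.2 z1 h.hZ.left).2 rfl) ?_ ?_).snoc hw.symm ?_ ?_
    · grind
    · grind
    · grind
    · grind
  have e : i = n := by
    by_cases hi : i = 0
    · have e : z1 = w := h1.zero_iff.1 hi
      have hz := h.hZC z1 h.hZ.left
      exact absurd (h.hmax z1 hz.2 hz.1 c hc a ha.1 (e ▸ hw.symm)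
        ((ha.2 z1 h.hZ.left).2 rfl).symm hne) hna
    · have := (h.outer q ha.1 hc (by omega) (by grind)).1
      omega
  have hj : j = 0 := by omega
  subst hj
  obtain ⟨rfl, rfl⟩ := h2.zero
  have hwS := h1.right
  refine ⟨hc, fun u huZ => ⟨fun h' => hu u ?_ h', ?_⟩⟩
  · grind
  · rintro rfl; exact hw

theorem Setting.nbZ (h : Setting G T z1 zn n Z) {u : V} (hu : u ∈ Z) : ∃ v ∈ Z, G.Adj u v := by
  by_cases e : u = zn
  · subst e
    obtain ⟨w, S2, h1, h2, -, h3, -⟩ := h.hZ.symm.tail h.zne.symm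
    exact ⟨w, h2 ▸ Or.inr h1.left, h3⟩
  · obtain ⟨i, w, S1, S2, -, -, h1, h2, -, h3, -⟩ := h.hZ.cut hu e
    exact ⟨w, h2 ▸ Or.inr h1.left, h3⟩

theorem exists_max {Q : ℕ → Prop} {h : ℕ} (hQ : ∃ i, i ≤ h ∧ Q i) :
    ∃ i, i ≤ h ∧ Q i ∧ ∀ j, j ≤ h → Q j → j ≤ i := by
  classical
  obtain ⟨i, hi, hq⟩ := hQ
  exact ⟨Nat.findGreatest Q h, Nat.findGreatest_le h, Nat.findGreatest_spec hi hq,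
    fun j hj hqj => Nat.le_findGreatest hj hqj⟩

theorem exists_min {Q : ℕ → Prop} (hQ : ∃ i, Q i) :
    ∃ i, Q i ∧ ∀ j, Q j → i ≤ j := by
  classical
  exact ⟨Nat.find hQ, Nat.find_spec hQ, fun j hj => Nat.find_min' hQ hj⟩

/-- interior `C`-vertices of a path from `A` to `B` do not touch `Z`. -/
theorem Setting.untouched (h : Setting G T z1 zn n Z) {a b : V} {k : ℕ} {P : Set V}
    (ha : a ∈ SA G T z1 Z) (hb : b ∈ SA G T zn Z) (hP : IPL G a b k P) (hk : 3 ≤ k)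
    (hPA : ∀ v ∈ P, v ∈ SA G T z1 Z → v = a) (hPB : ∀ v ∈ P, v ∈ SA G T zn Z → v = b)
    {c : V} (hc : c ∈ P) (hcC : c ∈ Cs G T) (hca : c ≠ a) (hcb : c ≠ b) :
    ∀ u ∈ Z, ¬ G.Adj c u := by
  intro u hu hcu
  by_cases e : G.Adj c a
  · have e' : ¬ G.Adj c b := by
      intro e'
      have := hP.two_of_common hc e e'
      omega
    exact hca (hPA c hc (h.symm.touch hb hcC ⟨u, hu, hcu⟩ hcb e'))
  · exact hcb (hPB c hc (h.touch ha hcC ⟨u, hu, hcu⟩ hca e))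

set_option maxHeartbeats 4000000 in
theorem Setting.claim1 (h : Setting G T z1 zn n Z) {a b : V} {k : ℕ} {P : Set V}
    (ha : a ∈ SA G T z1 Z) (hb : b ∈ SA G T zn Z) (hP : IPL G a b k P)
    (hPA : ∀ v ∈ P, v ∈ SA G T z1 Z → v = a) (hPB : ∀ v ∈ P, v ∈ SA G T zn Z → v = b) :
    k % 2 = 0 := by
  by_contra hodd
  have hk : 3 ≤ k := by
    have : k ≠ 1 := fun e => h.ab_nadj ha hb (hP.one_iff.1 e)
    omega
  have hPT := notT hP ha.1 hb.1 hk
  have hunt := fun c => h.untouched ha hb hP hk hPA hPB (c := c)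
  have haz := (ha.2 z1 h.hZ.left).2 rfl
  have hbz := (hb.2 zn h.hZ.right).2 rfl
  obtain ⟨p, hp, rfl, rfl, rfl⟩ := hP
  have haC := ha.1
  have hbC := hb.1
  have hcnt := h.rr.count k p hp haC hbC
  set C := Cs G T with hCdef
  have hZC := h.hZC
  -- touch
  have tch : ∀ i, i ≤ k → p i ∈ C → (∃ u ∈ Z, G.Adj (p i) u) → i = 0 ∨ i = k := by
    intro i hi hc ⟨u, hu, hau⟩
    by_contra hcon
    refine hunt (p i) ⟨i, hi, rfl⟩ hc ?_ ?_ u hu hau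
    · intro e; have := hp.inj hi (by omega) e; omega
    · intro e; have := hp.inj hi (by omega) e; omega
  have ZT : ∀ i, p i ∈ Z → ∃ u ∈ Z, G.Adj (p i) u := fun i hi => h.nbZ hi
  obtain ⟨hh, ⟨hhk, hht, hhodd⟩, hhmin⟩ := exists_min
    (Q := fun i => i ≤ k ∧ (∃ u ∈ Z, G.Adj (p i) u) ∧ cn C p i % 2 = 1)
    ⟨k, le_rfl, ⟨zn, h.hZ.right, hbz⟩, by omega⟩
  have hh0 : hh ≠ 0 := by rintro rfl; simp [cn] at hhodd
  obtain ⟨g, hgh, hgt, hgmax⟩ := exists_max (h := hh - 1)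
    (Q := fun i => (∃ u ∈ Z, G.Adj (p i) u)) ⟨0, by omega, z1, h.hZ.left, haz⟩
  have hgev : cn C p g % 2 = 0 := by
    by_contra hcon
    have := hhmin g ⟨by omega, hgt, by omega⟩
    omega
  have unt : ∀ i, g < i → i < hh → (∀ u ∈ Z, ¬ G.Adj (p i) u) ∧ p i ∉ Z := by
    intro i h1 h2
    have h3 : ¬ ∃ u ∈ Z, G.Adj (p i) u := by
      intro h3
      have := hgmax i (by omega) h3
      omega
    refine ⟨by grind, fun h4 => h3 (ZT i h4)⟩
  have hCe : ∃ i, g ≤ i ∧ i < hh ∧ p i ∈ C ∧ p (i+1) ∈ C := by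
    by_contra hcon
    have := cn_const (C := C) (p := p) (a := g) (b := hh) (by omega)
      (fun i h1 h2 h3 => hcon ⟨i, h1, h2, h3.1, h3.2⟩)
    omega
  obtain ⟨e0, he1, he2, he3, he4⟩ := hCe
  have hg2 : g + 2 ≤ hh := by
    by_contra hcon
    have : hh = g + 1 := by omega
    have h1 : e0 = g := by omega
    subst h1
    have h2 := tch e0 (by omega) he3 hgt
    have h3 := tch (e0+1) (by omega) he4 (this ▸ hht)
    omega
  obtain ⟨lo, ⟨hlo1, hlo2, hloC⟩, hlomin⟩ := exists_min
    (Q := fun i => g ≤ i ∧ i ≤ hh ∧ p i ∈ C) ⟨e0, he1, by omega, he3⟩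
  obtain ⟨hi, hhi1, ⟨hhi2, hhiC⟩, hhimax⟩ := exists_max (h := hh)
    (Q := fun i => g ≤ i ∧ p i ∈ C) ⟨e0, by omega, he1, he3⟩
  have hlohi : lo < hi := by
    have h1 := hlomin e0 ⟨he1, by omega, he3⟩
    have h2 := hhimax (e0+1) (by omega) ⟨by omega, he4⟩
    omega
  have hpar : (hi - lo) % 2 = 1 := by
    have c1 : cn C p lo = cn C p g := cn_const hlo1 (fun i h1 h2 h3 => by
      have := hlomin i ⟨h1, by omega, h3.1⟩; omega)
    have c2 : cn C p hh = cn C p hi := cn_const hhi1 (fun i h1 h2 h3 => by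
      have := hhimax (i+1) (by omega) ⟨by omega, h3.2⟩; omega)
    have c3 := cn_shift (C := C) (p := p) lo (hi - lo)
    have e1 : lo + (hi - lo) = hi := by omega
    have c4 := h.rr.count (hi - lo) (fun i => p (lo + i)) ((hp.mono (by omega : hi ≤ k)).shift lo)
      hloC (by simpa [e1] using hhiC)
    rw [e1] at c3
    rw [← hCdef] at c4
    omega
  set L : Set V := {v | ∃ i, g ≤ i ∧ i < lo ∧ p i = v} with hL
  set R : Set V := {v | ∃ i, hi < i ∧ i ≤ hh ∧ p i = v} with hR
  have hLm : ∀ v, v ∈ L → ∃ i, g ≤ i ∧ i < lo ∧ p i = v := fun v hv => hv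
  have hRm : ∀ v, v ∈ R → ∃ i, hi < i ∧ i ≤ hh ∧ p i = v := fun v hv => hv
  have hLi : ∀ i, g ≤ i → i < lo → p i ∈ L := fun i h1 h2 => ⟨i, h1, h2, rfl⟩
  have hRi : ∀ i, hi < i → i ≤ hh → p i ∈ R := fun i h1 h2 => ⟨i, h1, h2, rfl⟩
  have adj : ∀ i j, i ≤ k → j ≤ k → (G.Adj (p i) (p j) ↔ (j = i + 1 ∨ i = j + 1)) :=
    fun i j h1 h2 => hp.adj h1 h2
  have inj : ∀ i j, i ≤ k → j ≤ k → p i = p j → i = j := fun i j h1 h2 => hp.inj h1 h2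
  have cF1 : Conn G (Z ∪ L) := by
    by_cases e : g < lo
    · have h1 := isIP_conn (G := G) (p := p) g (lo - 1) (fun i h1 h2 => (adj _ _ (by omega) (by omega)).2 (by omega))
      have h2 : L = {v | ∃ i, g ≤ i ∧ i ≤ lo - 1 ∧ p i = v} := by
        ext v; constructor
        · rintro ⟨i, h3, h4, h5⟩; exact ⟨i, h3, by omega, h5⟩
        · rintro ⟨i, h3, h4, h5⟩; exact ⟨i, h3, by omega, h5⟩
      rw [h2]
      obtain ⟨u, hu, hau⟩ := hgt
      exact h.hZ.conn.union h1 ⟨u, hu, p g, ⟨g, by omega, by omega, rfl⟩, Or.inr hau.symm⟩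
    · have : L = ∅ := by
        ext v; simp only [Set.mem_empty_iff_false, iff_false]
        rintro ⟨i, h1, h2, h3⟩; omega
      rw [this, Set.union_empty]; exact h.hZ.conn
  have cF : Conn G (Z ∪ L ∪ R) := by
    by_cases e : hi < hh
    · have h1 := isIP_conn (G := G) (p := p) (hi+1) hh (fun i h1 h2 => (adj _ _ (by omega) (by omega)).2 (by omega))
      have h2 : R = {v | ∃ i, hi + 1 ≤ i ∧ i ≤ hh ∧ p i = v} := by
        ext v; constructor
        · rintro ⟨i, h3, h4, h5⟩; exact ⟨i, h3, by omega, h5⟩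
        · rintro ⟨i, h3, h4, h5⟩; exact ⟨i, h3, by omega, h5⟩
      rw [h2]
      obtain ⟨u, hu, hau⟩ := hht
      exact cF1.union h1 ⟨u, Or.inl hu, p hh, ⟨hh, by omega, by omega, rfl⟩, Or.inr hau.symm⟩
    · have : R = ∅ := by
        ext v; simp only [Set.mem_empty_iff_false, iff_false]
        rintro ⟨i, h1, h2, h3⟩; omega
      rw [this, Set.union_empty]; exact cF1
  have exc : ∃ x ∈ Z ∪ L ∪ R, G.Adj (p lo) x := by
    by_cases e : g < lo
    · exact ⟨p (lo - 1), Or.inl (Or.inr (hLi _ (by omega) (by omega))), (adj _ _ (by omega) (by omega)).2 (by omega)⟩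
    · have : g = lo := by omega
      subst this
      obtain ⟨u, hu, hau⟩ := hgt
      exact ⟨u, Or.inl (Or.inl hu), hau⟩
  have exc' : ∃ x ∈ Z ∪ L ∪ R, G.Adj (p hi) x := by
    by_cases e : hi < hh
    · exact ⟨p (hi + 1), Or.inr (hRi _ (by omega) (by omega)), (adj _ _ (by omega) (by omega)).2 (by omega)⟩
    · have : hi = hh := by omega
      subst this
      obtain ⟨u, hu, hau⟩ := hht
      exact ⟨u, Or.inl (Or.inl hu), hau⟩
  obtain ⟨x, hxF, hx⟩ := exc
  obtain ⟨x', hxF', hx'⟩ := exc'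
  obtain ⟨u, v, l, H, hH, hHF, hu, hv, huu, hvv⟩ :=
    cF.path hxF hxF' (fun w => G.Adj (p lo) w) (fun w => G.Adj (p hi) w) hx hx'
  have hHC : ∀ w ∈ H, w ∉ C ∧ w ∉ T := by
    intro w hw
    rcases hHF hw with (hw | ⟨i, h1, h2, rfl⟩) | ⟨i, h1, h2, rfl⟩
    · exact hZC w hw
    · refine ⟨fun h3 => ?_, hPT _ ⟨i, by omega, rfl⟩⟩
      have := hlomin i ⟨h1, by omega, h3⟩; omega
    · refine ⟨fun h3 => ?_, hPT _ ⟨i, by omega, rfl⟩⟩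
      have := hhimax i h2 ⟨by omega, h3⟩; omega
  have hloH : p lo ∉ H := fun h1 => (hHC _ h1).1 hloC
  have hhiH : p hi ∉ H := fun h1 => (hHC _ h1).1 hhiC
  by_cases hfar : lo + 1 < hi
  · -- hole
    have q : IPL G (p lo) (p hi) (l + 1 + 1) (insert (p hi) (insert (p lo) H)) := by
      refine (hH.cons hu hloH huu).snoc hv.symm ?_ ?_
      · rintro (e | e)
        · have := inj _ _ (by omega) (by omega) e; omega
        · exact hhiH e
      · rintro w (rfl | hw) hadj
        · have := (adj _ _ (by omega) (by omega)).1 hadj; omega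
        · exact hvv w hw hadj
    have e1 := h.rr _ _ _ _ q hloC hhiC (by grind) (by omega)
    have q2 := hp.ipl hlohi.le (show hi ≤ k by omega)
    have key : ∀ i, lo ≤ i → i ≤ hi → p i ∉ H ∧ ∀ w ∈ H, G.Adj (p i) w → (i = lo ∧ w = u) ∨ (i = hi ∧ w = v) := by
      intro i h1 h2
      rcases eq_or_lt_of_le h1 with e | h1'
      · subst e
        exact ⟨hloH, fun w hw h3 => Or.inl ⟨rfl, huu w hw h3⟩⟩
      rcases eq_or_lt_of_le h2 with e | h2'
      · subst e
        exact ⟨hhiH, fun w hw h3 => Or.inr ⟨rfl, hvv w hw h3⟩⟩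
      have h4 := unt i (by omega) (by omega)
      constructor
      · intro h5
        rcases hHF h5 with (hw | ⟨j, h6, h7, h8⟩) | ⟨j, h6, h7, h8⟩
        · exact h4.2 hw
        · have := inj _ _ (by omega) (by omega) h8; omega
        · have := inj _ _ (by omega) (by omega) h8; omega
      · intro w hw h3
        rcases hHF hw with (hw | ⟨j, h6, h7, rfl⟩) | ⟨j, h6, h7, rfl⟩
        · exact absurd h3 (h4.1 _ hw)
        · have := (adj _ _ (by omega) (by omega)).1 h3; omega
        · have := (adj _ _ (by omega) (by omega)).1 h3; omega
    have := h.hA.even q2 hH hu hv ⟨?_, ?_⟩ (by omega)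
    · rw [Nat.even_iff] at this e1
      omega
    · rintro _ ⟨i, h1, h2, rfl⟩; exact (key i h1 h2).1
    · rintro _ ⟨i, h1, h2, rfl⟩ w hw h3
      rcases (key i h1 h2).2 w hw h3 with ⟨rfl, rfl⟩ | ⟨rfl, rfl⟩
      · exact Or.inl ⟨rfl, rfl⟩
      · exact Or.inr ⟨rfl, rfl⟩
  · have ehi : hi = lo + 1 := by omega
    have hinotk : hi ≠ k → hi + 2 ≤ k := by
      intro h1
      have h2 : hi ≠ hh := by
        intro e
        rcases tch hi (by omega) hhiC (e ▸ hht) with h3 | h3 <;> omega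
      by_contra h3
      have h4 : hh = k := by omega
      have := hhimax hh le_rfl ⟨by omega, by rw [h4]; exact hbC⟩
      omega
    have loT : (∃ u ∈ Z, G.Adj (p lo) u) → lo = 0 := by
      intro h1
      rcases tch lo (by omega) hloC h1 with h2 | h2 <;> omega
    have hiT : (∃ u ∈ Z, G.Adj (p hi) u) → hi = k := by
      intro h1
      rcases tch hi (by omega) hhiC h1 with h2 | h2 <;> omega
    -- neighbours of c, c' in F
    have nbc : ∀ w ∈ Z ∪ L ∪ R, G.Adj (p lo) w → (w ∈ Z ∧ lo = 0) ∨ (w ∈ L) := by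
      rintro w ((hw | hw) | ⟨i, h1, h2, rfl⟩) h3
      · exact Or.inl ⟨hw, loT ⟨w, hw, h3⟩⟩
      · exact Or.inr hw
      · have := (adj _ _ (by omega) (by omega)).1 h3; omega
    have nbc' : ∀ w ∈ Z ∪ L ∪ R, G.Adj (p hi) w → (w ∈ Z ∧ hi = k) ∨ (w ∈ R) := by
      rintro w ((hw | ⟨i, h1, h2, rfl⟩) | hw) h3
      · exact Or.inl ⟨hw, hiT ⟨w, hw, h3⟩⟩
      · have := (adj _ _ (by omega) (by omega)).1 h3; omega
      · exact Or.inr hw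
    have LRadj : ∀ x ∈ L, ∀ y ∈ R, ¬ G.Adj x y ∧ x ≠ y := by
      rintro _ ⟨i, h1, h2, rfl⟩ _ ⟨j, h3, h4, rfl⟩
      refine ⟨fun h5 => ?_, fun h5 => ?_⟩
      · have := (adj _ _ (by omega) (by omega)).1 h5; omega
      · have := inj _ _ (by omega) (by omega) h5; omega
    have hHZ : ∃ ζ ∈ H, ζ ∈ Z := by
      by_contra hcon
      push Not at hcon
      have huL : u ∈ L := by
        rcases nbc u (hHF hH.left) hu with h1 | h1
        · exact absurd h1.1 (hcon u hH.left)
        · exact h1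
      have hvR : v ∈ R := by
        rcases nbc' v (hHF hH.right) hv with h1 | h1
        · exact absurd h1.1 (hcon v hH.right)
        · exact h1
      obtain ⟨w, i, j, S1, S2, hij, hw, h1, h2, hS, hun, -⟩ := hH.first (fun w => w ∈ R) ⟨v, hH.right, hvR⟩
      have hwu : w ≠ u := fun e => (LRadj u huL w hw).2 e.symm
      obtain ⟨w', S', h3, h4, h5, h6, -⟩ := h1.symm.tail hwu
      have hw'H : w' ∈ H := by rw [hS, h4]; exact Or.inl (Or.inr h3.left)
      rcases hHF hw'H with (h7 | h7) | h7
      · exact hcon _ hw'H h7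
      · exact (LRadj w' h7 w hw).1 h6.symm
      · have := hun w' (h4 ▸ Or.inr h3.left) h7
        exact h6.ne this.symm
    have hl : 1 ≤ l := by
      by_contra hl
      have e : u = v := hH.zero_iff.1 (by omega)
      subst e
      rcases nbc u (hHF hH.left) hu with h1 | h1
      · rcases nbc' u (hHF hH.left) hv with h2 | h2
        · omega
        · obtain ⟨i, h3, h4, rfl⟩ := h2
          have := (adj _ _ (by omega) (by omega)).1 hu; omega
      · obtain ⟨i, h3, h4, rfl⟩ := h1
        have := (adj _ _ (by omega) (by omega)).1 hv; omega
    obtain ⟨ζ, hζH, hζZ⟩ := hHZ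
    -- the terminal d
    have main : ∀ d, d ∈ C → (∃ u ∈ Z, G.Adj d u) → ¬ G.Adj d (p lo) → ¬ G.Adj d (p hi) → False := by
      intro d hdC hdZ hd1 hd2
      have cY : Conn G (insert d Z) := h.hZ.conn.ins hdZ
      obtain ⟨ξ, hξZ, hξ⟩ := h.nbZ hζZ
      obtain ⟨y, r, Y, hY, hYF, ⟨s, hsH, hys⟩, hYu⟩ := cY.pathFrom (Or.inl rfl) (Or.inr hξZ)
        (fun w => ∃ s ∈ H, G.Adj w s) ⟨ζ, hζH, hξ.symm⟩
      have hdH : d ∉ H := fun h1 => (hHC d h1).1 hdC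
      have Hnb : ∀ w ∈ H, ∃ s ∈ H, G.Adj w s := by
        intro w hw
        by_cases e : w = v
        · obtain ⟨w', S', h3, h4, h5, h6, -⟩ := hH.symm.tail (show v ≠ u by
            intro e; have := hH.zero_iff.2 e.symm; omega)
          exact ⟨w', h4 ▸ Or.inr h3.left, e ▸ h6⟩
        · obtain ⟨i, w', S1, S2, -, -, h1, h2, -, h3, -⟩ := hH.cut hw e
          exact ⟨w', h2 ▸ Or.inr h1.left, h3⟩
      have hYH : ∀ w ∈ Y, w ∉ H := by
        intro w hw hwH
        have e := hYu w hw (Hnb w hwH)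
        subst e
        have hdw : w ≠ d := by rintro rfl; exact hdH hwH
        obtain ⟨w', S', h3, h4, h5, h6, -⟩ := hY.symm.tail hdw
        have := hYu w' (h4 ▸ Or.inr h3.left) ⟨w, hwH, h6.symm⟩
        exact h6.ne this.symm
      refine h.lemE hloC hhiC ((adj _ _ (by omega) (by omega)).2 (by omega)) hH hHC
        (fun w hw => ⟨huu w hw, by rintro rfl; exact hu⟩)
        (fun w hw => ⟨hvv w hw, by rintro rfl; exact hv⟩) hl hdC hY ?_ hYH
        (fun w hw s hs has => hYu w hw ⟨s, hs, has⟩) ⟨s, hsH, hys⟩ ?_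
      · intro w hw hwd
        rcases hYF hw with h1 | h1
        · exact absurd h1 hwd
        · exact hZC w h1
      · intro w hw
        rcases hYF hw with h1 | h1
        · rw [h1]; exact ⟨hd1, hd2⟩
        · constructor
          · intro h2
            have h3 := loT ⟨w, h1, h2.symm⟩
            have h4 : w = z1 := (ha.2 w h1).1 (by rw [← h3]; exact h2.symm)
            rcases nbc u (hHF hH.left) hu with h5 | ⟨i, h5, h6, h7⟩
            · have h6 : u = z1 := (ha.2 u h5.1).1 (by rw [← h3]; exact hu)
              exact hYH w hw (by rw [h4, ← h6]; exact hH.left)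
            · omega
          · intro h2
            have h3 := hiT ⟨w, h1, h2.symm⟩
            have h4 : w = zn := (hb.2 w h1).1 (by rw [← h3]; exact h2.symm)
            rcases nbc' v (hHF hH.right) hv with h5 | ⟨i, h5, h6, h7⟩
            · have h6 : v = zn := (hb.2 v h5.1).1 (by rw [← h3]; exact hv)
              exact hYH w hw (by rw [h4, ← h6]; exact hH.right)
            · omega
    by_cases e : hi = k
    · refine main (p 0) haC ⟨z1, h.hZ.left, haz⟩ ?_ ?_
      · rw [adj _ _ (by omega) (by omega)]; omega
      · rw [adj _ _ (by omega) (by omega)]; omega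
    · have := hinotk e
      refine main (p k) hbC ⟨zn, h.hZ.right, hbz⟩ ?_ ?_
      · rw [adj _ _ (by omega) (by omega)]; omega
      · rw [adj _ _ (by omega) (by omega)]; omega

end Artemis

namespace Artemis
variable {V : Type*} {G : SimpleGraph V}
variable {T : Set V} {z1 zn : V} {n : ℕ} {Z : Set V}

/-- the initial segment of `Z` up to the first vertex touching `X` outside `a, a'`. -/
structure FQ (G : SimpleGraph V) (z1 zn zq a a' : V) (n r : ℕ) (Z Q X : Set V) : Prop where
  hQ : IPL G z1 zq r Q
  sub : Q ⊆ Z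
  tch : ∃ v ∈ X, v ≠ a ∧ v ≠ a' ∧ G.Adj zq v
  uni : ∀ u ∈ Q, ∀ v ∈ X, G.Adj u v → v = a ∨ v = a' ∨ u = zq
  dis : ∀ u ∈ Q, u ∉ X
  full : zq = zn → r = n ∧ Q = Z
  az : ∀ u ∈ Q, (G.Adj a u ↔ u = z1)
  az' : ∀ u ∈ Q, (G.Adj a' u ↔ u = z1)
  nota : a ∉ Q
  nota' : a' ∉ Q

theorem Setting.getQ (h : Setting G T z1 zn n Z) {a a' : V} {X : Set V} (ha : a ∈ SA G T z1 Z)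
    (ha' : a' ∈ SA G T z1 Z) (hX : ∃ u ∈ Z, ∃ v ∈ X, v ≠ a ∧ v ≠ a' ∧ G.Adj u v)
    (hXa : ∀ v ∈ X, v ≠ a → v ≠ a' → ¬ (G.Adj v a ∧ G.Adj v a')) :
    ∃ zq r Q, FQ G z1 zn zq a a' n r Z Q X := by
  obtain ⟨zq, r, s, Q, Q2, hrs, hzq, h1, h2, hS, hu, hd, he⟩ := h.hZ.first _ hX
  have sub : Q ⊆ Z := by rw [hS]; exact Set.subset_union_left
  have na := h.SA_notZ ha
  have na' := h.SA_notZ ha'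
  refine ⟨zq, r, Q, h1, sub, hzq, fun u hu1 v hv h5 => by
    by_contra hcon
    push Not at hcon
    exact hcon.2.2 (hu u hu1 ⟨v, hv, hcon.1, hcon.2.1, h5⟩), ?_, ?_,
    fun u hu => ha.2 u (sub hu), fun u hu => ha'.2 u (sub hu), fun h => na (sub h),
    fun h => na' (sub h)⟩
  · intro v hv hvX
    have hva : v ≠ a := by rintro rfl; exact na (sub hv)
    have hva' : v ≠ a' := by rintro rfl; exact na' (sub hv)
    by_cases e : v = z1
    · subst e
      exact hXa v hvX hva hva' ⟨((ha.2 v h.hZ.left).2 rfl).symm, ((ha'.2 v h.hZ.left).2 rfl).symm⟩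
    · obtain ⟨i, j, S1, S2, hij, k1, k2, rfl, k3, k4⟩ := h1.split hv
      obtain ⟨w, S', m1, m2, m3, m4, m5⟩ := k1.symm.tail e
      have hw : w ∈ S1 := m2 ▸ Or.inr m1.left
      have := hu w (Or.inl hw) ⟨v, hvX, hva, hva', m4.symm⟩
      subst this
      exact m4.ne (k3 w hw k2.right).symm
  · rintro rfl
    have hs : s = 0 := h2.zero_iff.2 rfl
    subst hs
    obtain ⟨-, rfl⟩ := h2.zero
    refine ⟨by omega, ?_⟩
    have := h1.right
    rw [hS]; grind

/-- configuration of type 2 -/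
structure Ty2 (G : SimpleGraph V) (T : Set V) (z1 zn : V) (Z : Set V) (a b a' b' : V) (l m : ℕ)
    (X1 X2 : Set V) : Prop where
  ha : a ∈ SA G T z1 Z
  ha' : a' ∈ SA G T z1 Z
  hb : b ∈ SA G T zn Z
  hb' : b' ∈ SA G T zn Z
  h1 : IPL G a b l X1
  h2 : IPL G a' b' m X2
  pl : l % 2 = 0
  pm : m % 2 = 0
  haa : G.Adj a a'
  hbb : G.Adj b b'
  t : TwoE G a b a' b' X1 X2
  hA1 : ∀ v ∈ X1, v ∈ SA G T z1 Z → v = a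
  hA2 : ∀ v ∈ X2, v ∈ SA G T z1 Z → v = a'
  hB1 : ∀ v ∈ X1, v ∈ SA G T zn Z → v = b
  hB2 : ∀ v ∈ X2, v ∈ SA G T zn Z → v = b'

variable {a b a' b' : V} {l m : ℕ} {X1 X2 : Set V}

theorem Ty2.swap (h : Ty2 G T z1 zn Z a b a' b' l m X1 X2) : Ty2 G T z1 zn Z a' b' a b m l X2 X1 :=
  ⟨h.ha', h.ha, h.hb', h.hb, h.h2, h.h1, h.pm, h.pl, h.haa.symm, h.hbb.symm, h.t.symm, h.hA2, h.hA1,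
    h.hB2, h.hB1⟩

theorem Ty2.rev (h : Ty2 G T z1 zn Z a b a' b' l m X1 X2) : Ty2 G T zn z1 Z b a b' a' l m X1 X2 :=
  ⟨h.hb, h.hb', h.ha, h.ha', h.h1.symm, h.h2.symm, h.pl, h.pm, h.hbb, h.haa, h.t.swap, h.hB1, h.hB2,
    h.hA1, h.hA2⟩

theorem FQ.swap {zq : V} {r : ℕ} {Q X : Set V} (h : FQ G z1 zn zq a a' n r Z Q X) :
    FQ G z1 zn zq a' a n r Z Q X :=
  ⟨h.hQ, h.sub, by obtain ⟨v, h1, h2, h3, h4⟩ := h.tch; exact ⟨v, h1, h3, h2, h4⟩,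
    fun u h1 v h2 h5 => by have := h.uni u h1 v h2 h5; tauto, h.dis, h.full, h.az', h.az, h.nota', h.nota⟩

/-- a path from `a'` along `Q` and then along a path `S` to `B` -/
theorem Setting.viaQ (h : Setting G T z1 zn n Z) {zq s : V} {r e : ℕ} {Q X S : Set V}
    (hb : b ∈ SA G T zn Z) (ha' : a' ∈ SA G T z1 Z)
    (f : FQ G z1 zn zq a a' n r Z Q X) (hS : IPL G s b e S) (hSX : S ⊆ X) (hzs : G.Adj zq s)
    (huni : ∀ v ∈ S, G.Adj zq v → v = s) (haS : ∀ v ∈ S, v ∉ SA G T z1 Z)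
    (haS' : ∀ v ∈ S, ¬ G.Adj a' v) (hanS : a ∉ S) (hB : ∀ v ∈ S, v ∈ SA G T zn Z → v = b) :
    (r + e) % 2 = 0 := by
  have hna : a' ∉ S := fun h1 => haS a' h1 ha'
  have hSX' : ∀ v ∈ S, v ∈ X := fun v hv => hSX hv
  have hab : ∀ v, v ∈ SA G T zn Z → v ≠ a' := fun v hv => (h.ab_ne ha' hv).symm
  have f1 := f.uni
  have f2 := f.dis
  have f3 := f.az'
  have f4 := f.nota'
  have f5 := f.sub
  have hZC := h.hZC
  have hz := f.hQ.left
  have q : IPL G a' b (r + e + 1 + 1) (insert a' (Q ∪ S)) := by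
    refine (f.hQ.append hS hzs ?_ ?_).cons ((f.az' z1 f.hQ.left).2 rfl) ?_ ?_
    · grind
    · grind
    · grind
    · grind
  have hq : ∀ v ∈ Q, ∀ w, v ∉ SA G T w Z := fun v hv w hs => (h.hZC v (f.sub hv)).1 hs.1
  have := h.claim1 ha' hb q (by grind) (by grind)
  omega

set_option maxHeartbeats 2000000 in
theorem Ty2.only (h : Setting G T z1 zn n Z) (y : Ty2 G T z1 zn Z a b a' b' l m X1 X2)
    {zq : V} {r : ℕ} {Q : Set V} (f : FQ G z1 zn zq a a' n r Z Q (X1 ∪ X2))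
    (h1 : ∃ v ∈ X1, v ≠ a ∧ G.Adj zq v) :
    (∃ v e S, IPL G b v e S ∧ S ⊆ X1 ∧ a ∉ S ∧ G.Adj zq v ∧ (∀ w ∈ S, G.Adj zq w → w = v) ∧
    (r + e) % 2 = 0) ∧ ∃ v ∈ X2, v ≠ a' ∧ G.Adj zq v := by
  have hab := h.ab_ne y.ha y.hb
  obtain ⟨w0, S0, k1, k2, k3, k4, k5⟩ := y.h1.tail hab
  obtain ⟨v, e, j, S1, S2, hej, hv, m1, m2, m3, m4, m5, m6⟩ := k1.symm.first (fun v => G.Adj zq v)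
    (by obtain ⟨v, h1, h2, h3⟩ := h1; rw [k2] at h1; exact ⟨v, by grind, h3⟩)
  have hsub : S1 ⊆ X1 := by rw [k2, m3]; grind
  have hna : a ∉ S1 := by grind
  obtain ⟨t1, t2⟩ := y.t
  have e1 : ∀ v ∈ S1, v ∉ X2 := fun v hv => t1 v (hsub hv)
  have hA1 := y.hA1
  have hB1 := y.hB1
  have hA2 := y.hA2
  have haa := y.haa
  have ha' := y.ha'
  have hna' : a' ∉ S1 := fun h1 => e1 _ h1 y.h2.left
  have par := h.viaQ y.hb y.ha' f m1.symm (fun v hv => Or.inl (hsub hv)) hv m4 (by grind)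
    (by have := y.h2.left; have := h.ab_ne y.ha' y.hb'; grind [G.adj_comm]) hna (by grind)
  refine ⟨⟨v, e, S1, m1, hsub, hna, hv, m4, par⟩, ?_⟩
  by_contra hcon
  push Not at hcon
  -- hole
  have q : IPL G a' v (m + e + 1) (X2 ∪ S1) := by
    refine y.h2.append m1 y.hbb.symm ?_ ?_
    · grind
    · grind [G.adj_comm]
  have f1 : ∀ u ∈ Q, ∀ v ∈ X1, G.Adj u v → v = a ∨ v = a' ∨ u = zq :=
    fun u hu v hv => f.uni u hu v (Or.inl hv)
  have f1' : ∀ u ∈ Q, ∀ v ∈ X2, G.Adj u v → v = a ∨ v = a' ∨ u = zq :=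
    fun u hu v hv => f.uni u hu v (Or.inr hv)
  have f2 : ∀ u ∈ Q, u ∉ X1 ∧ u ∉ X2 := fun u hu => not_or.1 (f.dis u hu)
  have f3 := f.az'
  have f4 := f.nota'
  have hz := f.hQ.left
  have hzq := f.hQ.right
  have hsub' : ∀ v ∈ S1, v ∈ X1 := fun v hv => hsub hv
  have hcon' : ∀ v ∈ X2, G.Adj zq v → v = a' := by grind
  have hX2a : ∀ v ∈ X2, v ≠ a := by
    rintro v hv rfl; exact t1 _ y.h1.left hv
  have hQ := f.hQ
  have haz := ((f.az' z1 f.hQ.left).2 rfl).symm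
  clear f k2 m3 hsub hcon h1 hB1 hA1 hA2
  have := h.hA.even hQ q haz hv ⟨by grind, by grind [G.adj_comm]⟩ (by
    have : m ≠ 0 := fun e => h.ab_ne y.ha' y.hb' (y.h2.zero_iff.1 e)
    omega)
  rw [Nat.even_iff] at this
  have := y.pm
  omega

set_option maxHeartbeats 2000000 in
theorem Ty2.far (h : Setting G T z1 zn n Z) (y : Ty2 G T z1 zn Z a b a' b' l m X1 X2) :
    (∀ u ∈ Z, u ∉ X1 ∪ X2) ∧ ∀ u ∈ Z, ∀ v ∈ X1 ∪ X2, G.Adj u v → v = a ∨ v = a' ∨ u = zn := by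
  have hab := h.ab_ne y.ha y.hb
  have hab' := h.ab_ne y.ha' y.hb'
  have hba := h.ab_ne y.ha' y.hb
  have hba' := h.ab_ne y.ha y.hb'
  obtain ⟨t1, t2⟩ := y.t
  have l1 := y.h1.left
  have l2 := y.h2.left
  have r1 := y.h1.right
  have r2 := y.h2.right
  obtain ⟨zq, r, Q, f⟩ := h.getQ (X := X1 ∪ X2) y.ha y.ha' ⟨zn, h.hZ.right, b, Or.inl r1, hab.symm,
    hba.symm, ((y.hb.2 zn h.hZ.right).2 rfl).symm⟩ (by grind [G.adj_comm])
  have f' : FQ G z1 zn zq a' a n r Z Q (X2 ∪ X1) := by rw [Set.union_comm]; exact f.swap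
  have both : (∃ v ∈ X1, v ≠ a ∧ G.Adj zq v) ∧ (∃ v ∈ X2, v ≠ a' ∧ G.Adj zq v) := by
    obtain ⟨v, h1 | h1, h2, h3, h4⟩ := f.tch
    · have g1 : ∃ v ∈ X1, v ≠ a ∧ G.Adj zq v := ⟨v, h1, h2, h4⟩
      exact ⟨g1, (Ty2.only h y f g1).2⟩
    · have g1 : ∃ v ∈ X2, v ≠ a' ∧ G.Adj zq v := ⟨v, h1, h3, h4⟩
      exact ⟨(Ty2.only h y.swap f' g1).2, g1⟩
  obtain ⟨⟨v, e, S, m1, m2, m3, m4, m5, m6⟩, -⟩ := Ty2.only h y f both.1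
  obtain ⟨⟨v', e', S', m1', m2', m3', m4', m5', m6'⟩, -⟩ := Ty2.only h y.swap f' both.2
  have f2 := f.dis
  have e0 : e + e' = 0 := by
    by_contra hcon
    have q : IPL G v v' (e + e' + 1) (S ∪ S') := by
      refine m1.symm.append m1' y.hbb ?_ ?_
      · grind
      · grind
    have hzq := f.hQ.right
    have := h.hA.even (IPL.single G zq) q m4 m4' ⟨by grind, by grind⟩ (by omega)
    rw [Nat.even_iff] at this
    omega
  have ev : b = v := m1.zero_iff.1 (by omega)
  subst ev
  have ezq : zq = zn := (y.hb.2 zq (f.sub f.hQ.right)).1 m4.symm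
  obtain ⟨-, rfl⟩ := f.full ezq
  exact ⟨f.dis, fun u hu v hv h3 => ezq ▸ f.uni u hu v hv h3⟩

set_option maxHeartbeats 2000000 in
theorem Ty2.false (h : Setting G T z1 zn n Z) (y : Ty2 G T z1 zn Z a b a' b' l m X1 X2) : False := by
  obtain ⟨d, f1⟩ := Ty2.far h y
  obtain ⟨-, f2⟩ := Ty2.far h.symm y.rev
  have hz := h.zne
  have d1 : ∀ u ∈ Z, u ∉ X1 ∧ u ∉ X2 := fun u hu => not_or.1 (d u hu)
  have f11 := fun u hu v hv => f1 u hu v (Or.inl hv)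
  have f12 := fun u hu v hv => f1 u hu v (Or.inr hv)
  have f21 := fun u hu v hv => f2 u hu v (Or.inl hv)
  have f22 := fun u hu v hv => f2 u hu v (Or.inr hv)
  clear d f1 f2
  have ha := y.ha.2
  have ha' := y.ha'.2
  have hb := y.hb.2
  have hb' := y.hb'.2
  obtain ⟨t1, t2⟩ := y.t
  have l1 := y.h1.left
  have l2 := y.h2.left
  have r1 := y.h1.right
  have r2 := y.h2.right
  exact h.hA.spr (x1 := z1) (y1 := zn) h.hZ.conn y.h1.conn y.h2.conn h.hZ.left y.h1.left y.h2.left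
    h.hZ.right y.h1.right y.h2.right ((y.ha.2 _ h.hZ.left).2 rfl).symm y.haa
    ((y.ha'.2 _ h.hZ.left).2 rfl).symm
    ((y.hb.2 _ h.hZ.right).2 rfl).symm y.hbb ((y.hb'.2 _ h.hZ.right).2 rfl).symm h.zne
    (h.ab_ne y.ha y.hb) (h.ab_ne y.ha' y.hb') ⟨by grind, by grind [G.adj_comm]⟩
    ⟨by grind, by grind [G.adj_comm]⟩ y.t

end Artemis

namespace Artemis
variable {V : Type*} {G : SimpleGraph V}
variable {T : Set V} {z1 zn : V} {n : ℕ} {Z : Set V}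

/-- configuration of type 1 -/
structure Ty1 (G : SimpleGraph V) (T : Set V) (z1 zn : V) (Z : Set V) (a a' b x y w : V) (j i k : ℕ)
    (X1 X2 X3 : Set V) : Prop where
  ha : a ∈ SA G T z1 Z
  ha' : a' ∈ SA G T z1 Z
  hb : b ∈ SA G T zn Z
  h1 : IPL G a x j X1
  h2 : IPL G a' y i X2
  h3 : IPL G w b k X3
  hax : a ≠ x
  hay : a' ≠ y
  hxy : G.Adj x y
  hxw : G.Adj x w
  hyw : G.Adj y w
  haa : G.Adj a a'
  t12 : TwoE G a x a' y X1 X2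
  t13 : OneE G x w X1 X3
  t23 : OneE G y w X2 X3
  p1 : (j + 1 + k) % 2 = 0
  p2 : (i + 1 + k) % 2 = 0
  hB1 : ∀ v ∈ X1, v ∉ SA G T zn Z
  hB2 : ∀ v ∈ X2, v ∉ SA G T zn Z
  hB3 : ∀ v ∈ X3, v ∈ SA G T zn Z → v = b
  hA1 : ∀ v ∈ X1, v ∈ SA G T z1 Z → v = a
  hA2 : ∀ v ∈ X2, v ∈ SA G T z1 Z → v = a'
  hA3 : ∀ v ∈ X3, v ∉ SA G T z1 Z
  hT1 : ∀ v ∈ X1, v ∉ T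
  hT2 : ∀ v ∈ X2, v ∉ T
  hT3 : ∀ v ∈ X3, v ∉ T
  u1 : ∀ v ∈ X1, v ∈ Cs G T → v = a ∨ ∀ u ∈ Z, ¬ G.Adj v u
  u2 : ∀ v ∈ X2, v ∈ Cs G T → v = a' ∨ ∀ u ∈ Z, ¬ G.Adj v u
  u3 : ∀ v ∈ X3, v ∈ Cs G T → v = b ∨ ∀ u ∈ Z, ¬ G.Adj v u

variable {a a' b x y w : V} {j i k : ℕ} {X1 X2 X3 : Set V}

theorem Ty1.swap (h : Ty1 G T z1 zn Z a a' b x y w j i k X1 X2 X3) :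
    Ty1 G T z1 zn Z a' a b y x w i j k X2 X1 X3 :=
  ⟨h.ha', h.ha, h.hb, h.h2, h.h1, h.h3, h.hay, h.hax, h.hxy.symm, h.hyw, h.hxw, h.haa.symm, h.t12.symm,
    h.t23, h.t13, h.p2, h.p1, h.hB2, h.hB1, h.hB3, h.hA2, h.hA1, h.hA3, h.hT2, h.hT1, h.hT3, h.u2, h.u1,
    h.u3⟩

/-- at least two of three adjacencies -/
def Two3 (G : SimpleGraph V) (t x y w : V) : Prop :=
  (G.Adj t x ∧ G.Adj t y) ∨ (G.Adj t x ∧ G.Adj t w) ∨ (G.Adj t y ∧ G.Adj t w)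

theorem Two3.swap {t : V} (h : Two3 G t x y w) : Two3 G t y x w := by
  unfold Two3 at *; tauto

theorem Ty1.tail (h : Ty1 G T z1 zn Z a a' b x y w j i k X1 X2 X3) :
    ∃ x1 F, IPL G x1 x (j - 1) F ∧ x ∈ F ∧ (∀ v ∈ F, v ∈ X1) ∧ (∀ v ∈ X1, v = a ∨ v ∈ F) ∧ a ∉ F := by
  obtain ⟨w0, S0, k1, k2, k3, k4, k5⟩ := h.h1.tail h.hax
  subst k2
  refine ⟨w0, S0, k1, k1.right, ?_, ?_, k3⟩ <;> grind

theorem Ty1.spT (hs : Setting G T z1 zn n Z) (h : Ty1 G T z1 zn Z a a' b x y w j i k X1 X2 X3)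
    {t : V} (h1 : t ∉ X1) (h2 : t ∉ X2) (h3 : t ∉ X3) (n1 : ∃ v ∈ X1, v ≠ a ∧ G.Adj t v)
    (n2 : ∃ v ∈ X2, G.Adj t v) (n3 : ∃ v ∈ X3, G.Adj t v) : Two3 G t x y w := by
  obtain ⟨x1, F, g1, g2, g3, g4, g5⟩ := h.tail
  obtain ⟨t1, t2⟩ := h.t12
  refine hs.hA.sp g1.conn h.h2.conn h.h3.conn g2 h.h2.right h.h3.left h.hxy h.hyw h.hxw ⟨?_, ?_⟩
    (h.t13.mono g3 subset_rfl) h.t23 ?_ h2 h3 ?_ n2 n3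
  · grind
  · grind
  · grind
  · grind

set_option maxHeartbeats 2000000 in
theorem Ty1.tT (hs : Setting G T z1 zn n Z) (h : Ty1 G T z1 zn Z a a' b x y w j i k X1 X2 X3)
    {t : V} (ht : t ∈ T) : Two3 G t x y w := by
  have e1 : t ∉ X1 := fun hv => h.hT1 t hv ht
  have e2 : t ∉ X2 := fun hv => h.hT2 t hv ht
  have e3 : t ∉ X3 := fun hv => h.hT3 t hv ht
  have ta : G.Adj t a := (h.ha.1 t ht).symm
  have ta' : G.Adj t a' := (h.ha'.1 t ht).symm
  have tb : G.Adj t b := (h.hb.1 t ht).symm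
  have l1 := h.h1.left
  have l2 := h.h2.left
  have l3 := h.h3.left
  have r3 := h.h3.right
  by_cases c1 : ∃ v ∈ X1, v ≠ a ∧ G.Adj t v
  · exact h.spT hs e1 e2 e3 c1 ⟨a', l2, ta'⟩ ⟨b, r3, tb⟩
  by_cases c2 : ∃ v ∈ X2, v ≠ a' ∧ G.Adj t v
  · exact (h.swap.spT hs e2 e1 e3 c2 ⟨a, l1, ta⟩ ⟨b, r3, tb⟩).swap
  exfalso
  push Not at c1 c2
  have c1' : ∀ v ∈ X1, G.Adj t v → v = a := by grind
  have c2' : ∀ v ∈ X2, G.Adj t v → v = a' := by grind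
  obtain ⟨s1, s2⟩ := h.t13
  obtain ⟨s3, s4⟩ := h.t23
  exact hs.hA.spr (h.h3.conn.ins ⟨b, r3, tb⟩) h.h1.conn h.h2.conn (Or.inl rfl) l1 l2 (Or.inr l3)
    h.h1.right h.h2.right ta h.haa ta' h.hxw.symm h.hxy h.hyw.symm (by grind) h.hax h.hay
    ⟨by grind, by grind [G.adj_comm]⟩ ⟨by grind, by grind [G.adj_comm]⟩ h.t12

theorem Ty1.spQ (hs : Setting G T z1 zn n Z) (h : Ty1 G T z1 zn Z a a' b x y w j i k X1 X2 X3)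
    {zq : V} {r : ℕ} {Q : Set V} (f : FQ G z1 zn zq a a' n r Z Q (X1 ∪ X2 ∪ X3))
    (n1 : ∃ v ∈ X1, v ≠ a ∧ G.Adj zq v) (n3 : ∃ v ∈ X3, G.Adj zq v) : Two3 G zq x y w := by
  have f1 : ∀ u ∈ Q, ∀ v ∈ X1, G.Adj u v → v = a ∨ v = a' ∨ u = zq :=
    fun u hu v hv => f.uni u hu v (Or.inl (Or.inl hv))
  have f3 : ∀ u ∈ Q, ∀ v ∈ X3, G.Adj u v → v = a ∨ v = a' ∨ u = zq :=
    fun u hu v hv => f.uni u hu v (Or.inr hv)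
  have f2 : ∀ u ∈ Q, u ∉ X1 ∧ u ∉ X2 ∧ u ∉ X3 := fun u hu => by have := f.dis u hu; simp at this; tauto
  have hq := f2 _ f.hQ.right
  obtain ⟨x1, F, g1, g2, g3, g4, g5⟩ := h.tail
  obtain ⟨t1, t2⟩ := h.t12
  have hz : G.Adj a' z1 := (f.az' z1 f.hQ.left).2 rfl
  by_cases e : zq = z1
  · exact h.spT hs hq.1 hq.2.1 hq.2.2 n1 ⟨a', h.h2.left, e ▸ hz.symm⟩ n3
  obtain ⟨w0, S0, k1, k2, k3, k4, k5⟩ := f.hQ.symm.tail e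
  have k6 : ∀ v ∈ S0, v ∈ Q := by rw [k2]; grind
  have c : Conn G (S0 ∪ X2) := k1.conn.union h.h2.conn ⟨z1, k1.right, a', h.h2.left, Or.inr hz.symm⟩
  obtain ⟨s1, s2⟩ := h.t13
  obtain ⟨s3, s4⟩ := h.t23
  have l1 := h.h1.left
  have l2 := h.h2.left
  refine hs.hA.sp g1.conn c h.h3.conn g2 (Or.inr h.h2.right) h.h3.left h.hxy h.hyw h.hxw ⟨?_, ?_⟩
    (h.t13.mono g3 subset_rfl) ⟨?_, ?_⟩ ?_ ?_ hq.2.2 ?_ ⟨w0, Or.inl k1.left, k4⟩ n3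
  · grind
  · clear k2; grind [G.adj_comm]
  · grind
  · clear k2; grind [G.adj_comm]
  · grind
  · grind
  · grind

set_option maxHeartbeats 2000000 in
theorem Ty1.one (hs : Setting G T z1 zn n Z) (h : Ty1 G T z1 zn Z a a' b x y w j i k X1 X2 X3)
    {zq : V} {r : ℕ} {Q : Set V} (f : FQ G z1 zn zq a a' n r Z Q (X1 ∪ X2 ∪ X3))
    (n1 : ∃ v ∈ X1, v ≠ a ∧ G.Adj zq v) (n3 : ∀ v ∈ X3, ¬ G.Adj zq v) :
    (∃ v e S, IPL G x v e S ∧ (∀ u ∈ S, u ∈ X1) ∧ a ∉ S ∧ G.Adj zq v ∧ (∀ w ∈ S, G.Adj zq w → w = v) ∧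
    (r + e + k + 1) % 2 = 0) ∧ ∃ v ∈ X2, v ≠ a' ∧ G.Adj zq v := by
  obtain ⟨x1, F, g1, g2, g3, g4, g5⟩ := h.tail
  obtain ⟨v, e, j, S1, S2, hej, hv, m1, m2, m3, m4, m5, m6⟩ := g1.symm.first (fun v => G.Adj zq v)
    (by obtain ⟨v, h1, h2, h3⟩ := n1; exact ⟨v, by grind, h3⟩)
  have hsub : ∀ v ∈ S1, v ∈ X1 := by rw [m3] at g3; grind
  have hna : a ∉ S1 := by grind
  obtain ⟨t1, t2⟩ := h.t12
  obtain ⟨s1, s2⟩ := h.t13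
  obtain ⟨s3, s4⟩ := h.t23
  have hA1 := h.hA1
  have hA2 := h.hA2
  have hA3 := h.hA3
  have hB1 := h.hB1
  have hB3 := h.hB3
  have l1 := h.h1.left
  have l2 := h.h2.left
  have hay := h.hay
  clear m3 m5 m6
  have q1 : IPL G v b (e + k + 1) (S1 ∪ X3) := by
    refine m1.symm.append h.h3 h.hxw ?_ ?_
    · grind
    · grind
  have par := hs.viaQ h.hb h.ha' f q1 (by
      rintro v (h | h)
      · exact Or.inl (Or.inl (hsub v h))
      · exact Or.inr h) hv (by grind) (by grind) (by grind [G.adj_comm]) (by grind) (by grind)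
  refine ⟨⟨v, e, S1, m1, hsub, hna, hv, m4, by omega⟩, ?_⟩
  by_contra hcon
  push Not at hcon
  have q : IPL G a' v (i + e + 1) (X2 ∪ S1) := by
    refine h.h2.append m1 h.hxy.symm ?_ ?_
    · grind
    · grind [G.adj_comm]
  have f1 : ∀ u ∈ Q, ∀ v ∈ X1, G.Adj u v → v = a ∨ v = a' ∨ u = zq :=
    fun u hu v hv => f.uni u hu v (Or.inl (Or.inl hv))
  have f1' : ∀ u ∈ Q, ∀ v ∈ X2, G.Adj u v → v = a ∨ v = a' ∨ u = zq :=
    fun u hu v hv => f.uni u hu v (Or.inl (Or.inr hv))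
  have f2 : ∀ u ∈ Q, u ∉ X1 ∧ u ∉ X2 ∧ u ∉ X3 := fun u hu => by have := f.dis u hu; simp at this; tauto
  have f3 := f.az'
  have hQ := f.hQ
  have hz := hQ.left
  have hcon' : ∀ v ∈ X2, G.Adj zq v → v = a' := by grind
  have hX2a : ∀ v ∈ X2, v ≠ a := by
    rintro v hv rfl; exact t1 _ l1 hv
  have hX1a : ∀ v ∈ X1, v ≠ a' := by
    rintro v hv rfl; exact t1 _ hv l2
  have haz := ((f.az' z1 f.hQ.left).2 rfl).symm
  clear f hcon hB1 hA1 hA2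
  have p1 := h.p1
  have p2 := h.p2
  have hi : i ≠ 0 := fun e => h.hay (h.h2.zero_iff.1 e)
  clear h
  have := hs.hA.even hQ q haz hv ⟨by grind, by grind [G.adj_comm]⟩ (by omega)
  rw [Nat.even_iff] at this
  omega

end Artemis

namespace Artemis
variable {V : Type*} {G : SimpleGraph V}
variable {T : Set V} {z1 zn : V} {n : ℕ} {Z : Set V}
variable {a a' b x y w : V} {j i k : ℕ} {X1 X2 X3 : Set V}

set_option maxHeartbeats 2000000 in
theorem Ty1.two (hs : Setting G T z1 zn n Z) (h : Ty1 G T z1 zn Z a a' b x y w j i k X1 X2 X3)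
    {zq : V} {r : ℕ} {Q : Set V} (f : FQ G z1 zn zq a a' n r Z Q (X1 ∪ X2 ∪ X3)) :
    Two3 G zq x y w := by
  have f' : FQ G z1 zn zq a' a n r Z Q (X2 ∪ X1 ∪ X3) := by rw [Set.union_comm X2 X1]; exact f.swap
  obtain ⟨t1, t2⟩ := h.t12
  obtain ⟨s1, s2⟩ := h.t13
  obtain ⟨s3, s4⟩ := h.t23
  have l1 := h.h1.left
  have l2 := h.h2.left
  have r1 := h.h1.right
  have r2 := h.h2.right
  have f2 : ∀ u ∈ Q, u ∉ X1 ∧ u ∉ X2 ∧ u ∉ X3 := fun u hu => by have := f.dis u hu; simp at this; tauto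
  by_cases c3 : ∃ v ∈ X3, G.Adj zq v
  · by_cases c1 : ∃ v ∈ X1, v ≠ a ∧ G.Adj zq v
    · exact h.spQ hs f c1 c3
    by_cases c2 : ∃ v ∈ X2, v ≠ a' ∧ G.Adj zq v
    · exact (h.swap.spQ hs f' c2 c3).swap
    exfalso
    push Not at c1 c2
    have c1' : ∀ v ∈ X1, G.Adj zq v → v = a := by grind
    have c2' : ∀ v ∈ X2, G.Adj zq v → v = a' := by grind
    have f1 : ∀ u ∈ Q, ∀ v ∈ X1, G.Adj u v → v = a ∨ v = a' ∨ u = zq :=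
      fun u hu v hv => f.uni u hu v (Or.inl (Or.inl hv))
    have f1' : ∀ u ∈ Q, ∀ v ∈ X2, G.Adj u v → v = a ∨ v = a' ∨ u = zq :=
      fun u hu v hv => f.uni u hu v (Or.inl (Or.inr hv))
    have az := f.az
    have az' := f.az'
    have hX2a : ∀ v ∈ X2, v ≠ a := by
      rintro v hv rfl; exact t1 _ l1 hv
    have hX1a : ∀ v ∈ X1, v ≠ a' := by
      rintro v hv rfl; exact t1 _ hv l2
    have l3 := h.h3.left
    obtain ⟨v3, hv3, e3⟩ := c3
    have hz := f.hQ.left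
    refine hs.hA.spr (x1 := z1) (y1 := w) (f.hQ.conn.union h.h3.conn ⟨zq, f.hQ.right, v3, hv3, Or.inr e3⟩)
      h.h1.conn h.h2.conn (Or.inl hz) l1 l2 (Or.inr l3)
      h.h1.right h.h2.right ((az _ hz).2 rfl).symm h.haa ((az' _ hz).2 rfl).symm
      h.hxw.symm h.hxy h.hyw.symm (by grind) h.hax h.hay
      ⟨?_, ?_⟩ ⟨?_, ?_⟩ h.t12
    · clear f f'; grind
    · clear f f'; grind [G.adj_comm]
    · clear f f'; grind
    · clear f f'; grind [G.adj_comm]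
  have c3' : ∀ v ∈ X3, ¬ G.Adj zq v := by push Not at c3; exact c3
  have both : (∃ v ∈ X1, v ≠ a ∧ G.Adj zq v) ∧ (∃ v ∈ X2, v ≠ a' ∧ G.Adj zq v) := by
    obtain ⟨v, (h1 | h1) | h1, h2, h3, h4⟩ := f.tch
    · have g1 : ∃ v ∈ X1, v ≠ a ∧ G.Adj zq v := ⟨v, h1, h2, h4⟩
      exact ⟨g1, (h.one hs f g1 c3').2⟩
    · have g1 : ∃ v ∈ X2, v ≠ a' ∧ G.Adj zq v := ⟨v, h1, h3, h4⟩
      exact ⟨(h.swap.one hs f' g1 c3').2, g1⟩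
    · exact absurd h4 (c3' v h1)
  obtain ⟨⟨v, e, S, m1, m2, m3, m4, m5, m6⟩, -⟩ := h.one hs f both.1 c3'
  obtain ⟨⟨v', e', S', m1', m2', m3', m4', m5', m6'⟩, -⟩ := h.swap.one hs f' both.2 c3'
  have e0 : e + e' = 0 := by
    by_contra hcon
    have q : IPL G v v' (e + e' + 1) (S ∪ S') := by
      refine m1.symm.append m1' h.hxy ?_ ?_
      · grind
      · grind
    have hzq := f.hQ.right
    have := hs.hA.even (IPL.single G zq) q m4 m4' ⟨by grind, by grind⟩ (by omega)
    rw [Nat.even_iff] at this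
    omega
  have ev : x = v := m1.zero_iff.1 (by omega)
  have ev' : y = v' := m1'.zero_iff.1 (by omega)
  subst ev ev'
  exact Or.inl ⟨m4, m4'⟩

/-- `Q` together with an edge `a x` -/
theorem Ty1.hole1 (hs : Setting G T z1 zn n Z) (h : Ty1 G T z1 zn Z a a' b x y w j i k X1 X2 X3)
    {zq : V} {r : ℕ} {Q : Set V} (f : FQ G z1 zn zq a a' n r Z Q (X1 ∪ X2 ∪ X3)) (hr : r ≠ 0)
    (hj : j = 1) (hq : G.Adj zq x) : r % 2 = 1 := by
  subst hj
  have e := h.h1.one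
  have h1 := h.h1
  rw [e] at h1
  have hz := f.hQ.left
  have f1 : ∀ u ∈ Q, G.Adj u x → x = a ∨ x = a' ∨ u = zq :=
    fun u hu => f.uni u hu x (Or.inl (Or.inl h.h1.right))
  have f2 : x ∉ Q := fun hu => f.dis x hu (Or.inl (Or.inl h.h1.right))
  have hxa' : x ≠ a' := by rintro e; exact h.t12.1 _ h.h1.right (e ▸ h.h2.left)
  have hax := h.hax
  have f3 := f.az
  have f4 := f.nota
  have := hs.hA.even f.hQ h1 ((f.az _ hz).2 rfl).symm hq ⟨by grind, by grind [G.adj_comm]⟩ (by omega)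
  rw [Nat.even_iff] at this
  omega

theorem Ty1.c (h : Ty1 G T z1 zn Z a a' b x y w j i k X1 X2 X3) {u : V} (hu : u ∈ Z)
    (hux : G.Adj u x) : x ∉ Cs G T := by
  intro hc
  obtain e | e := h.u1 x h.h1.right hc
  · exact h.hax e.symm
  · exact e u hu hux.symm

theorem Ty1.nax (h : Ty1 G T z1 zn Z a a' b x y w j i k X1 X2 X3) : ¬ G.Adj a y := by
  intro e
  obtain e | e := h.t12.2 a h.h1.left y h.h2.right e
  · exact h.hay e.2.symm
  · exact h.hax e.1

theorem Ty1.caseI (hs : Setting G T z1 zn n Z) (h : Ty1 G T z1 zn Z a a' b x y w j i k X1 X2 X3)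
    {u : V} (hu : u ∈ Z) (hux : G.Adj u x) (huy : G.Adj u y) : j = 1 ∧ w = b := by
  have cx := h.c hu hux
  have cy := h.swap.c hu huy
  have hj : j ≠ 0 := fun e => h.hax (h.h1.zero_iff.1 e)
  have cov : ∀ t ∈ T, G.Adj x t ∨ G.Adj y t := by
    intro t ht
    obtain e | e | e := h.tT hs ht
    · exact Or.inl e.1.symm
    · exact Or.inl e.1.symm
    · exact Or.inr e.1.symm
  have l := fun d => hs.hA.lab (d := d) hs.anti h.hxy (h.hT1 _ h.h1.right) (h.hT2 _ h.h2.right) cx cy cov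
  by_contra hcon
  by_cases hw : w = b
  · exact l a h.ha.1 (fun e => hcon ⟨h.h1.one_iff.2 e, hw⟩) h.nax
  · exact l b h.hb.1 (fun e => hw (h.t13.2 _ h.h1.right _ h.h3.right e.symm).2.symm)
      (fun e => hw (h.t23.2 _ h.h2.right _ h.h3.right e.symm).2.symm)

set_option maxHeartbeats 2000000 in
theorem Ty1.caseII (hs : Setting G T z1 zn n Z) (h : Ty1 G T z1 zn Z a a' b x y w j i k X1 X2 X3)
    {zq : V} {r : ℕ} {Q : Set V} (f : FQ G z1 zn zq a a' n r Z Q (X1 ∪ X2 ∪ X3))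
    (hux : G.Adj zq x) (huw : G.Adj zq w) : False := by
  have hu : zq ∈ Z := f.sub f.hQ.right
  have cx := h.c hu hux
  have cov : ∀ t ∈ T, (G.Adj x t ∨ G.Adj w t) ∧ (G.Adj x t ∨ G.Adj y t) := by
    intro t ht
    obtain e | e | e := h.tT hs ht
    · exact ⟨Or.inl e.1.symm, Or.inl e.1.symm⟩
    · exact ⟨Or.inl e.1.symm, Or.inl e.1.symm⟩
    · exact ⟨Or.inr e.2.symm, Or.inr e.1.symm⟩
  by_cases hw : w = b
  swap
  · have cw : w ∉ Cs G T := by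
      intro hc
      obtain e | e := h.u3 w h.h3.left hc
      · exact hw e
      · exact e zq hu huw.symm
    exact hs.hA.lab (d := a') hs.anti h.hxw (h.hT1 _ h.h1.right) (h.hT3 _ h.h3.left) cx cw
      (fun t ht => (cov t ht).1) h.ha'.1 h.swap.nax
      (fun e => h.hay (h.t23.2 _ h.h2.left _ h.h3.left e).1)
  subst hw
  have e : zq = zn := (h.hb.2 _ hu).1 huw.symm
  obtain ⟨rfl, rfl⟩ := f.full e
  have hn := hs.nev
  have hn2 := hs.n2
  by_cases hj : j = 1
  · have := h.hole1 hs f (by omega) hj hux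
    omega
  have hnax : ¬ G.Adj a x := fun e => hj (h.h1.one_iff.2 e)
  by_cases cy : y ∈ Cs G T
  · have hy : ∀ u ∈ Q, ¬ G.Adj y u := by
      obtain e | e := h.u2 y h.h2.right cy
      · exact absurd e.symm h.hay
      · exact e
    have hz := f.hQ.left
    have f3 := f.az
    have f4 := f.nota
    have f1 : ∀ u ∈ Q, G.Adj u x → x = a ∨ x = a' ∨ u = zq :=
      fun u hu => f.uni u hu x (Or.inl (Or.inl h.h1.right))
    have f2 : x ∉ Q := fun hu => f.dis x hu (Or.inl (Or.inl h.h1.right))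
    have f2' : y ∉ Q := fun hu => f.dis y hu (Or.inl (Or.inr h.h2.right))
    have hxa' : x ≠ a' := by rintro e; exact h.t12.1 _ h.h1.right (e ▸ h.h2.left)
    have hya' : y ≠ a := by rintro e; exact h.t12.1 _ h.h1.left (e ▸ h.h2.right)
    have hax := h.hax
    have nax := h.nax
    have hxy := h.hxy
    have q := ((f.hQ.cons ((f.az _ hz).2 rfl) f.nota (fun v hv hh => (f.az v hv).1 hh)).snoc hux
      (by grind) (by grind [G.adj_comm])).snoc h.hxy (by grind [G.ne_of_adj]) (by grind [G.adj_comm])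
    have := hs.outer q h.ha.1 cy (by omega) (by
      rintro v (rfl | rfl | rfl | hv) hc
      · exact Or.inr rfl
      · exact absurd hc cx
      · exact Or.inl rfl
      · exact absurd hc (hs.hZC v hv).1)
    omega
  · exact hs.hA.lab (d := a) hs.anti h.hxy (h.hT1 _ h.h1.right) (h.hT2 _ h.h2.right) cx cy
      (fun t ht => (cov t ht).2) h.ha.1 hnax h.nax

set_option maxHeartbeats 2000000 in
theorem Ty1.false (hs : Setting G T z1 zn n Z) (h : Ty1 G T z1 zn Z a a' b x y w j i k X1 X2 X3) :
    False := by
  obtain ⟨t1, t2⟩ := h.t12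
  obtain ⟨s1, s2⟩ := h.t13
  obtain ⟨s3, s4⟩ := h.t23
  have l1 := h.h1.left
  have l2 := h.h2.left
  have r1 := h.h1.right
  have r2 := h.h2.right
  have r3 := h.h3.right
  have hax := h.hax
  have hay := h.hay
  have nax := h.nax
  have nax' := h.swap.nax
  obtain ⟨zq, r, Q, f⟩ := hs.getQ (X := X1 ∪ X2 ∪ X3) h.ha h.ha' ⟨zn, hs.hZ.right, b, Or.inr h.h3.right,
    (hs.ab_ne h.ha h.hb).symm, (hs.ab_ne h.ha' h.hb).symm, ((h.hb.2 zn hs.hZ.right).2 rfl).symm⟩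
    (by grind [G.adj_comm])
  have f' : FQ G z1 zn zq a' a n r Z Q (X2 ∪ X1 ∪ X3) := by rw [Set.union_comm X2 X1]; exact f.swap
  have hu : zq ∈ Z := f.sub f.hQ.right
  obtain ⟨e1, e2⟩ | ⟨e1, e2⟩ | ⟨e1, e2⟩ := h.two hs f
  rotate_left
  · exact h.caseII hs f e1 e2
  · exact h.swap.caseII hs f' e1 e2
  obtain ⟨hj, hw⟩ := h.caseI hs hu e1 e2
  obtain ⟨hi, -⟩ := h.swap.caseI hs hu e2 e1
  by_cases c : G.Adj zq b
  · exact h.caseII hs f e1 (hw ▸ c)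
  subst hw
  have hXa := hs.ab_ne h.ha' h.hb
  have q : IPL G x w (0 + 1) (insert x {w}) := (IPL.single G w).cons h.hxw (by have := h.hxw.ne; simpa) (by simp)
  have hA1 := h.hA1
  have hB1 := h.hB1
  have hA3 := h.hA3
  have par := hs.viaQ h.hb h.ha' f q (by grind) e1 (by grind) (by grind) (by grind) (by grind)
    (by grind)
  have hr : z1 ≠ zq := fun e => by have := f.hQ.zero_iff.2 e; omega
  subst hj hi
  have E1 := h.h1.one
  have E2 := h.h2.one
  have hz := f.hQ.left
  have az := f.az
  have az' := f.az'
  have na := f.nota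
  have na' := f.nota'
  have fx : ∀ u ∈ Q, G.Adj u x → x = a ∨ x = a' ∨ u = zq :=
    fun u hu => f.uni u hu x (Or.inl (Or.inl h.h1.right))
  have fx2 : x ∉ Q := fun hu => f.dis x hu (Or.inl (Or.inl h.h1.right))
  have fy : ∀ u ∈ Q, G.Adj u y → y = a ∨ y = a' ∨ u = zq :=
    fun u hu => f.uni u hu y (Or.inl (Or.inr h.h2.right))
  have fy2 : y ∉ Q := fun hu => f.dis y hu (Or.inl (Or.inr h.h2.right))
  refine hs.hA.spr (x1 := z1) (y1 := zq) f.hQ.conn h.h1.conn h.h2.conn hz l1 l2 f.hQ.right r1 r2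
    ((az _ hz).2 rfl).symm h.haa ((az' _ hz).2 rfl).symm e1 h.hxy e2 hr h.hax h.hay ⟨?_, ?_⟩ ⟨?_, ?_⟩ h.t12
  · rw [E1]; clear f f'; grind
  · rw [E1]; clear f f'; grind [G.adj_comm]
  · rw [E2]; clear f f'; grind
  · rw [E2]; clear f f'; grind [G.adj_comm]

end Artemis

namespace Artemis
variable {V : Type*} {G : SimpleGraph V}
variable {T : Set V} {z1 zn : V} {n : ℕ} {Z : Set V}

/-- data common to both cases of the proof of the star lemma -/
structure Star (G : SimpleGraph V) (T : Set V) (z1 zn : V) (Z : Set V) (a a' a1 b' y : V) (l i : ℕ)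
    (R1 X2 : Set V) : Prop where
  ha : a ∈ SA G T z1 Z
  ha' : a' ∈ SA G T z1 Z
  hb : b' ∈ SA G T zn Z
  haa : G.Adj a a'
  h1 : IPL G a1 b' l R1
  h2 : IPL G a' y i X2
  pl : l % 2 = 1
  hay : a' ≠ y
  haR : a ∉ R1
  haa1 : G.Adj a a1
  haR2 : ∀ v ∈ R1, G.Adj a v → v = a1
  aX : a ∉ X2
  aX2 : ∀ v ∈ X2, G.Adj a v → v = a'
  dX : ∀ u ∈ X2, u ∉ R1
  eX : ∀ u ∈ X2, ∀ v ∈ R1, G.Adj u v → u = y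
  ex : ∃ v ∈ R1, G.Adj y v
  hA1 : ∀ v ∈ R1, v ∉ SA G T z1 Z
  hA2 : ∀ v ∈ X2, v ∈ SA G T z1 Z → v = a'
  hB1 : ∀ v ∈ R1, v ∈ SA G T zn Z → v = b'
  hT1 : ∀ v ∈ R1, v ∉ T
  hT2 : ∀ v ∈ X2, v ∉ T
  u1 : ∀ v ∈ R1, v ∈ Cs G T → v = b' ∨ ∀ u ∈ Z, ¬ G.Adj v u

variable {a a' a1 b b' y : V} {l i m : ℕ} {R1 X2 R R' : Set V}

theorem Star.seg (s : Star G T z1 zn Z a a' a1 b' y l i R1 X2) {w : V} {i1 : ℕ} {S1 : Set V}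
    (h : IPL G a1 w i1 S1) (hS : ∀ v ∈ S1, v ∈ R1) (hw : ∀ v ∈ S1, G.Adj y v → v = w) :
    IPL G a w (i1 + 1) (insert a S1) ∧ TwoE G a w a' y (insert a S1) X2 := by
  have haR := s.haR
  have haR2 := s.haR2
  have aX := s.aX
  have aX2 := s.aX2
  have dX := s.dX
  have eX := s.eX
  refine ⟨h.cons s.haa1 (by grind) (by grind), by grind, by grind [G.adj_comm]⟩

theorem Star.hole (hs : Setting G T z1 zn n Z) (s : Star G T z1 zn Z a a' a1 b' y l i R1 X2) {w : V}
    {i1 : ℕ} {S1 : Set V}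
    (h : IPL G a1 w i1 S1) (hS : ∀ v ∈ S1, v ∈ R1) (hw : ∀ v ∈ S1, G.Adj y v → v = w)
    (hyw : G.Adj y w) : (i + i1 + 1) % 2 = 0 := by
  obtain ⟨g1, g2⟩ := s.seg h hS hw
  have := hs.hA.even g1 s.h2 s.haa hyw.symm g2
    (by have : i ≠ 0 := fun e => s.hay (s.h2.zero_iff.1 e)
        omega)
  rw [Nat.even_iff] at this
  omega

theorem Star.via (hs : Setting G T z1 zn n Z) (s : Star G T z1 zn Z a a' a1 b' y l i R1 X2) {w : V}
    {i2 : ℕ} {S2 : Set V} (hB2 : ∀ v ∈ X2, v ∉ SA G T zn Z)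
    (h : IPL G w b' i2 S2) (hS : ∀ v ∈ S2, v ∈ R1) (hw : ∀ v ∈ S2, G.Adj y v → v = w)
    (hyw : G.Adj y w) : (i + i2 + 1) % 2 = 0 := by
  have dX := s.dX
  have eX := s.eX
  have q := s.h2.append h hyw (by grind) (by grind)
  have hA1 := s.hA1
  have hA2 := s.hA2
  have hB1 := s.hB1
  exact hs.claim1 s.ha' s.hb q (by grind) (by grind)

set_option maxHeartbeats 2000000 in
theorem Star.false1 (hs : Setting G T z1 zn n Z) (s : Star G T z1 zn Z a a' a1 b' y l i R1 X2)
    (hB2 : ∀ v ∈ X2, v ∉ SA G T zn Z)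
    (u2 : ∀ v ∈ X2, v ∈ Cs G T → v = a' ∨ ∀ u ∈ Z, ¬ G.Adj v u) : False := by
  have pl := s.pl
  have dX := s.dX
  have eX := s.eX
  have hA1 := s.hA1
  have hA2 := s.hA2
  have hB1 := s.hB1
  have haR := s.haR
  have haR2 := s.haR2
  have aX2 := s.aX2
  have hT1 := s.hT1
  have u1 := s.u1
  obtain ⟨w, i1, i2, S1, S2, e, hw, g1, g2, hS, h3, h4, h5⟩ |
    ⟨w, w', i1, i2, S1, S2, e, hw, hw', hww, g1, g2, hS, h3, h4, h5, h6⟩ |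
    ⟨w, w', i1, i2, S1, S2, e, hw, hw', g1, g2, hS, h3, h4, h5, h6⟩ := s.h1.trich (fun v => G.Adj y v) s.ex
  · have k1 := s.hole hs g1 (by grind) (by grind) hw
    have k2 := s.via hs hB2 g2 (by grind) (by grind) hw
    omega
  · have hS1 : ∀ v ∈ S1, v ∈ R1 := by grind
    have hS2 : ∀ v ∈ S2, v ∈ R1 := by grind
    have k1 := s.hole hs g1 hS1 h5 hw
    have k2 := s.via hs hB2 g2 hS2 h6 hw'
    obtain ⟨q1, q2⟩ := s.seg g1 hS1 h5
    have l1 := g1.left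
    have r2 := g2.right
    have r1 := g1.right
    have haC := Cs.notMem s.ha.1
    have hab := s.ha
    have hne := hs.ab_ne s.ha s.hb
    have hB : a ∉ SA G T zn Z := fun h => hs.ab_ne s.ha h rfl
    exact Ty1.false hs (a := a) (a' := a') (b := b') (x := w) (y := y) (w := w') (j := i1 + 1) (i := i)
      (k := i2) (X1 := insert a S1) (X2 := X2) (X3 := S2)
      ⟨s.ha, s.ha', s.hb, q1, s.h2, g2, by grind, s.hay, hw.symm, hww, hw', s.haa, q2,
        ⟨by grind, by grind⟩, ⟨by grind, by grind⟩, by omega, by omega, by grind, hB2, by grind, by grind, hA2,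
        by grind, by grind, s.hT2, by grind, by grind, u2, by grind⟩
  · have hS1 : ∀ v ∈ S1, v ∈ R1 := fun v hv => hS (Or.inl hv)
    have hS2 : ∀ v ∈ S2, v ∈ R1 := fun v hv => hS (Or.inr hv)
    have k1 := s.hole hs g1 hS1 h5 hw
    have k2 := s.via hs hB2 g2 hS2 h6 hw'
    obtain ⟨q1, q2⟩ := s.seg g1 hS1 h5
    have hyX := s.h2.right
    have l1 := g1.left
    have hay := s.hay
    have aX := s.aX
    have hB : a ∉ SA G T zn Z := fun h => hs.ab_ne s.ha h rfl
    clear hS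
    have q := (q1.snoc hw.symm (by grind) (by grind [G.adj_comm])).append g2 hw' (by grind) (by grind)
    have := hs.claim1 s.ha s.hb q (by grind) (by grind)
    omega

set_option maxHeartbeats 2000000 in
theorem Star.false2 (hs : Setting G T z1 zn n Z) (s : Star G T z1 zn Z a a' a1 b' b l i R1 X2)
    (hb : b ∈ SA G T zn Z) (hB2 : ∀ v ∈ X2, v ∈ SA G T zn Z → v = b) (hi : i % 2 = 0) : False := by
  have pl := s.pl
  have dX := s.dX
  have eX := s.eX
  have hA1 := s.hA1
  have hA2 := s.hA2
  have hB1 := s.hB1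
  have haR := s.haR
  have haR2 := s.haR2
  have aX := s.aX
  have aX2 := s.aX2
  have hB : a ∉ SA G T zn Z := fun h => hs.ab_ne s.ha h rfl
  have hne : b ≠ b' := by
    rintro rfl
    exact s.dX _ s.h2.right s.h1.right
  have hbb : G.Adj b b' := hs.symm.clique hb s.hb hne
  obtain ⟨w, i1, i2, S1, S2, e, hw, g1, g2, hS, h3, h4, h5⟩ |
    ⟨w, w', i1, i2, S1, S2, e, hw, hw', hww, g1, g2, hS, h3, h4, h5, h6⟩ |
    ⟨w, w', i1, i2, S1, S2, e, hw, hw', g1, g2, hS, h3, h4, h5, h6⟩ := s.h1.trich (fun v => G.Adj b v) s.ex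
  · have e1 := h5 b' s.h1.right hbb
    subst e1
    have e2 := g2.zero_iff.2 rfl
    obtain ⟨q1, q2⟩ := s.seg g1 (by grind) (by grind)
    have ha := s.ha
    exact Ty2.false hs ⟨s.ha, s.ha', s.hb, hb, q1, s.h2, by omega, hi, s.haa, hbb.symm, q2, by grind, by grind,
      by grind, by grind⟩
  · have k1 := s.hole hs g1 (by grind) h5 hw
    have e1 := h6 b' g2.right hbb
    subst e1
    have e2 := g2.zero_iff.2 rfl
    omega
  · have hS1 : ∀ v ∈ S1, v ∈ R1 := fun v hv => hS (Or.inl hv)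
    have k1 := s.hole hs g1 hS1 h5 hw
    obtain ⟨q1, q2⟩ := s.seg g1 hS1 h5
    have hyX := s.h2.right
    have hay := s.hay
    have r2 := g2.right
    have hbA : b ∉ SA G T z1 Z := fun h => hs.ab_ne h hb rfl
    clear hS
    have q := q1.snoc hw.symm (by grind) (by grind [G.adj_comm])
    have := hs.claim1 s.ha hb q (by grind) (by grind)
    omega

set_option maxHeartbeats 2000000 in
theorem Setting.star (hs : Setting G T z1 zn n Z) (ha : a ∈ SA G T z1 Z) (ha' : a' ∈ SA G T z1 Z)
    (hb : b ∈ SA G T zn Z) (hb' : b' ∈ SA G T zn Z) (hne : a ≠ a')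
    (hR : IPL G a' b m R) (hR' : IPL G a b' l R') (hm : m % 2 = 0) (hl : l % 2 = 0)
    (haR : a ∉ R) (haR2 : ∀ v ∈ R, G.Adj a v → v = a')
    (haR' : a' ∉ R') (haR2' : ∀ v ∈ R', G.Adj a' v → v = a)
    (hB : ∀ v ∈ R, v ∈ SA G T zn Z → v = b) (hB' : ∀ v ∈ R', v ∈ SA G T zn Z → v = b') : False := by
  have haa := hs.clique ha ha' hne
  obtain ⟨a1, R1, h1, hS, hn, haa1, haR1⟩ := hR'.tail (hs.ab_ne ha hb')
  have hsub : ∀ v ∈ R1, v ∈ R' := by grind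
  have hl2 : 2 ≤ l := by
    have : l ≠ 0 := fun e => hs.ab_ne ha hb' (hR'.zero_iff.1 e)
    omega
  have nb : ∀ v ∈ R1, ∃ u ∈ R1, G.Adj v u := by
    intro v hv
    by_cases e : v = b'
    · subst e
      obtain ⟨w, S2, g1, g2, -, g3, -⟩ := h1.symm.tail (fun e => by
        have := h1.zero_iff.2 e.symm
        omega)
      exact ⟨w, g2 ▸ Or.inr g1.left, g3⟩
    · obtain ⟨i, w, S1, S2, -, -, g1, g2, -, g3, -⟩ := h1.cut hv e
      exact ⟨w, g2 ▸ Or.inr g1.left, g3⟩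
  have exb : ∃ v ∈ R1, G.Adj b v := by
    by_cases e : b = b'
    · subst e; exact nb _ h1.right
    · exact ⟨b', h1.right, hs.symm.clique hb hb' e⟩
  obtain ⟨y, i, j, X2, Y, hij, hy, g1, g2, hS2, g3, g4, g5⟩ :=
    hR.first (fun u => ∃ v ∈ R1, G.Adj u v) ⟨b, hR.right, exb⟩
  have hX : ∀ v ∈ X2, v ∈ R := by rw [hS2]; grind
  have hay : a' ≠ y := by
    rintro rfl
    obtain ⟨v, hv, e⟩ := hy
    have := haR2' v (hsub v hv) e
    subst this
    exact hn hv
  have dX : ∀ u ∈ X2, u ∉ R1 := by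
    intro u hu hu1
    have := g3 u hu (nb u hu1)
    subst this
    obtain ⟨w, S2, k1, k2, k3, k4, k5⟩ := g1.symm.tail hay.symm
    have hw : w ∈ X2 := k2 ▸ Or.inr k1.left
    have := g3 w hw ⟨u, hu1, k4.symm⟩
    exact k4.ne this.symm
  have hAR : ∀ v ∈ R, v ∈ SA G T z1 Z → v = a' := fun v hv hvA => by
    by_cases e : v = a
    · exact absurd (e ▸ hv) haR
    · exact haR2 v hv (hs.clique ha hvA (Ne.symm e))
  have hAR' : ∀ v ∈ R', v ∈ SA G T z1 Z → v = a := fun v hv hvA => by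
    by_cases e : v = a'
    · exact absurd (e ▸ hv) haR'
    · exact haR2' v hv (hs.clique ha' hvA (Ne.symm e))
  have hTR : ∀ v ∈ R, v ∉ T := fun v hv ht =>
    Cs.notMem ha'.1 (haR2 v hv (ha.1 v ht) ▸ ht)
  have hTR' : ∀ v ∈ R', v ∉ T := fun v hv ht =>
    Cs.notMem ha.1 (haR2' v hv (ha'.1 v ht) ▸ ht)
  have un : ∀ v ∈ R, v ∈ Cs G T → v = a' ∨ v = b ∨ ∀ u ∈ Z, ¬ G.Adj v u := by
    intro v hv hc
    by_cases e : v = a'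
    · exact Or.inl e
    by_contra! hcon
    exact hcon.2.1 (hB v hv (hs.touch ha hc hcon.2.2 (by rintro rfl; exact haR hv)
      (fun h => e (haR2 v hv h.symm))))
  have un' : ∀ v ∈ R', v ∈ Cs G T → v = a ∨ v = b' ∨ ∀ u ∈ Z, ¬ G.Adj v u := by
    intro v hv hc
    by_cases e : v = a
    · exact Or.inl e
    by_contra! hcon
    exact hcon.2.1 (hB' v hv (hs.touch ha' hc hcon.2.2 (by rintro rfl; exact haR' hv)
      (fun h => e (haR2' v hv h.symm))))
  have s : Star G T z1 zn Z a a' a1 b' y (l - 1) i R1 X2 :=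
    ⟨ha, ha', hb', haa, h1, g1, by omega, hay, hn, haa1, haR1, by grind, by grind, dX,
      fun u hu v hv e => g3 u hu ⟨v, hv, e⟩, hy, by grind, by grind, by grind, by grind, by grind,
      by grind⟩
  by_cases e : y = b
  · subst e
    have := g2.zero_iff.2 rfl
    exact s.false2 hs hb (by grind) (by omega)
  · have hbX : b ∉ X2 := fun h => e (g4 b h g2.right).symm
    exact s.false1 hs (by grind) (by grind)

end Artemis

namespace Artemis
variable {V : Type*} {G : SimpleGraph V}
variable {T : Set V} {z1 zn : V} {n : ℕ} {Z : Set V}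

/-- the order on `A` -/
def OLt (G : SimpleGraph V) (T : Set V) (z1 zn : V) (Z : Set V) (a a' : V) : Prop :=
  a ∈ SA G T z1 Z ∧ a' ∈ SA G T z1 Z ∧ a ≠ a' ∧ ∃ b m R, b ∈ SA G T zn Z ∧ IPL G a' b m R ∧ m % 2 = 0 ∧
    a ∉ R ∧ (∀ v ∈ R, G.Adj a v → v = a') ∧ (∀ v ∈ R, v ∈ SA G T zn Z → v = b)

theorem Setting.olt_get (hs : Setting G T z1 zn n Z) {a b v : V} {k : ℕ} {P : Set V}
    (ha : a ∈ SA G T z1 Z) (hb : b ∈ SA G T zn Z) (hP : IPL G a b k P) (hk : k % 2 = 1)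
    (hv : v ∈ P) (hvA : v ∈ SA G T z1 Z) (hne : v ≠ a) : OLt G T z1 zn Z a v := by
  obtain ⟨a', R, h1, hS, h2, h3, h4⟩ := hP.tail (hs.ab_ne ha hb)
  have e : v = a' := h4 v (by grind) (hs.clique ha hvA hne.symm)
  subst e
  refine ⟨ha, hvA, hne.symm, b, k - 1, R, hb, h1, by omega, h2, h4, ?_⟩
  intro u hu huB
  by_contra hub
  obtain ⟨w, S, g1, g2, g3, g4, g5⟩ := h1.symm.tail (hs.ab_ne hvA hb).symm
  have e : u = w := g5 u (by grind) (hs.symm.clique hb huB (Ne.symm hub))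
  subst e
  have hl := h1.left
  have := hs.claim1 hvA huB g1.symm (by
    intro x hx hxA
    refine h4 x (by grind) (hs.clique ha hxA ?_)
    rintro rfl
    exact h2 (by grind)) (by
    intro x hx hxB
    refine g5 x hx (hs.symm.clique hb hxB ?_)
    rintro rfl
    exact g3 hx)
  have : k - 1 ≠ 0 := fun e => (hs.ab_ne hvA hb) (h1.zero_iff.1 e)
  omega

theorem Setting.olt_asymm (hs : Setting G T z1 zn n Z) {a a' : V} (h : OLt G T z1 zn Z a a')
    (h' : OLt G T z1 zn Z a' a) : False := by
  obtain ⟨ha, ha', hne, b, m, R, hb, h1, h2, h3, h4, h5⟩ := h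
  obtain ⟨-, -, -, b', m', R', hb', h1', h2', h3', h4', h5'⟩ := h'
  exact hs.star ha ha' hb hb' hne h1 h1' h2 h2' h3 h4 h3' h4' h5 h5'

set_option maxHeartbeats 1000000 in
theorem Setting.olt_trans (hs : Setting G T z1 zn n Z) {a a' a'' : V} (h : OLt G T z1 zn Z a a')
    (h' : OLt G T z1 zn Z a' a'') : OLt G T z1 zn Z a a'' := by
  by_cases e : a = a''
  · subst e; exact (hs.olt_asymm h h').elim
  obtain ⟨ha, ha', hne, b, m, R, hb, h1, h2, h3, h4, h5⟩ := h
  obtain ⟨-, ha'', hne', b', m', R', hb', h1', h2', h3', h4', h5'⟩ := h'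
  have hAR : ∀ v ∈ R', v ∈ SA G T z1 Z → v = a'' := fun v hv hvA => by
    by_cases e : v = a'
    · exact absurd (e ▸ hv) h3'
    · exact h4' v hv (hs.clique ha' hvA (Ne.symm e))
  have haR : a ∉ R' := fun h => e (hAR a h ha)
  by_cases c : ∃ v ∈ R', G.Adj a v ∧ v ≠ a''
  · exfalso
    obtain ⟨e, q, j, S1, S2, hij, he, g1, g2, hS, g3, g4, g5⟩ := h1'.symm.first _ c
    have hS1 : ∀ v ∈ S1, v ∈ R' := by grind
    have hn : a'' ∉ S1 := fun h => he.2 (g4 _ h g2.right).symm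
    have hB : a ∉ SA G T zn Z := fun h => hs.ab_ne ha h rfl
    clear hS
    have g3' : ∀ v ∈ S1, G.Adj a v → v = e := fun v hv h => g3 v hv ⟨h, by rintro rfl; exact hn hv⟩
    have hp := g1.symm.cons he.1 (by grind) g3'
    have par := hs.claim1 ha hb' hp (by grind) (by grind)
    exact hs.star ha ha' hb hb' hne h1 hp h2 par h3 h4 (by grind) (by grind) h5 (by grind)
  · exact ⟨ha, ha'', e, b', m', R', hb', h1', h2', haR, by grind, h5'⟩

theorem Setting.maximal [Finite V] (hs : Setting G T z1 zn n Z) :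
    ∃ a ∈ SA G T z1 Z, ∀ b ∈ SA G T zn Z, ∀ k P, IPL G a b k P → k % 2 = 1 →
      ∀ v ∈ P, v ∈ SA G T z1 Z → v = a := by
  haveI : IsTrans V (fun x y => OLt G T z1 zn Z y x) := ⟨fun x y z h1 h2 => hs.olt_trans h2 h1⟩
  haveI : Std.Irrefl (fun x y => OLt G T z1 zn Z y x) := ⟨fun x h => h.2.2.1 rfl⟩
  have wf := Finite.wellFounded_of_trans_of_irrefl (fun x y => OLt G T z1 zn Z y x)
  obtain ⟨a, ha, hmin⟩ := wf.has_min (SA G T z1 Z) hs.hAne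
  refine ⟨a, ha, fun b hb k P hP hk v hv hvA => ?_⟩
  by_contra hne
  exact hmin v hvA (hs.olt_get ha hb hP hk hv hvA hne)

/-- the chosen pair -/
structure Pair (G : SimpleGraph V) (T : Set V) (z1 zn : V) (Z : Set V) (a b : V) : Prop where
  ha : a ∈ SA G T z1 Z
  hb : b ∈ SA G T zn Z
  m1 : ∀ b ∈ SA G T zn Z, ∀ k P, IPL G a b k P → k % 2 = 1 → ∀ v ∈ P, v ∈ SA G T z1 Z → v = a
  m2 : ∀ a ∈ SA G T z1 Z, ∀ k P, IPL G b a k P → k % 2 = 1 → ∀ v ∈ P, v ∈ SA G T zn Z → v = b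

theorem Setting.pair [Finite V] (hs : Setting G T z1 zn n Z) : ∃ a b, Pair G T z1 zn Z a b := by
  obtain ⟨a, ha, h1⟩ := hs.maximal
  obtain ⟨b, hb, h2⟩ := hs.symm.maximal
  exact ⟨a, b, ha, hb, h1, h2⟩

theorem Pair.symm {a b : V} (p : Pair G T z1 zn Z a b) : Pair G T zn z1 Z b a :=
  ⟨p.hb, p.ha, p.m2, p.m1⟩

theorem Pair.even (hs : Setting G T z1 zn n Z) {a b : V} (p : Pair G T z1 zn Z a b) {k : ℕ} {P : Set V}
    (hP : IPL G a b k P) : k % 2 = 0 := by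
  by_contra hk
  have hk : k % 2 = 1 := by omega
  have := hs.claim1 p.ha p.hb hP (p.m1 b p.hb k P hP hk) (p.m2 a p.ha k P hP.symm hk)
  omega

end Artemis

namespace Artemis
variable {V : Type*} {G : SimpleGraph V}

/-- two paths between two triangles, with connected sets at both ends -/
structure GP (G : SimpleGraph V) (a1 a2 a3 b1 b2 b3 : V) (k2 k3 : ℕ) (A P2 P3 F : Set V) : Prop where
  cF : Conn G F
  cA : Conn G A
  hb1 : b1 ∈ F
  ha1 : a1 ∈ A
  h2 : IPL G a2 b2 k2 P2
  h3 : IPL G a3 b3 k3 P3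
  n2 : a2 ≠ b2
  n3 : a3 ≠ b3
  a12 : G.Adj a1 a2
  a13 : G.Adj a1 a3
  a23 : G.Adj a2 a3
  b12 : G.Adj b1 b2
  b13 : G.Adj b1 b3
  b23 : G.Adj b2 b3
  eAF : NoE G A F
  eA2 : OneE G a1 a2 A P2
  eA3 : OneE G a1 a3 A P3
  eF2 : OneE G b1 b2 F P2
  eF3 : OneE G b1 b3 F P3
  e23 : TwoE G a2 b2 a3 b3 P2 P3

variable {a1 a2 a3 b1 b2 b3 z : V} {k2 k3 : ℕ} {A P2 P3 F : Set V}

theorem GP.swap (g : GP G a1 a2 a3 b1 b2 b3 k2 k3 A P2 P3 F) : GP G a1 a3 a2 b1 b3 b2 k3 k2 A P3 P2 F :=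
  ⟨g.cF, g.cA, g.hb1, g.ha1, g.h3, g.h2, g.n3, g.n2, g.a13, g.a12, g.a23.symm, g.b13, g.b12, g.b23.symm,
    g.eAF, g.eA3, g.eA2, g.eF3, g.eF2, g.e23.symm⟩

/-- every apex claw with a neighbour in `P2 - a2` and in `A ∪ P3` -/
theorem GP.sp1 (hA : AF G) (g : GP G a1 a2 a3 b1 b2 b3 k2 k3 A P2 P3 F) (zF : z ∉ F) (zA : z ∉ A)
    (z2 : z ∉ P2) (z3 : z ∉ P3) (nF : ∃ w ∈ F, G.Adj z w)
    (m2 : ∃ w ∈ P2, w ≠ a2 ∧ G.Adj z w) (m3 : ∃ w ∈ A ∪ P3, G.Adj z w) : Two3 G z b1 b2 b3 := by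
  obtain ⟨w0, S0, k1, e, k3, k4, k5⟩ := g.h2.tail g.n2
  obtain ⟨q1, q2⟩ := g.eAF
  obtain ⟨q3, q4⟩ := g.eA2
  obtain ⟨q5, q6⟩ := g.eF3
  obtain ⟨q7, q8⟩ := g.eF2
  obtain ⟨q9, q10⟩ := g.e23
  have hS : ∀ v ∈ S0, v ∈ P2 := by grind
  have hS' : ∀ v ∈ P2, v = a2 ∨ v ∈ S0 := by grind
  clear e
  refine hA.sp g.cF k1.conn (g.cA.union g.h3.conn ⟨a1, g.ha1, a3, g.h3.left, Or.inr g.a13⟩)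
    g.hb1 k1.right (Or.inr g.h3.right) g.b12 g.b23 g.b13 ⟨?_, ?_⟩ ⟨?_, ?_⟩ ⟨?_, ?_⟩ zF ?_ ?_ nF ?_ m3
  · grind
  · grind
  · grind
  · grind [G.adj_comm]
  · grind
  · grind [G.adj_comm]
  · grind
  · grind
  · grind

theorem GP.sp2 (hA : AF G) (g : GP G a1 a2 a3 b1 b2 b3 k2 k3 A P2 P3 F)
    (z2 : z ∉ P2) (z3 : z ∉ P3) (nF : ∃ w ∈ F, G.Adj z w)
    (c3 : ∀ w ∈ P3, ¬ G.Adj z w) (m : G.Adj z a2) (m2 : ∀ w ∈ P2, G.Adj z w → w = a2) : False := by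
  obtain ⟨w0, S0, k1, e, k3, k4, k5⟩ := g.h2.tail g.n2
  obtain ⟨q5, q6⟩ := g.eF3
  obtain ⟨q7, q8⟩ := g.eF2
  obtain ⟨q9, q10⟩ := g.e23
  have hS : ∀ v ∈ S0, v ∈ P2 := by grind
  have hS' : ∀ v ∈ P2, v = a2 ∨ v ∈ S0 := by grind
  clear e
  have l2 := g.h2.left
  have n2 := g.n2
  have n3 := g.n3
  have b1F := g.hb1
  have r3 := g.h3.right
  have := hA.sp (t := a2) (g.cF.ins nF) k1.conn g.h3.conn (Or.inr g.hb1) k1.right g.h3.right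
    g.b12 g.b23 g.b13 ⟨by grind, by grind⟩ ⟨by grind, by grind⟩ ⟨by grind, by grind⟩ (by grind) k3
    (by grind) ⟨z, Or.inl rfl, m.symm⟩ ⟨w0, k1.left, k4⟩ ⟨a3, g.h3.left, g.a23⟩
  have e1 : ¬ G.Adj a2 b1 := fun h => n2 (q8 _ b1F _ l2 h.symm).2
  have e2 : ¬ G.Adj a2 b3 := fun h => by
    obtain e | e := q10 _ l2 _ r3 h
    · exact n3 e.2.symm
    · exact n2 e.1
  tauto

set_option maxHeartbeats 2000000 in
theorem GP.two (hA : AF G) (g : GP G a1 a2 a3 b1 b2 b3 k2 k3 A P2 P3 F) (zF : z ∉ F) (zA : z ∉ A)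
    (z2 : z ∉ P2) (z3 : z ∉ P3) (nF : ∃ w ∈ F, G.Adj z w)
    (c3 : ∀ w ∈ P3, ¬ G.Adj z w) (m2 : ∃ w ∈ P2, G.Adj z w) : Two3 G z b1 b2 b3 ∨
      (G.Adj z b2 ∧ ∀ w ∈ A, ¬ G.Adj z w) := by
  by_cases m2' : ∃ w ∈ P2, w ≠ a2 ∧ G.Adj z w
  swap
  · push Not at m2'
    have m2'' : ∀ w ∈ P2, G.Adj z w → w = a2 := by grind
    obtain ⟨w, hw, e⟩ := m2
    exact (g.sp2 hA z2 z3 nF c3 (m2'' w hw e ▸ e) m2'').elim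
  by_cases cA : ∃ w ∈ A, G.Adj z w
  · obtain ⟨w, hw, e⟩ := cA
    exact Or.inl (g.sp1 hA zF zA z2 z3 nF m2' ⟨w, Or.inl hw, e⟩)
  push Not at cA
  by_cases cb : G.Adj z b2
  · exact Or.inr ⟨cb, cA⟩
  obtain ⟨q5, q6⟩ := g.eF3
  obtain ⟨q7, q8⟩ := g.eF2
  obtain ⟨q9, q10⟩ := g.e23
  have l2 := g.h2.left
  have l3 := g.h3.left
  have n2 := g.n2
  have n3 := g.n3
  have b1F := g.hb1
  have r2 := g.h2.right
  have r3 := g.h3.right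
  obtain ⟨w, i1, i2, S1, S2, e, hw, g1, g2, hS, h3, h4, h5⟩ |
    ⟨w, w', i1, i2, S1, S2, e, hw, hw', hww, g1, g2, hS, h3, h4, h5, h6⟩ |
    ⟨w, w', i1, i2, S1, S2, e, hw, hw', g1, g2, hS, h3, h4, h5, h6⟩ := g.h2.trich (fun v => G.Adj z v) m2
  · exfalso
    have wb : w ≠ b2 := by rintro rfl; exact cb hw
    have wa : w ≠ a2 := by rintro rfl; grind
    obtain ⟨p, U1, k1, e1, k3, k4, k5⟩ := g1.symm.tail wa
    obtain ⟨p', U2, k1', e1', k3', k4', k5'⟩ := g2.tail wb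
    have hU1 : ∀ v ∈ U1, v ∈ P2 ∧ v ∉ U2 ∧ v ≠ w := by grind
    have hU2 : ∀ v ∈ U2, v ∈ P2 ∧ v ≠ w := by grind
    have hU3 : ∀ u ∈ U1, ∀ v ∈ U2, ¬ G.Adj u v := by grind
    have hwP : w ∈ P2 := by rw [hS]; exact Or.inl g1.right
    have la := k1.right
    have lb := k1'.right
    clear hS e1 e1' h3 h4
    have := hA.sp (t := w) (g.cF.ins nF) k1'.conn (k1.conn.union g.h3.conn ⟨a2, k1.right, a3, l3, Or.inr g.a23⟩)
      (Or.inr g.hb1) k1'.right (Or.inr r3)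
      g.b12 g.b23 g.b13 ⟨by grind, by grind⟩ ⟨by grind, by grind⟩ ⟨by grind, by grind [G.adj_comm]⟩ (by grind) k3'
      (by grind) ⟨z, Or.inl rfl, hw.symm⟩ ⟨p', k1'.left, k4'⟩ ⟨p, Or.inl k1.left, k4⟩
    have e1 : ¬ G.Adj w b1 := fun h => wb (q8 _ b1F _ hwP h.symm).2
    have e2 : ¬ G.Adj w b3 := fun h => by
      obtain e | e := q10 _ hwP _ r3 h
      · exact n3 e.2.symm
      · exact wb e.1
    tauto
  · exfalso
    have wb : w' ≠ b2 := by rintro rfl; exact cb hw'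
    have hS1 : ∀ v ∈ S1, v ∈ P2 := by grind
    have hS2 : ∀ v ∈ S2, v ∈ P2 := by grind
    have l1 := g1.left
    have lr := g1.right
    have lb := g2.right
    clear hS
    exact hA.spr (x1 := z) (y1 := b1) (g.cF.ins nF) g2.conn
      (g1.conn.union g.h3.conn ⟨a2, g1.left, a3, l3, Or.inr g.a23⟩)
      (Or.inl rfl) g2.left (Or.inl g1.right) (Or.inr b1F) g2.right (Or.inr r3)
      hw' hww.symm hw g.b12 g.b23 g.b13 (by grind) wb (by grind)
      ⟨by grind, by grind⟩ ⟨by grind, by grind⟩ ⟨by grind, by grind [G.adj_comm]⟩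
  · left
    have hS1 : ∀ v ∈ S1, v ∈ P2 := fun v hv => hS (Or.inl hv)
    have hS2 : ∀ v ∈ S2, v ∈ P2 := fun v hv => hS (Or.inr hv)
    clear hS
    have l1 := g1.left
    have r1 := g2.right
    exact hA.sp g.cF g2.conn (g1.conn.union g.h3.conn ⟨a2, g1.left, a3, l3, Or.inr g.a23⟩)
      g.hb1 g2.right (Or.inr r3) g.b12 g.b23 g.b13 ⟨by grind, by grind⟩ ⟨by grind, by grind⟩
      ⟨by grind, by grind [G.adj_comm]⟩ zF (by grind) (by grind) nF ⟨w', g2.left, hw'⟩ ⟨w, Or.inl g1.right, hw⟩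

set_option maxHeartbeats 2000000 in
theorem GP.main (hA : AF G) (g : GP G a1 a2 a3 b1 b2 b3 k2 k3 A P2 P3 F) (zF : z ∉ F) (zA : z ∉ A)
    (z2 : z ∉ P2) (z3 : z ∉ P3) (nF : ∃ w ∈ F, G.Adj z w) : Two3 G z b1 b2 b3 ∨
      ((∀ w ∈ A, ¬ G.Adj z w) ∧ (∀ w ∈ P2, ¬ G.Adj z w) ∧ (∀ w ∈ P3, ¬ G.Adj z w)) ∨
      ((∀ w ∈ A, ¬ G.Adj z w) ∧ G.Adj z b2 ∧ (∀ w ∈ P3, ¬ G.Adj z w)) ∨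
      ((∀ w ∈ A, ¬ G.Adj z w) ∧ (∀ w ∈ P2, ¬ G.Adj z w) ∧ G.Adj z b3) := by
  have sw : Two3 G z b1 b3 b2 → Two3 G z b1 b2 b3 := by unfold Two3; tauto
  by_cases c2 : ∃ w ∈ P2, G.Adj z w
  · by_cases c3 : ∃ w ∈ P3, G.Adj z w
    · left
      by_cases d2 : ∃ w ∈ P2, w ≠ a2 ∧ G.Adj z w
      · obtain ⟨w, hw, e⟩ := c3
        exact g.sp1 hA zF zA z2 z3 nF d2 ⟨w, Or.inr hw, e⟩
      by_cases d3 : ∃ w ∈ P3, w ≠ a3 ∧ G.Adj z w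
      · obtain ⟨w, hw, e⟩ := c2
        exact sw (g.swap.sp1 hA zF zA z3 z2 nF d3 ⟨w, Or.inr hw, e⟩)
      exfalso
      push Not at d2 d3
      have d2' : ∀ w ∈ P2, G.Adj z w → w = a2 := by grind
      have d3' : ∀ w ∈ P3, G.Adj z w → w = a3 := by grind
      obtain ⟨w2, hw2, e2⟩ := c2
      obtain ⟨w3, hw3, e3⟩ := c3
      have f2 := d2' _ hw2 e2
      have f3 := d3' _ hw3 e3
      subst f2 f3
      obtain ⟨q5, q6⟩ := g.eF3
      obtain ⟨q7, q8⟩ := g.eF2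
      have hb := g.hb1
      exact hA.spr (x1 := z) (y1 := b1) (g.cF.ins nF) g.h2.conn g.h3.conn
        (Or.inl rfl) hw2 hw3 (Or.inr g.hb1) g.h2.right g.h3.right
        e2 g.a23 e3 g.b12 g.b23 g.b13 (by grind) g.n2 g.n3
        ⟨by grind, by grind⟩ ⟨by grind, by grind⟩ g.e23
    · push Not at c3
      obtain h | h := g.two hA zF zA z2 z3 nF c3 c2
      · exact Or.inl h
      · exact Or.inr (Or.inr (Or.inl ⟨h.2, h.1, c3⟩))
  · push Not at c2
    by_cases c3 : ∃ w ∈ P3, G.Adj z w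
    · obtain h | h := g.swap.two hA zF zA z3 z2 nF c2 c3
      · exact Or.inl (sw h)
      · exact Or.inr (Or.inr (Or.inr ⟨h.2, c2, h.1⟩))
    · push Not at c3
      by_cases cA : ∃ w ∈ A, G.Adj z w
      swap
      · push Not at cA
        exact Or.inr (Or.inl ⟨cA, c2, c3⟩)
      exfalso
      obtain ⟨w, hw, e⟩ := cA
      obtain ⟨q1, q2⟩ := g.eAF
      obtain ⟨q3, q4⟩ := g.eA2
      obtain ⟨q3', q4'⟩ := g.eA3
      obtain ⟨q5, q6⟩ := g.eF3
      obtain ⟨q7, q8⟩ := g.eF2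
      have hb := g.hb1
      have ha := g.ha1
      exact hA.spr (x1 := a1) (y1 := b1)
        ((g.cF.ins nF).union g.cA ⟨z, Or.inl rfl, w, hw, Or.inr e⟩) g.h2.conn g.h3.conn
        (Or.inr ha) g.h2.left g.h3.left (Or.inl (Or.inr hb)) g.h2.right g.h3.right
        g.a12 g.a23 g.a13 g.b12 g.b23 g.b13 (by grind) g.n2 g.n3
        ⟨by grind, by grind⟩ ⟨by grind, by grind⟩ g.e23

end Artemis

namespace Artemis
variable {V : Type*} {G : SimpleGraph V}
variable {T : Set V} {z1 zn : V} {n : ℕ} {Z : Set V}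

/-- the gap configuration, giving a prism after contraction -/
structure GapD (G : SimpleGraph V) (a b a1 a2 a3 b1 b2 b3 : V) (i j k2 k3 : ℕ) (A B P2 P3 : Set V) :
    Prop where
  hA : IPL G a a1 i A
  hB : IPL G b b1 j B
  hb : b ≠ b1
  g : GP G a1 a2 a3 b1 b2 b3 k2 k3 A P2 P3 B

/-- existence of a gap configuration -/
def Gap (G : SimpleGraph V) (a b : V) : Prop :=
  ∃ a1 a2 a3 b1 b2 b3 i j k2 k3 A B P2 P3, GapD G a b a1 a2 a3 b1 b2 b3 i j k2 k3 A B P2 P3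

variable {a b a1 a2 a3 b1 b2 b3 : V} {i j k2 k3 : ℕ} {A B P2 P3 : Set V}

theorem GapD.swap (d : GapD G a b a1 a2 a3 b1 b2 b3 i j k2 k3 A B P2 P3) :
    GapD G a b a1 a3 a2 b1 b3 b2 i j k3 k2 A B P3 P2 := ⟨d.hA, d.hB, d.hb, d.g.swap⟩

theorem GapD.path (d : GapD G a b a1 a2 a3 b1 b2 b3 i j k2 k3 A B P2 P3) :
    ∃ k, 4 ≤ k ∧ IPL G a b k (A ∪ P2 ∪ B) := by
  obtain ⟨q1, q2⟩ := d.g.eAF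
  obtain ⟨q3, q4⟩ := d.g.eA2
  obtain ⟨q7, q8⟩ := d.g.eF2
  have q := (d.hA.append d.g.h2 d.g.a12 q3 q4).append d.hB.symm d.g.b12.symm (by grind)
    (by grind [G.adj_comm])
  refine ⟨_, ?_, q⟩
  have : j ≠ 0 := fun e => d.hb (d.hB.zero_iff.1 e)
  have : k2 ≠ 0 := fun e => d.g.n2 (d.g.h2.zero_iff.1 e)
  omega

theorem Pair.f1half (hs : Setting G T z1 zn n Z) (p : Pair G T z1 zn Z a b) {k : ℕ} {D : Set V}
    (h : IPL G a b k D) {c : V} (hc : c ∈ D) (hcA : c ∈ SA G T z1 Z) : c = a := by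
  by_contra hne
  have par := p.even hs h
  obtain ⟨c', D', h1, hS, h2, h3, h4⟩ := h.tail (hs.ab_ne p.ha p.hb)
  have hcD : c ∈ D' := by grind
  have e : c = c' := h4 c hcD (hs.clique p.ha hcA (Ne.symm hne))
  subst e
  have hk : k ≠ 0 := fun e => (hs.ab_ne p.ha p.hb) (h.zero_iff.1 e)
  have := hs.claim1 hcA p.hb h1 (fun v hv hvA => h4 v hv (hs.clique p.ha hvA (by
    rintro rfl; exact h2 hv))) (p.m2 c hcA _ _ h1.symm (by omega))
  omega

theorem Pair.f1 (hs : Setting G T z1 zn n Z) (p : Pair G T z1 zn Z a b) {k : ℕ} {D : Set V}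
    (h : IPL G a b k D) (hk : 3 ≤ k) {c : V} (hc : c ∈ D) (hcC : c ∈ Cs G T) :
    c = a ∨ c = b ∨ ∀ u ∈ Z, ¬ G.Adj c u := by
  by_contra! hcon
  obtain ⟨ca, cb, ht⟩ := hcon
  by_cases e : G.Adj c b
  · have e' : ¬ G.Adj c a := by
      intro e'
      have := h.two_of_common hc e' e
      omega
    exact cb (p.symm.f1half hs.symm h.symm hc (hs.touch p.ha hcC ht ca e'))
  · exact ca (p.f1half hs h hc (hs.symm.touch p.hb hcC ht cb e))

theorem GapD.unt (hs : Setting G T z1 zn n Z) (p : Pair G T z1 zn Z a b)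
    (d : GapD G a b a1 a2 a3 b1 b2 b3 i j k2 k3 A B P2 P3) :
    (b1 ∈ Cs G T → ∀ u ∈ Z, ¬ G.Adj b1 u) ∧ (b2 ∈ Cs G T → ∀ u ∈ Z, ¬ G.Adj b2 u) ∧
      (b3 ∈ Cs G T → ∀ u ∈ Z, ¬ G.Adj b3 u) := by
  obtain ⟨k, hk, hD⟩ := d.path
  obtain ⟨k', hk', hD'⟩ := d.swap.path
  obtain ⟨q1, q2⟩ := d.g.eAF
  obtain ⟨q3, q4⟩ := d.g.eA2
  obtain ⟨q7, q8⟩ := d.g.eF2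
  obtain ⟨q3', q4'⟩ := d.g.eA3
  obtain ⟨q7', q8'⟩ := d.g.eF3
  have l1 := d.hA.left
  have l2 := d.hB.left
  have m1 := d.g.hb1
  have m2 := d.g.h2.right
  have m3 := d.g.h3.right
  have hb := d.hb
  refine ⟨fun hc => ?_, fun hc => ?_, fun hc => ?_⟩
  · obtain e | e | e := p.f1 hs hD (by omega) (Or.inr m1) hc
    · grind
    · grind
    · exact e
  · obtain e | e | e := p.f1 hs hD (by omega) (Or.inl (Or.inr m2)) hc
    · grind
    · grind
    · exact e
  · obtain e | e | e := p.f1 hs hD' (by omega) (Or.inl (Or.inr m3)) hc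
    · grind
    · grind
    · exact e

/-- non-adjacencies of the ends -/
theorem GapD.nadj (d : GapD G a b a1 a2 a3 b1 b2 b3 i j k2 k3 A B P2 P3) :
    ¬ G.Adj a b1 ∧ ¬ G.Adj a b2 ∧ ¬ G.Adj b b2 ∧ a ≠ b2 ∧ b ≠ b2 := by
  have l1 := d.hA.left
  have l2 := d.hB.left
  have m2 := d.g.h2.right
  refine ⟨d.g.eAF.2 _ l1 _ d.g.hb1, fun e => d.g.n2 (d.g.eA2.2 _ l1 _ m2 e).2.symm,
    fun e => d.hb (d.g.eF2.2 _ l2 _ m2 e).1, ?_, ?_⟩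
  · rintro rfl; exact d.g.eA2.1 _ l1 m2
  · rintro rfl; exact d.g.eF2.1 _ l2 m2

theorem GapD.f2 (hs : Setting G T z1 zn n Z) (p : Pair G T z1 zn Z a b)
    (d : GapD G a b a1 a2 a3 b1 b2 b3 i j k2 k3 A B P2 P3) :
    (b1 ∈ Cs G T ∨ b2 ∈ Cs G T) ∧ (b1 ∈ Cs G T ∨ b3 ∈ Cs G T) ∧ (b2 ∈ Cs G T ∨ b3 ∈ Cs G T) := by
  obtain ⟨k, hk, hD⟩ := d.path
  obtain ⟨k', hk', hD'⟩ := d.swap.path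
  have nT := notT hD p.ha.1 p.hb.1 (by omega)
  have nT' := notT hD' p.ha.1 p.hb.1 (by omega)
  have cov : ∀ t ∈ T, Two3 G t b1 b2 b3 := by
    intro t ht
    have ta := (p.ha.1 t ht).symm
    obtain h | ⟨h, -⟩ | ⟨h, -⟩ | ⟨h, -⟩ := d.g.main hs.hA (z := t) (fun h => nT t (Or.inr h) ht)
      (fun h => nT t (Or.inl (Or.inl h)) ht) (fun h => nT t (Or.inl (Or.inr h)) ht)
      (fun h => nT' t (Or.inl (Or.inr h)) ht) ⟨b, d.hB.left, (p.hb.1 t ht).symm⟩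
    · exact h
    all_goals exact absurd ta (h a d.hA.left)
  obtain ⟨e1, e2, -⟩ := d.nadj
  obtain ⟨-, e3, -⟩ := d.swap.nadj
  have t1 := nT b1 (Or.inr d.g.hb1)
  have t2 := nT b2 (Or.inl (Or.inr d.g.h2.right))
  have t3 := nT' b3 (Or.inl (Or.inr d.g.h3.right))
  refine ⟨?_, ?_, ?_⟩
  · by_contra! hcon
    refine hs.hA.lab hs.anti d.g.b12 t1 t2 hcon.1 hcon.2 (fun t ht => ?_) p.ha.1 e1 e2
    have := cov t ht
    unfold Two3 at this
    grind [G.adj_comm]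
  · by_contra! hcon
    refine hs.hA.lab hs.anti d.g.b13 t1 t3 hcon.1 hcon.2 (fun t ht => ?_) p.ha.1 e1 e3
    have := cov t ht
    unfold Two3 at this
    grind [G.adj_comm]
  · by_contra! hcon
    refine hs.hA.lab hs.anti d.g.b23 t2 t3 hcon.1 hcon.2 (fun t ht => ?_) p.ha.1 e2 e3
    have := cov t ht
    unfold Two3 at this
    grind [G.adj_comm]

/-- one outer path from `a` via `Z`, `b2` to `b3` -/
theorem Setting.reach (hs : Setting G T z1 zn n Z) (ha : a ∈ SA G T z1 Z) (h2 : ¬ G.Adj a b2)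
    (h3 : ¬ G.Adj a b3) (n2 : a ≠ b2) (n3 : a ≠ b3) (h23 : G.Adj b2 b3) (c2 : b2 ∉ Cs G T)
    (c3 : b3 ∈ Cs G T) (u3 : ∀ u ∈ Z, ¬ G.Adj b3 u) (t : ∃ u ∈ Z, G.Adj b2 u) :
    ∃ w q j S1 S2, q + j = n ∧ q + 1 = n ∧ G.Adj b2 w ∧ IPL G z1 w q S1 ∧ IPL G w zn j S2 ∧ Z = S1 ∪ S2 ∧
      (∀ u ∈ S1, G.Adj b2 u → u = w) := by
  obtain ⟨w, q, j, S1, S2, e, hw, g1, g2, hS, g3, g4, g5⟩ := hs.hZ.first _ t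
  refine ⟨w, q, j, S1, S2, e, ?_, hw, g1, g2, hS, g3⟩
  have hsub : ∀ v ∈ S1, v ∈ Z := by rw [hS]; exact fun v hv => Or.inl hv
  have ha2 := ha.2
  have haZ := hs.SA_notZ ha
  have hz := g1.left
  have hZC := hs.hZC
  have b2Z : b2 ∉ Z := fun h => u3 _ h h23.symm
  have b3Z : b3 ∉ Z := fun h => (hs.hZC _ h).1 c3
  have ne := h23.ne
  clear hS
  have qq := ((g1.cons ((ha.2 z1 hs.hZ.left).2 rfl) (by grind) (by grind)).snoc hw.symm
    (by grind) (by grind [G.adj_comm])).snoc h23 (by grind) (by grind [G.adj_comm])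
  have := hs.outer qq ha.1 c3 (by omega) (by grind)
  have := hs.nev
  omega

end Artemis

namespace Artemis
variable {V : Type*} {G : SimpleGraph V}
variable {T : Set V} {z1 zn : V} {n : ℕ} {Z : Set V}
variable {a b a1 a2 a3 b1 b2 b3 : V} {i j k2 k3 : ℕ} {A B P2 P3 : Set V}

theorem IPL.nbr {x y : V} {k : ℕ} {S : Set V} (h : IPL G x y k S) (hne : x ≠ y) {s : V} (hs : s ∈ S) :
    ∃ w ∈ S, G.Adj s w := by
  by_cases e : s = y
  · subst e
    obtain ⟨w, S2, g1, g2, -, g3, -⟩ := h.symm.tail hne.symm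
    exact ⟨w, by rw [g2]; exact Or.inr g1.left, g3⟩
  · obtain ⟨q, w', S1, S2, -, -, g2, g3, -, g4, -⟩ := h.cut hs e
    exact ⟨w', by rw [g3]; exact Or.inr g2.left, g4⟩

/-- minimal subpath of `Z` linking the rest of the gap with `B` -/
structure CoreD (G : SimpleGraph V) (Z A B P2 P3 : Set V) (u v : V) (k : ℕ) (S : Set V) : Prop where
  hS : IPL G u v k S
  hZ : ∀ s ∈ S, s ∈ Z
  pu : ∃ w, (w ∈ A ∨ w ∈ P2 ∨ w ∈ P3) ∧ G.Adj u w
  qv : ∃ w ∈ B, G.Adj v w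
  uu : ∀ s ∈ S, ∀ w, (w ∈ A ∨ w ∈ P2 ∨ w ∈ P3) → G.Adj s w → s = u
  uv : ∀ s ∈ S, ∀ w ∈ B, G.Adj s w → s = v

variable {u v : V} {k : ℕ} {S : Set V}

theorem CoreD.swap (c : CoreD G Z A B P2 P3 u v k S) : CoreD G Z A B P3 P2 u v k S :=
  ⟨c.hS, c.hZ, by obtain ⟨w, h, h'⟩ := c.pu; exact ⟨w, by tauto, h'⟩, c.qv,
    fun s hs w hw => c.uu s hs w (by tauto), c.uv⟩

theorem CoreD.disj (hs : Setting G T z1 zn n Z) (p : Pair G T z1 zn Z a b)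
    (d : GapD G a b a1 a2 a3 b1 b2 b3 i j k2 k3 A B P2 P3) (c : CoreD G Z A B P2 P3 u v k S) :
    ∀ s ∈ S, s ∉ A ∧ s ∉ P2 ∧ s ∉ P3 ∧ s ∉ B := by
  obtain ⟨t1, t2, t3⟩ := d.unt hs p
  obtain ⟨f1, f2, f3⟩ := d.f2 hs p
  have hZC : ∀ v ∈ Z, v ∉ Cs G T := fun v hv => (hs.hZC v hv).1
  have hzS := c.hZ
  obtain ⟨q1, q2⟩ := d.g.eAF
  obtain ⟨q3, q4⟩ := d.g.eA2
  obtain ⟨q7, q8⟩ := d.g.eF2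
  obtain ⟨q3', q4'⟩ := d.g.eA3
  obtain ⟨q7', q8'⟩ := d.g.eF3
  have m2 := d.g.h2.right
  have m3 := d.g.h3.right
  have b12 := d.g.b12
  have b13 := d.g.b13
  intro s hsS
  have key : ¬ (s ∈ A ∨ s ∈ P2 ∨ s ∈ P3) := by
    intro h
    have ht : ∃ w, (w ∈ A ∨ w ∈ P2 ∨ w ∈ P3) ∧ G.Adj s w := by
      obtain h | h | h := h
      · by_cases e : a = a1
        · subst e
          obtain ⟨e1, e2⟩ := (d.hA.zero_iff.2 rfl ▸ d.hA : IPL G a a 0 A).zero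
          rw [e2] at h
          obtain rfl : s = a := h
          exact ⟨a2, Or.inr (Or.inl d.g.h2.left), d.g.a12⟩
        · obtain ⟨w, h1, h2⟩ := d.hA.nbr e h
          exact ⟨w, Or.inl h1, h2⟩
      · obtain ⟨w, h1, h2⟩ := d.g.h2.nbr d.g.n2 h
        exact ⟨w, Or.inr (Or.inl h1), h2⟩
      · obtain ⟨w, h1, h2⟩ := d.g.h3.nbr d.g.n3 h
        exact ⟨w, Or.inr (Or.inr h1), h2⟩
    obtain ⟨w, hw, hw'⟩ := ht
    obtain rfl := c.uu s hsS w hw hw'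
    by_cases e : s = v
    · subst e
      obtain ⟨x, hx, hx'⟩ := c.qv
      have := hzS _ hsS
      obtain h | h | h := h
      · exact q2 _ h _ hx hx'
      · obtain ⟨rfl, rfl⟩ := q8 _ hx _ h hx'.symm
        have := hZC _ this
        grind [G.adj_comm]
      · obtain ⟨rfl, rfl⟩ := q8' _ hx _ h hx'.symm
        have := hZC _ this
        grind [G.adj_comm]
    · obtain ⟨x, hx, hx'⟩ := c.hS.nbr e hsS
      exact hx'.ne (c.uu x hx s h hx'.symm).symm
  refine ⟨fun h => key (by tauto), fun h => key (by tauto), fun h => key (by tauto), fun h => ?_⟩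
  obtain ⟨w, hw, hw'⟩ := d.hB.nbr d.hb h
  obtain rfl := c.uv s hsS w hw hw'
  by_cases e : u = s
  · subst e
    obtain ⟨x, hx, hx'⟩ := c.pu
    have := hZC _ (hzS _ hsS)
    obtain hx | hx | hx := hx
    · exact q2 _ hx _ h hx'.symm
    · obtain ⟨rfl, rfl⟩ := q8 _ h _ hx hx'
      exact t2 (by tauto) _ (hzS _ hsS) hx'.symm
    · obtain ⟨rfl, rfl⟩ := q8' _ h _ hx hx'
      exact t3 (by tauto) _ (hzS _ hsS) hx'.symm
  · obtain ⟨x, hx, hx'⟩ := c.hS.nbr e hsS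
    exact hx'.ne (c.uv x hx s h hx'.symm).symm

theorem CoreD.ext (hs : Setting G T z1 zn n Z) (p : Pair G T z1 zn Z a b)
    (d : GapD G a b a1 a2 a3 b1 b2 b3 i j k2 k3 A B P2 P3) (c : CoreD G Z A B P2 P3 u v k S) :
    ∃ F, GP G a1 a2 a3 b1 b2 b3 k2 k3 A P2 P3 F ∧ u ∉ F ∧ (∃ w ∈ F, G.Adj u w) ∧
      ∀ x ∈ F, x ∈ B ∨ (x ∈ S ∧ x ≠ u) := by
  have dj := c.disj hs p d
  by_cases e : u = v
  · subst e
    exact ⟨B, d.g, (dj u c.hS.left).2.2.2, c.qv, fun x hx => Or.inl hx⟩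
  obtain ⟨u', S', h1, hS, h2, h3, h4⟩ := c.hS.tail e
  obtain ⟨w, hw, hw'⟩ := c.qv
  have g := d.g
  have hS1 : ∀ x ∈ S', x ∈ S := by grind
  have hS2 : ∀ x ∈ S', x ≠ u := by grind
  have uu := c.uu
  have uB := (dj u c.hS.left).2.2.2
  clear hS
  refine ⟨S' ∪ B, ⟨h1.conn.union g.cF ⟨v, h1.right, w, hw, Or.inr hw'⟩, g.cA, Or.inr g.hb1, g.ha1, g.h2,
    g.h3, g.n2, g.n3, g.a12, g.a13, g.a23, g.b12, g.b13, g.b23, ?_, g.eA2, g.eA3, ?_, ?_, g.e23⟩, ?_,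
    ⟨u', Or.inl h1.left, h3⟩, ?_⟩
  · obtain ⟨q1, q2⟩ := g.eAF
    refine ⟨?_, ?_⟩
    · rintro x hx (h | h)
      · exact (dj x (hS1 x h)).1 hx
      · exact q1 x hx h
    · rintro x hx y (h | h) hxy
      · exact hS2 y h (uu y (hS1 y h) x (Or.inl hx) hxy.symm)
      · exact q2 x hx y h hxy
  · obtain ⟨q1, q2⟩ := g.eF2
    refine ⟨?_, ?_⟩
    · rintro x (h | h) hx
      · exact (dj x (hS1 x h)).2.1 hx
      · exact q1 x h hx
    · rintro x (h | h) y hy hxy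
      · exact (hS2 x h (uu x (hS1 x h) y (Or.inr (Or.inl hy)) hxy)).elim
      · exact q2 x h y hy hxy
  · obtain ⟨q1, q2⟩ := g.eF3
    refine ⟨?_, ?_⟩
    · rintro x (h | h) hx
      · exact (dj x (hS1 x h)).2.2.1 hx
      · exact q1 x h hx
    · rintro x (h | h) y hy hxy
      · exact (hS2 x h (uu x (hS1 x h) y (Or.inr (Or.inr hy)) hxy)).elim
      · exact q2 x h y hy hxy
  · rintro (h | h)
    · exact h2 h
    · exact uB h
  · rintro x (h | h)
    · exact Or.inr ⟨hS1 x h, hS2 x h⟩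
    · exact Or.inl h

theorem CoreD.core (hs : Setting G T z1 zn n Z) (p : Pair G T z1 zn Z a b)
    (d : GapD G a b a1 a2 a3 b1 b2 b3 i j k2 k3 A B P2 P3) (c : CoreD G Z A B P2 P3 u v k S) :
    ((∀ w ∈ A, ¬ G.Adj u w) ∧ G.Adj u b2 ∧ (∀ w ∈ P3, ¬ G.Adj u w)) ∨
    ((∀ w ∈ A, ¬ G.Adj u w) ∧ G.Adj u b3 ∧ (∀ w ∈ P2, ¬ G.Adj u w)) := by
  obtain ⟨F, g, uF, nF, -⟩ := c.ext hs p d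
  obtain ⟨d1, d2, d3, -⟩ := c.disj hs p d u c.hS.left
  obtain ⟨t1, t2, t3⟩ := d.unt hs p
  obtain ⟨f1, f2, f3⟩ := d.f2 hs p
  have huZ := c.hZ u c.hS.left
  obtain h | ⟨h1, h2, h3⟩ | ⟨h1, h2, h3⟩ | ⟨h1, h2, h3⟩ := g.main hs.hA uF d1 d2 d3 nF
  · exfalso
    unfold Two3 at h
    have t1' : b1 ∈ Cs G T → ¬ G.Adj u b1 := fun h e => t1 h u huZ e.symm
    have t2' : b2 ∈ Cs G T → ¬ G.Adj u b2 := fun h e => t2 h u huZ e.symm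
    have t3' : b3 ∈ Cs G T → ¬ G.Adj u b3 := fun h e => t3 h u huZ e.symm
    clear t1 t2 t3 nF uF g huZ
    grind
  · obtain ⟨w, hw, hw'⟩ := c.pu
    obtain hw | hw | hw := hw
    · exact (h1 w hw hw').elim
    · exact (h2 w hw hw').elim
    · exact (h3 w hw hw').elim
  · exact Or.inl ⟨h1, h2, h3⟩
  · exact Or.inr ⟨h1, h3, h2⟩

theorem CoreD.exists (hs : Setting G T z1 zn n Z) (p : Pair G T z1 zn Z a b)
    (d : GapD G a b a1 a2 a3 b1 b2 b3 i j k2 k3 A B P2 P3) : ∃ u v k S, CoreD G Z A B P2 P3 u v k S := by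
  obtain ⟨u, v, k, S, h1, h2, h3, h4, h5, h6⟩ := hs.hZ.conn.path hs.hZ.left hs.hZ.right
    (fun s => ∃ w, (w ∈ A ∨ w ∈ P2 ∨ w ∈ P3) ∧ G.Adj s w) (fun s => ∃ w ∈ B, G.Adj s w)
    ⟨a, Or.inl d.hA.left, ((p.ha.2 z1 hs.hZ.left).2 rfl).symm⟩
    ⟨b, d.hB.left, ((p.hb.2 zn hs.hZ.right).2 rfl).symm⟩
  exact ⟨u, v, k, S, h1, h2, h3, h4, fun s hs w hw e => h5 s hs ⟨w, hw, e⟩,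
    fun s hs w hw e => h6 s hs ⟨w, hw, e⟩⟩

set_option maxHeartbeats 2000000 in
theorem CoreD.false2 (hs : Setting G T z1 zn n Z) (p : Pair G T z1 zn Z a b)
    (d : GapD G a b a1 a2 a3 b1 b2 b3 i j k2 k3 A B P2 P3) (c : CoreD G Z A B P2 P3 u v k S)
    (hu : G.Adj u b2) (nA : ∀ w ∈ A, ¬ G.Adj u w) : False := by
  obtain ⟨F, g, uF, nF, hF⟩ := c.ext hs p d
  have dj := c.disj hs p d
  obtain ⟨t1, t2, t3⟩ := d.unt hs p
  obtain ⟨f1, f2, f3⟩ := d.f2 hs p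
  have huZ := c.hZ u c.hS.left
  have c2 : b2 ∉ Cs G T := fun h => t2 h u huZ hu.symm
  have c1 : b1 ∈ Cs G T := by tauto
  have c3 : b3 ∈ Cs G T := by tauto
  obtain ⟨x1, x2, x3, x4, x5⟩ := d.nadj
  obtain ⟨-, y2, y3, y4, y5⟩ := d.swap.nadj
  obtain ⟨w, q, r, S1, S2, e1, e2, e3, g1, g2, hS, g3⟩ := hs.reach p.ha x2 y2 x4 y4 g.b23 c2 c3 (t3 c3)
    ⟨u, huZ, hu.symm⟩
  obtain ⟨w', q', r', S1', S2', e1', e2', e3', g1', g2', hS', g3'⟩ :=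
    hs.symm.reach p.hb x3 y3 x5 y5 g.b23 c2 c3 (t3 c3) ⟨u, huZ, hu.symm⟩
  have n2 := hs.n2
  obtain rfl : r = 1 := by omega
  obtain rfl : r' = 1 := by omega
  have q1 := g2.one
  have q2 := g2'.one
  have hww : w' = w ∧ n = 2 := by
    have hm : w' ∈ S1 ∪ S2 := hS ▸ (hS' ▸ Or.inl g1'.right)
    have ad := g2'.one_iff.1 rfl
    have hq : w' ≠ zn := by
      rintro rfl
      have := g1'.zero_iff.2 rfl
      omega
    have e : w' = w := by
      obtain h | h := hm
      · exact g3 _ h e3'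
      · rw [q1] at h
        exact h.resolve_right hq
    subst e
    have := g1.one_iff.2 ad.symm
    exact ⟨rfl, by omega⟩
  obtain ⟨rfl, rfl⟩ := hww
  obtain rfl : q = 1 := by omega
  obtain rfl : q' = 1 := by omega
  have s1 := g1.one
  have s1' := g1'.one
  have ad1 := g1.one_iff.1 rfl
  have ad2 := g1'.one_iff.1 rfl
  have z1b2 : ¬ G.Adj b2 z1 := fun h => ad1.ne (g3 _ g1.left h)
  have znb2 : ¬ G.Adj b2 zn := fun h => ad2.ne (g3' _ g1'.left h)
  have z1zn : ¬ G.Adj z1 zn := fun h => by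
    have := hs.hZ.one_iff.2 h
    omega
  have hZ : ∀ x ∈ Z, x = z1 ∨ x = w' ∨ x = zn := by
    intro x hx
    rw [hS, s1, q1] at hx
    grind
  obtain rfl : u = w' := by
    obtain rfl | h | rfl := hZ u huZ
    · exact (z1b2 hu.symm).elim
    · exact h
    · exact (znb2 hu.symm).elim
  have z1a := ((p.ha.2 z1 hs.hZ.left).2 rfl).symm
  have z1A := d.hA.left
  have z1B : ∀ x ∈ B, ¬ G.Adj z1 x := by
    intro x hx hxa
    have c' : CoreD G Z A B P2 P3 z1 z1 0 {z1} := ⟨IPL.single G z1, by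
      rintro s rfl; exact hs.hZ.left, ⟨a, Or.inl z1A, z1a⟩, ⟨x, hx, hxa⟩, fun s hs _ _ _ => hs,
      fun s hs _ _ _ => hs⟩
    obtain ⟨h, -⟩ | ⟨h, -⟩ := c'.core hs p d
    · exact h a z1A z1a
    · exact h a z1A z1a
  have z1nB : z1 ∉ B := by
    intro h
    obtain ⟨x, hx, hx'⟩ := d.hB.nbr d.hb h
    exact z1B x hx hx'
  have z1S : z1 ∉ S := fun h => ad1.ne (c.uu z1 h a (Or.inl z1A) z1a)
  have z1nF : z1 ∉ F := fun h => (hF _ h).elim z1nB (fun h => z1S h.1)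
  have z1F : ∀ x ∈ F, ¬ G.Adj z1 x := by
    intro x hx hxa
    obtain h | ⟨h, h'⟩ := hF x hx
    · exact z1B x h hxa
    · obtain rfl | h | rfl := hZ x (c.hZ x h)
      · exact hxa.ne rfl
      · exact h' h
      · exact z1zn hxa
  obtain ⟨d1, d2, d3, -⟩ := dj u c.hS.left
  have z1b2n : z1 ≠ b2 := by
    rintro rfl
    exact z1B _ d.g.hb1 d.g.b12.symm
  obtain ⟨r1, r2⟩ := g.eAF
  obtain ⟨r3, r4⟩ := g.eA2
  obtain ⟨r7, r8⟩ := g.eF2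
  obtain ⟨r7', r8'⟩ := g.eF3
  obtain ⟨r9, r10⟩ := g.e23
  have m2 := g.h2.right
  have nn := g.n2
  have hb2F : b2 ∉ F := fun h => r7 _ h m2
  have res := hs.hA.sp (Conn.single G b2) g.cF
    ((g.cA.union g.h3.conn ⟨a1, g.ha1, a3, g.h3.left, Or.inr g.a13⟩).ins (x := z1) ⟨a, Or.inl z1A, z1a⟩)
    rfl g.hb1 (Or.inr (Or.inr g.h3.right)) g.b12.symm g.b13 g.b23 (t := u)
    ⟨by rintro x rfl; exact hb2F, by rintro x rfl y hy hxy; exact ⟨rfl, (r8 y hy _ m2 hxy.symm).1⟩⟩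
    ⟨by
      rintro x rfl (h | h | h)
      · exact z1b2n h.symm
      · exact r3 _ h m2
      · exact r9 _ m2 h, by
      rintro x rfl y (rfl | h | h) hxy
      · exact (z1b2 hxy).elim
      · exact (nn (r4 y h _ m2 hxy.symm).2.symm).elim
      · obtain ⟨h1, h2⟩ | ⟨h1, h2⟩ := r10 _ m2 _ h hxy
        · exact (nn h1.symm).elim
        · exact ⟨rfl, h2⟩⟩
    ⟨by
      rintro x hx (h | h | h)
      · exact z1nF (h ▸ hx)
      · exact r1 _ h hx
      · exact r7' _ hx h, by
      rintro x hx y (rfl | h | h) hxy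
      · exact (z1F x hx hxy.symm).elim
      · exact (r2 y h x hx hxy.symm).elim
      · exact r8' _ hx _ h hxy⟩
    (fun h => hu.ne h) uF (by
      rintro (h | h | h)
      · exact ad1.ne h.symm
      · exact d1 h
      · exact d3 h) ⟨b2, rfl, hu⟩ nF ⟨z1, Or.inl rfl, ad1.symm⟩
  have t1' : ¬ G.Adj u b1 := fun e => t1 c1 u huZ e.symm
  have t3' : ¬ G.Adj u b3 := fun e => t3 c3 u huZ e.symm
  tauto

theorem Pair.noGap (hs : Setting G T z1 zn n Z) (p : Pair G T z1 zn Z a b) : ¬ Gap G a b := by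
  rintro ⟨a1, a2, a3, b1, b2, b3, i, j, k2, k3, A, B, P2, P3, d⟩
  obtain ⟨u, v, k, S, c⟩ := CoreD.exists hs p d
  obtain ⟨h1, h2, -⟩ | ⟨h1, h2, -⟩ := c.core hs p d
  · exact c.false2 hs p d h2 h1
  · exact c.swap.false2 hs p d.swap h2 h1

end Artemis

namespace Artemis
universe uu

section transport
variable {V W : Type*} {G : SimpleGraph V} {H : SimpleGraph W} {f : W → V}

theorem IPL.map (hf : Function.Injective f) {x y : W} {k : ℕ} {S : Set W} (h : IPL H x y k S)
    (hadj : ∀ u ∈ S, ∀ v ∈ S, (G.Adj (f u) (f v) ↔ H.Adj u v)) : IPL G (f x) (f y) k (f '' S) := by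
  obtain ⟨p, hp, rfl, rfl, rfl⟩ := h
  refine ⟨fun i => f (p i), fun i j hij hj => ⟨fun e => (hp i j hij hj).1 (hf e), ?_⟩, rfl, rfl, ?_⟩
  · rw [hadj _ ⟨i, by omega, rfl⟩ _ ⟨j, by omega, rfl⟩]
    exact (hp i j hij hj).2
  · ext v
    constructor
    · rintro ⟨_, ⟨i, hi, rfl⟩, rfl⟩
      exact ⟨i, hi, rfl⟩
    · rintro ⟨i, hi, rfl⟩
      exact ⟨_, ⟨i, hi, rfl⟩, rfl⟩

theorem IPL.lift (hf : Function.Injective f) {x y : W} {k : ℕ} {S : Set V}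
    (h : IPL G (f x) (f y) k S) (hS : ∀ v ∈ S, ∃ w, f w = v)
    (hadj : ∀ u v, f u ∈ S → f v ∈ S → (G.Adj (f u) (f v) ↔ H.Adj u v)) : IPL H x y k (f ⁻¹' S) := by
  obtain ⟨p, hp, h0, hk, rfl⟩ := h
  have : ∀ i, ∃ w, i ≤ k → f w = p i := by
    intro i
    by_cases hi : i ≤ k
    · obtain ⟨w, hw⟩ := hS (p i) ⟨i, hi, rfl⟩
      exact ⟨w, fun _ => hw⟩
    · exact ⟨x, fun h => (hi h).elim⟩
  choose q hq using this
  refine ⟨q, fun i j hij hj => ⟨fun e => (hp i j hij hj).1 ?_, ?_⟩, hf ?_, hf ?_, ?_⟩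
  · rw [← hq i (by omega), ← hq j hj, e]
  · rw [← hadj _ _ ⟨i, by omega, (hq i (by omega)).symm⟩ ⟨j, hj, (hq j hj).symm⟩, hq i (by omega), hq j hj]
    exact (hp i j hij hj).2
  · rw [hq 0 (by omega), h0]
  · rw [hq k le_rfl, hk]
  · ext v
    constructor
    · rintro ⟨i, hi, h⟩
      exact ⟨i, hi, hf (by rw [hq i hi, h])⟩
    · rintro ⟨i, hi, rfl⟩
      exact ⟨i, hi, (hq i hi).symm⟩

theorem HoleF.map (hf : Function.Injective f) {p : ℕ → W} {k : ℕ} (h : HoleF H p k)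
    (hadj : ∀ i j, i < j → j ≤ k → (G.Adj (f (p i)) (f (p j)) ↔ H.Adj (p i) (p j))) :
    HoleF G (fun i => f (p i)) k := by
  obtain ⟨h3, hp⟩ := h
  exact ⟨h3, fun i j hij hj => ⟨fun e => (hp i j hij hj).1 (hf e), by
    rw [hadj i j hij hj]; exact (hp i j hij hj).2⟩⟩

theorem TwoE.map (hf : Function.Injective f) {a b c d : W} {S R : Set W} (h : TwoE H a b c d S R)
    (hadj : ∀ u ∈ S, ∀ v ∈ R, (G.Adj (f u) (f v) ↔ H.Adj u v)) :
    TwoE G (f a) (f b) (f c) (f d) (f '' S) (f '' R) := by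
  obtain ⟨h1, h2⟩ := h
  refine ⟨?_, ?_⟩
  · rintro _ ⟨u, hu, rfl⟩ ⟨v, hv, e⟩
    exact h1 u hu (hf e ▸ hv)
  · rintro _ ⟨u, hu, rfl⟩ _ ⟨v, hv, rfl⟩ e
    obtain ⟨rfl, rfl⟩ | ⟨rfl, rfl⟩ := h2 u hu v hv ((hadj u hu v hv).1 e)
    · exact Or.inl ⟨rfl, rfl⟩
    · exact Or.inr ⟨rfl, rfl⟩

theorem AF.induce (hA : AF G) (C : Set V) : AF (G.induce C) := by
  have hf : Function.Injective (Subtype.val : C → V) := Subtype.val_injective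
  refine ⟨fun p k hp => hA.hole _ _ (hp.map hf fun _ _ _ _ => Iff.rfl), fun p k hp =>
    hA.anti _ _ (hp.map hf fun i j hij hj => ?_), ?_⟩
  · have := (hp.2 i j hij hj).1
    simp only [compl_adj, comap_adj, Function.Embedding.subtype_apply]
    simp [Subtype.val_inj]
  · rintro ⟨a1, a2, a3, b1, b2, b3, k1, k2, k3, S1, S2, S3, h1, h2, h3, e1, e2, e3, e4, e5, e6, n1, n2,
      n3, t1, t2, t3⟩
    exact hA.prism ⟨a1, a2, a3, b1, b2, b3, k1, k2, k3, _, _, _, h1.map hf fun _ _ _ _ => Iff.rfl,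
      h2.map hf fun _ _ _ _ => Iff.rfl, h3.map hf fun _ _ _ _ => Iff.rfl, e1, e2, e3, e4, e5, e6,
      fun e => n1 (hf e), fun e => n2 (hf e), fun e => n3 (hf e), t1.map hf fun _ _ _ _ => Iff.rfl,
      t2.map hf fun _ _ _ _ => Iff.rfl, t3.map hf fun _ _ _ _ => Iff.rfl⟩

theorem OneE.lift {C : Set V} {a b : C} {S R : Set V} (h : OneE G a b S R) :
    OneE (G.induce C) a b (Subtype.val ⁻¹' S) (Subtype.val ⁻¹' R) :=
  ⟨fun u hu hv => h.1 u hu hv, fun u hu v hv e => by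
    obtain ⟨h1, h2⟩ := h.2 u hu v hv e
    exact ⟨Subtype.ext h1, Subtype.ext h2⟩⟩

theorem GapD.lift {C : Set V} {a b a1 a2 a3 b1 b2 b3 : V} {i j k2 k3 : ℕ} {A B P2 P3 : Set V}
    (d : GapD G a b a1 a2 a3 b1 b2 b3 i j k2 k3 A B P2 P3) (hA : ∀ v ∈ A, v ∈ C) (hB : ∀ v ∈ B, v ∈ C)
    (h2 : ∀ v ∈ P2, v ∈ C) (h3 : ∀ v ∈ P3, v ∈ C) (ha : a ∈ C) (hb : b ∈ C) :
    Gap (G.induce C) ⟨a, ha⟩ ⟨b, hb⟩ := by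
  have hf : Function.Injective (Subtype.val : C → V) := Subtype.val_injective
  have g := d.g
  have i1 : IPL (G.induce C) ⟨a, ha⟩ ⟨a1, hA _ g.ha1⟩ i (Subtype.val ⁻¹' A) :=
    IPL.lift hf d.hA (fun v hv => ⟨⟨v, hA v hv⟩, rfl⟩) fun _ _ _ _ => Iff.rfl
  have i2 : IPL (G.induce C) ⟨b, hb⟩ ⟨b1, hB _ g.hb1⟩ j (Subtype.val ⁻¹' B) :=
    IPL.lift hf d.hB (fun v hv => ⟨⟨v, hB v hv⟩, rfl⟩) fun _ _ _ _ => Iff.rfl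
  have i3 : IPL (G.induce C) ⟨a2, h2 _ g.h2.left⟩ ⟨b2, h2 _ g.h2.right⟩ k2 (Subtype.val ⁻¹' P2) :=
    IPL.lift hf g.h2 (fun v hv => ⟨⟨v, h2 v hv⟩, rfl⟩) fun _ _ _ _ => Iff.rfl
  have i4 : IPL (G.induce C) ⟨a3, h3 _ g.h3.left⟩ ⟨b3, h3 _ g.h3.right⟩ k3 (Subtype.val ⁻¹' P3) :=
    IPL.lift hf g.h3 (fun v hv => ⟨⟨v, h3 v hv⟩, rfl⟩) fun _ _ _ _ => Iff.rfl
  refine ⟨_, _, _, _, _, _, i, j, k2, k3, _, _, _, _, i1, i2, fun e => d.hb (congrArg Subtype.val e),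
    ⟨i2.conn, i1.conn, g.hb1, g.ha1, i3, i4, fun e => g.n2 (congrArg Subtype.val e),
    fun e => g.n3 (congrArg Subtype.val e), g.a12, g.a13, g.a23, g.b12, g.b13, g.b23, ?_, OneE.lift g.eA2,
    OneE.lift g.eA3, OneE.lift g.eF2, OneE.lift g.eF3, ?_⟩⟩
  · exact ⟨fun u hu hv => g.eAF.1 u hu hv, fun u hu v hv e => g.eAF.2 u hu v hv e⟩
  · refine ⟨fun u hu hv => g.e23.1 u hu hv, fun u hu v hv e => ?_⟩
    obtain ⟨e1, e2⟩ | ⟨e1, e2⟩ := g.e23.2 u hu v hv e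
    · exact Or.inl ⟨Subtype.ext e1, Subtype.ext e2⟩
    · exact Or.inr ⟨Subtype.ext e1, Subtype.ext e2⟩

end transport

section main
variable {V : Type uu} {G : SimpleGraph V}

/-- interesting sets -/
def Intr (G : SimpleGraph V) (T : Set V) : Prop :=
  T.Nonempty ∧ Conn Gᶜ T ∧ ∃ x ∈ Cs G T, ∃ y ∈ Cs G T, x ≠ y ∧ ¬ G.Adj x y

/-- outer paths -/
def Outer (G : SimpleGraph V) (T : Set V) (k : ℕ) : Prop :=
  ∃ x y S, IPL G x y k S ∧ x ∈ Cs G T ∧ y ∈ Cs G T ∧ 2 ≤ k ∧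
    (∀ v ∈ S, v ∈ Cs G T → v = x ∨ v = y) ∧ (∀ v ∈ S, v ∉ T)

/-- the property of the pair to be found -/
def Good (G : SimpleGraph V) (x y : V) : Prop :=
  x ≠ y ∧ ¬ G.Adj x y ∧ (∀ k S, IPL G x y k S → k % 2 = 0) ∧ ¬ Gap G x y ∧ ¬ Gap G y x

theorem Intr.of_ipl {x y : V} {k : ℕ} {S : Set V} (h : IPL G x y k S) (hk : 2 ≤ k) : ∃ T, Intr G T := by
  obtain ⟨p, hp, rfl, rfl, rfl⟩ := h
  refine ⟨{p 1}, ⟨p 1, rfl⟩, Conn.single _ _, p 0, ?_, p 2, ?_, (hp 0 2 (by omega) hk).1, ?_⟩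
  · rintro t rfl
    exact (hp 0 1 (by omega) (by omega)).2.2 rfl
  · rintro t rfl
    exact ((hp 1 2 (by omega) (by omega)).2.2 rfl).symm
  · intro e
    have := (hp 0 2 (by omega) hk).2.1 e
    omega

theorem good_none (h : ¬ ∃ T, Intr G T) {x y : V} (hne : x ≠ y) (hna : ¬ G.Adj x y) : Good G x y := by
  have key : ∀ {x y k S}, IPL G x y k S → ¬ 2 ≤ k := fun h' h2 => h (Intr.of_ipl h' h2)
  refine ⟨hne, hna, fun k S hS => ?_, ?_, ?_⟩
  · have h0 : k ≠ 0 := fun e => hne (hS.zero_iff.1 e)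
    have h1 : k ≠ 1 := fun e => hna (hS.one_iff.1 e)
    exact (key hS (by omega)).elim
  · rintro ⟨a1, a2, a3, b1, b2, b3, i, j, k2, k3, A, B, P2, P3, d⟩
    obtain ⟨k, h1, h2⟩ := d.path
    exact key h2 (by omega)
  · rintro ⟨a1, a2, a3, b1, b2, b3, i, j, k2, k3, A, B, P2, P3, d⟩
    obtain ⟨k, h1, h2⟩ := d.path
    exact key h2 (by omega)

theorem Base.of_max [Finite V] (hA : AF G) {T : Set V} (hT : Intr G T)
    (hmax : ∀ T', Intr G T' → T ⊆ T' → T' ⊆ T) : Base G T := by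
  refine ⟨hA, hT.1, hT.2.1, hA.rr hT.1 hT.2.1, ?_⟩
  intro u huT huC v hv w hw huv huw hne
  by_contra hna
  refine huT (hmax (insert u T) ⟨⟨u, Or.inl rfl⟩, hT.2.1.ins ?_, v, ?_, w, ?_, hne, hna⟩
    (fun t ht => Or.inr ht) (Or.inl rfl))
  · by_contra hcon
    refine huC fun t ht => ?_
    by_contra hut
    exact hcon ⟨t, ht, by rw [compl_adj]; exact ⟨fun e => huT (e ▸ ht), hut⟩⟩
  · rintro t (rfl | ht)
    · exact huv.symm
    · exact hv t ht
  · rintro t (rfl | ht)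
    · exact huw.symm
    · exact hw t ht

theorem inside {T : Set V} (h : ∀ k, ¬ Outer G T k) {x y : V} {k : ℕ} {S : Set V} (hS : IPL G x y k S)
    (hx : x ∈ Cs G T) (hy : y ∈ Cs G T) (hk : 3 ≤ k) : ∀ v ∈ S, v ∈ Cs G T := by
  have nT := notT hS hx hy hk
  obtain ⟨p, hp, rfl, rfl, rfl⟩ := hS
  rintro _ ⟨m, hm, rfl⟩
  by_contra hmC
  obtain ⟨i, hi, hiC, imax⟩ := exists_max (Q := fun i => p i ∈ Cs G T) (h := m) ⟨0, by omega, hx⟩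
  obtain ⟨j, ⟨hj, hjk, hjC⟩, jmin⟩ := exists_min (Q := fun j => m ≤ j ∧ j ≤ k ∧ p j ∈ Cs G T)
    ⟨k, hm, le_rfl, hy⟩
  have him : i ≠ m := fun e => hmC (e ▸ hiC)
  have hjm : j ≠ m := fun e => hmC (e ▸ hjC)
  refine h (j - i) ⟨p i, p j, _, hp.ipl (by omega) hjk, hiC, hjC, by omega, ?_, ?_⟩
  · rintro _ ⟨l, h1, h2, rfl⟩ hl
    by_cases e : l ≤ m
    · have := imax l e hl
      left; congr 1; omega
    · have := jmin l ⟨by omega, by omega, hl⟩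
      right; congr 1; omega
  · rintro _ ⟨l, h1, h2, rfl⟩
    exact nT _ ⟨l, by omega, rfl⟩

theorem GapD.inside {T : Set V} (h : ∀ k, ¬ Outer G T k) {x y : V} (hx : x ∈ Cs G T) (hy : y ∈ Cs G T)
    (hg : Gap G x y) : Gap (G.induce (Cs G T)) ⟨x, hx⟩ ⟨y, hy⟩ := by
  obtain ⟨a1, a2, a3, b1, b2, b3, i, j, k2, k3, A, B, P2, P3, d⟩ := hg
  obtain ⟨k, h1, h2⟩ := d.path
  obtain ⟨k', h1', h2'⟩ := d.swap.path
  have i1 := Artemis.inside h h2 hx hy (by omega)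
  have i2 := Artemis.inside h h2' hx hy (by omega)
  exact d.lift (fun v hv => i1 v (Or.inl (Or.inl hv))) (fun v hv => i1 v (Or.inr hv))
    (fun v hv => i1 v (Or.inl (Or.inr hv))) (fun v hv => i2 v (Or.inl (Or.inr hv))) hx hy

theorem Setting.of_outer {T : Set V} (hB : Base G T) {N : ℕ} (hN : Outer G T N)
    (hmin : ∀ k, Outer G T k → N ≤ k) : ∃ z1 zn n Z, Setting G T z1 zn n Z := by
  obtain ⟨x, y, S, hS, hx, hy, h2, hC, hT⟩ := hN
  have hev : N % 2 = 0 := Nat.even_iff.1 (hB.rr x y N S hS hx hy hC (by omega))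
  obtain ⟨p, hp, rfl, rfl, rfl⟩ := hS
  have notC : ∀ i, 1 ≤ i → i + 1 ≤ N → p i ∉ Cs G T := by
    intro i h1 h2 h
    obtain e | e := hC (p i) ⟨i, by omega, rfl⟩ h
    · exact (hp 0 i (by omega) (by omega)).1 e.symm
    · exact (hp i N (by omega) (by omega)).1 e
  have hN2 : N ≠ 2 := by
    rintro rfl
    have := hB.hmax (p 1) (hT _ ⟨1, by omega, rfl⟩) (notC 1 (by omega) (by omega)) _ hx _ hy
      ((hp 0 1 (by omega) (by omega)).2.2 rfl).symm ((hp 1 2 (by omega) (by omega)).2.2 rfl)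
      (hp 0 2 (by omega) (by omega)).1
    have := (hp 0 2 (by omega) (by omega)).2.1 this
    omega
  have hz := hp.ipl (a := 1) (b := N - 1) (by omega) (by omega)
  refine ⟨_, _, _, _, { hB with hZ := hz, n2 := by omega, nev := by omega, hZC := ?_, hAne := ⟨p 0, hx, ?_⟩, hBne := ⟨p N, hy, ?_⟩, hshort := ?_ }⟩
  · rintro _ ⟨i, h1, h2, rfl⟩
    exact ⟨notC i h1 (by omega), hT _ ⟨i, by omega, rfl⟩⟩
  · rintro _ ⟨i, h1, h2, rfl⟩
    rw [(hp 0 i (by omega) (by omega)).2]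
    constructor
    · rintro rfl; rfl
    · intro e
      by_contra hne
      exact (hp 1 i (by omega) (by omega)).1 e.symm
  · rintro _ ⟨i, h1, h2, rfl⟩
    rw [G.adj_comm, (hp i N (by omega) (by omega)).2]
    constructor
    · rintro rfl; rfl
    · intro e
      by_contra hne
      exact (hp i (N - 1) (by omega) (by omega)).1 e
  · intro x y k S h1 h2 h3 h4 h5 h6
    have := hmin k ⟨x, y, S, h1, h2, h3, h4, h5, h6⟩
    omega

theorem good_pair (n : ℕ) : ∀ (V : Type uu) (_ : Finite V) (G : SimpleGraph V), Nat.card V = n → AF G →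
    (∃ x y, x ≠ y ∧ ¬ G.Adj x y) → ∃ x y, Good G x y := by
  induction n using Nat.strong_induction_on with
  | _ n ih =>
  intro V _ G hn hA hne
  by_cases hI : ∃ T, Intr G T
  swap
  · obtain ⟨x, y, h1, h2⟩ := hne
    exact ⟨x, y, good_none hI h1 h2⟩
  obtain ⟨T, hT⟩ := (Set.toFinite {T : Set V | Intr G T}).exists_maximal hI
  have hTI : Intr G T := hT.1
  have hB := Base.of_max hA hTI (fun T' h1 h2 => hT.2 h1 h2)
  by_cases hO : ∃ k, Outer G T k
  · obtain ⟨N, hN, hmin⟩ := exists_min hO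
    obtain ⟨z1, zn, n, Z, hs⟩ := Setting.of_outer hB hN hmin
    obtain ⟨a, b, p⟩ := hs.pair
    exact ⟨a, b, hs.ab_ne p.ha p.hb, hs.ab_nadj p.ha p.hb, fun k S h => p.even hs h, p.noGap hs,
      p.symm.noGap hs.symm⟩
  · push Not at hO
    obtain ⟨t, ht⟩ := hTI.1
    obtain ⟨x0, hx0, y0, hy0, hne0, hna0⟩ := hTI.2.2
    have hcard : Nat.card (Cs G T) < n := by
      rw [Nat.card_coe_set_eq, ← hn, ← Set.ncard_univ V]
      refine Set.ncard_lt_ncard ?_ (Set.toFinite _)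
      rw [Set.ssubset_univ_iff]
      intro e
      exact Cs.notMem (e ▸ Set.mem_univ t : t ∈ Cs G T) ht
    obtain ⟨⟨x, hx⟩, ⟨y, hy⟩, g1, g2, g3, g4, g5⟩ := ih _ hcard (Cs G T) inferInstance (G.induce (Cs G T)) rfl
      (hA.induce _) ⟨⟨x0, hx0⟩, ⟨y0, hy0⟩, fun e => hne0 (congrArg Subtype.val e), hna0⟩
    have hxy : x ≠ y := fun e => g1 (Subtype.ext e)
    refine ⟨x, y, hxy, g2, fun k S hS => ?_, fun h => g4 (GapD.inside hO hx hy h),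
      fun h => g5 (GapD.inside hO hy hx h)⟩
    have h0 : k ≠ 0 := fun e => hxy (hS.zero_iff.1 e)
    have h1 : k ≠ 1 := fun e => g2 (hS.one_iff.1 e)
    by_cases hk : k = 2
    · omega
    · have hi := inside hO hS hx hy (by omega)
      exact g3 k _ (IPL.lift (x := ⟨x, hx⟩) (y := ⟨y, hy⟩) Subtype.val_injective hS (fun v hv => ⟨⟨v, hi v hv⟩, rfl⟩)
        fun _ _ _ _ => Iff.rfl)

end main
end Artemis

namespace Artemis
variable {V : Type*} {G : SimpleGraph V} {x y : V}

theorem Good.symm (h : Good G x y) : Good G y x :=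
  ⟨h.1.symm, fun e => h.2.1 e.symm, fun k S hS => h.2.2.1 k S hS.symm, h.2.2.2.2, h.2.2.2.1⟩

theorem cp_adj (hxy : x ≠ y) {u v : {v : V // v ≠ y}} (hu : u ≠ ⟨x, hxy⟩) (hv : v ≠ ⟨x, hxy⟩) :
    G.Adj u.1 v.1 ↔ (contractPair G x y).Adj u v := by
  have hu' : u.1 ≠ x := fun e => hu (Subtype.ext e)
  have hv' : v.1 ≠ x := fun e => hv (Subtype.ext e)
  unfold contractPair
  rw [fromRel_adj]
  constructor
  · intro h
    exact ⟨fun e => h.ne (congrArg Subtype.val e), Or.inl (Or.inl h)⟩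
  · rintro ⟨-, (h | h | h) | (h | h | h)⟩
    · exact h
    · exact (hu' h.1).elim
    · exact (hv' h.1).elim
    · exact h.symm
    · exact (hv' h.1).elim
    · exact (hu' h.1).elim

theorem cp_adjX (hxy : x ≠ y) {v : {v : V // v ≠ y}} (hv : v ≠ ⟨x, hxy⟩) :
    (contractPair G x y).Adj ⟨x, hxy⟩ v ↔ (G.Adj x v.1 ∨ G.Adj y v.1) := by
  have hv' : v.1 ≠ x := fun e => hv (Subtype.ext e)
  unfold contractPair
  rw [fromRel_adj]
  constructor
  · rintro ⟨-, (h | h | h) | (h | h | h)⟩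
    · exact Or.inl h
    · exact Or.inr h.2
    · exact (hv' h.1).elim
    · exact Or.inl h.symm
    · exact (hv' h.1).elim
    · exact Or.inr h.2.symm
  · rintro (h | h)
    · exact ⟨hv.symm, Or.inl (Or.inl h)⟩
    · exact ⟨hv.symm, Or.inl (Or.inr (Or.inl ⟨rfl, h⟩))⟩

theorem HoleF.rot {p : ℕ → V} {k : ℕ} (h : HoleF G p k) :
    HoleF G (fun j => if j < k then p (j + 1) else p 0) k := by
  obtain ⟨h3, hp⟩ := h
  refine ⟨h3, fun i j hij hj => ?_⟩
  have hi : i < k := by omega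
  simp only [hi, if_true]
  by_cases e : j < k
  · simp only [e, if_true]
    refine ⟨(hp (i + 1) (j + 1) (by omega) (by omega)).1, ?_⟩
    rw [(hp (i + 1) (j + 1) (by omega) (by omega)).2]
    omega
  · simp only [e, if_false]
    refine ⟨(hp 0 (i + 1) (by omega) (by omega)).1.symm, ?_⟩
    rw [G.adj_comm, (hp 0 (i + 1) (by omega) (by omega)).2]
    omega

theorem HoleF.rotTo {p : ℕ → V} {k i : ℕ} (h : HoleF G p k) (hi : i ≤ k) :
    ∃ q, HoleF G q k ∧ q 0 = p i := by
  induction i generalizing p with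
  | zero => exact ⟨p, h, rfl⟩
  | succ i ih =>
    obtain ⟨q, h1, h2⟩ := ih h.rot (by omega)
    refine ⟨q, h1, ?_⟩
    rw [h2]
    simp only [show i < k by omega, if_true]

theorem cp_hole (hA : AF G) (hg : Good G x y) {p : ℕ → {v : V // v ≠ y}} {k : ℕ}
    (h : HoleF (contractPair G x y) p k) : Odd k := by
  have hxy := hg.1
  by_cases hX : ∃ i, i ≤ k ∧ p i = ⟨x, hxy⟩
  swap
  · refine hA.hole _ _ (h.map Subtype.val_injective fun i j hij hj => cp_adj hxy ?_ ?_)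
    · exact fun e => hX ⟨i, by omega, e⟩
    · exact fun e => hX ⟨j, by omega, e⟩
  obtain ⟨i, hi, hX⟩ := hX
  obtain ⟨q, hq, h0⟩ := h.rotTo hi
  rw [hX] at h0
  clear hX hi h p i
  obtain ⟨k3, hp⟩ := hq
  have nX : ∀ i, 1 ≤ i → i ≤ k → q i ≠ ⟨x, hxy⟩ := fun i h1 h2 e =>
    (hp 0 i (by omega) h2).1 (by rw [h0, e])
  have hS : IPL G (q 1).1 (q k).1 (k - 1) {v | ∃ i, 1 ≤ i ∧ i ≤ k ∧ (q i).1 = v} := by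
    have : IsIP G (fun i => (q (i + 1)).1) (k - 1) := by
      intro i j hij hj
      refine ⟨fun e => (hp (i + 1) (j + 1) (by omega) (by omega)).1 (Subtype.ext e), ?_⟩
      rw [cp_adj hxy (nX _ (by omega) (by omega)) (nX _ (by omega) (by omega)),
        (hp (i + 1) (j + 1) (by omega) (by omega)).2]
      omega
    refine ⟨_, this, rfl, ?_, ?_⟩
    · simp only [show k - 1 + 1 = k by omega]
    · ext v
      constructor
      · rintro ⟨i, h1, h2, rfl⟩
        exact ⟨i - 1, by omega, by simp only [show i - 1 + 1 = i by omega]⟩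
      · rintro ⟨i, h1, rfl⟩
        exact ⟨i + 1, by omega, by omega, rfl⟩
  have nb : ∀ v ∈ {v | ∃ i, 1 ≤ i ∧ i ≤ k ∧ (q i).1 = v}, (v ≠ x ∧ v ≠ y) ∧
      ((G.Adj x v ∨ G.Adj y v) ↔ v = (q 1).1 ∨ v = (q k).1) := by
    rintro _ ⟨i, h1, h2, rfl⟩
    refine ⟨⟨fun e => nX i h1 h2 (Subtype.ext e), (q i).2⟩, ?_⟩
    rw [← cp_adjX hxy (nX i h1 h2), ← h0, (hp 0 i (by omega) h2).2]
    constructor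
    · rintro (rfl | ⟨-, rfl⟩)
      · exact Or.inl rfl
      · exact Or.inr rfl
    · rintro (e | e)
      · left
        by_contra hne
        exact (hp 1 i (by omega) h2).1 (Subtype.ext e.symm)
      · right
        refine ⟨rfl, ?_⟩
        by_contra hne
        exact (hp i k (by omega) (by omega)).1 (Subtype.ext e)
  revert hS nb
  generalize {v | ∃ i, 1 ≤ i ∧ i ≤ k ∧ (q i).1 = v} = S
  generalize (q 1).1 = s
  generalize (q k).1 = e
  clear hp h0 nX q
  intro hS nb
  rw [Nat.odd_iff]
  have key : ∀ x y s e, (∀ v ∈ S, (v ≠ x ∧ v ≠ y) ∧ ((G.Adj x v ∨ G.Adj y v) ↔ v = s ∨ v = e)) →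
      IPL G s e (k - 1) S → G.Adj x s → G.Adj x e → k % 2 = 1 := by
    intro x y s e nb hS h1 h2
    have := Nat.even_iff.1 (hA.even hS (IPL.single G x) h1.symm h2.symm ⟨by grind, by
      rintro u hu _ rfl e
      have := (nb u hu).2.1 (Or.inl e.symm)
      grind⟩ (by omega))
    omega
  have key2 : ∀ s e, (∀ v ∈ S, (v ≠ x ∧ v ≠ y) ∧ ((G.Adj x v ∨ G.Adj y v) ↔ v = s ∨ v = e)) →
      IPL G s e (k - 1) S → G.Adj x s → ¬ G.Adj x e → G.Adj y e → ¬ G.Adj y s → k % 2 = 1 := by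
    intro s e nb hS h1 h2 h3 h4
    have hna := hg.2.1
    have := hg.2.2.1 _ _ ((hS.cons h1 (by grind) (by grind)).snoc h3.symm (by grind) (by grind [G.adj_comm]))
    omega
  have nb' : ∀ v ∈ S, (v ≠ y ∧ v ≠ x) ∧ ((G.Adj y v ∨ G.Adj x v) ↔ v = s ∨ v = e) := by
    intro v hv
    have := nb v hv
    tauto
  have nb'' : ∀ v ∈ S, (v ≠ x ∧ v ≠ y) ∧ ((G.Adj x v ∨ G.Adj y v) ↔ v = e ∨ v = s) := by
    intro v hv
    have := nb v hv
    tauto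
  have k1 := key x y s e nb hS
  have k2 := key y x s e nb' hS
  have k3 := key2 s e nb hS
  have k4 := key2 e s nb'' hS.symm
  have l1 := (nb s hS.left).2.2 (Or.inl rfl)
  have l2 := (nb e hS.right).2.2 (Or.inr rfl)
  tauto

theorem anti_gap (hA : AF G) {f : ℕ → V} {K : ℕ} (hf : IsIP Gᶜ f K) {z : V} (hz : ∀ i, i ≤ K → f i ≠ z)
    (h0 : ¬ G.Adj z (f 0)) (hK : ¬ G.Adj z (f K)) {i : ℕ} (hi : i + 1 ≤ K) (h1 : G.Adj z (f i)) :
    ¬ G.Adj z (f (i + 1)) := by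
  intro h2
  obtain ⟨l, hl, hlC, lmax⟩ := exists_max (Q := fun l => ¬ G.Adj z (f l)) (h := i) ⟨0, by omega, h0⟩
  obtain ⟨j, ⟨hj, hjk, hjC⟩, jmin⟩ := exists_min (Q := fun j => i ≤ j ∧ j ≤ K ∧ ¬ G.Adj z (f j))
    ⟨K, by omega, le_rfl, hK⟩
  have e1 : l ≠ i := fun e => hlC (e ▸ h1)
  have e2 : j ≠ i := fun e => hjC (e ▸ h1)
  have e3 : j ≠ i + 1 := fun e => hjC (e ▸ h2)
  refine hA.noanti (hf.ipl (a := l) (b := j) (by omega) hjk) (IPL.single Gᶜ z) ?_ ?_ ⟨?_, ?_⟩ (by omega)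
  · rw [compl_adj]
    exact ⟨hz l (by omega), fun e => hlC e.symm⟩
  · rw [compl_adj]
    exact ⟨hz j (by omega), fun e => hjC e.symm⟩
  · rintro _ ⟨m, h1, h2, rfl⟩ h
    exact hz m (by omega) h
  · rintro _ ⟨m, h1, h2, rfl⟩ z' hz' h
    obtain rfl : z = z' := Eq.symm hz'
    rw [compl_adj] at h
    have hm : ¬ G.Adj z (f m) := fun e => h.2 e.symm
    by_cases e : m ≤ i
    · have := lmax m e hm
      left; exact ⟨by congr 1; omega, rfl⟩
    · have := jmin m ⟨by omega, by omega, hm⟩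
      right; exact ⟨by congr 1; omega, rfl⟩

set_option maxHeartbeats 1000000 in
theorem anti_key (hA : AF G) (hg : Good G x y) {f : ℕ → V} {K : ℕ} (hK : 3 ≤ K) (hf : IsIP Gᶜ f K)
    (hx : ∀ i, i ≤ K → f i ≠ x) (hy : ∀ i, i ≤ K → f i ≠ y)
    (nb : ∀ i, i ≤ K → ((¬ G.Adj x (f i) ∧ ¬ G.Adj y (f i)) ↔ i = 0 ∨ i = K)) (h1 : G.Adj y (f 1)) :
    False := by
  obtain ⟨x0, y0⟩ := (nb 0 (by omega)).2 (Or.inl rfl)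
  obtain ⟨xK, yK⟩ := (nb K (by omega)).2 (Or.inr rfl)
  have gx := fun i => anti_gap hA hf hx x0 xK (i := i)
  have gy := fun i => anti_gap hA hf hy y0 yK (i := i)
  have hG : ∀ i j, i < j → j ≤ K → f i ≠ f j ∧ (G.Adj (f i) (f j) ↔ j ≠ i + 1) := by
    intro i j hij hj
    have := hf i j hij hj
    refine ⟨this.1, ?_⟩
    rw [compl_adj] at this
    tauto
  have y2 := gy 1 (by omega) h1
  have x2 : G.Adj x (f 2) := by
    have := nb 2 (by omega)
    by_contra h
    have := this.1 ⟨h, y2⟩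
    omega
  have x1 : ¬ G.Adj x (f 1) := fun e => gx 1 (by omega) e x2
  have x3 := gx 2 (by omega) x2
  have hna := hg.2.1
  have hne := hg.1
  have e1 := hG 0 1 (by omega) (by omega)
  have e2 := hG 0 2 (by omega) (by omega)
  have e3 := hG 0 3 (by omega) (by omega)
  have e4 := hG 1 2 (by omega) (by omega)
  have e5 := hG 1 3 (by omega) (by omega)
  have e6 := hG 2 3 (by omega) (by omega)
  have hx0 := hx 0 (by omega)
  have hx1 := hx 1 (by omega)
  have hx2 := hx 2 (by omega)
  have hx3 := hx 3 (by omega)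
  have hy0 := hy 0 (by omega)
  have hy1 := hy 1 (by omega)
  have hy2 := hy 2 (by omega)
  have hy3 := hy 3 (by omega)
  norm_num at e1 e2 e3 e4 e5 e6
  by_cases K3 : K = 3
  · subst K3
    clear hf hx hy nb gx gy hG
    have q := ((((IPL.single G y).cons (x := f 1) h1.symm (by grind) (by grind)).cons (x := f 3) e5.2.symm
      (by grind) (by grind [G.adj_comm])).cons (x := f 0) e3.2 (by grind) (by grind [G.adj_comm])).cons (x := f 2) e2.2.symm
      (by grind) (by grind [G.adj_comm])
    have := hg.2.2.1 _ _ (q.cons x2 (by grind) (by grind [G.adj_comm]))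
    omega
  have y3 : G.Adj y (f 3) := by
    have := nb 3 (by omega)
    by_contra h
    have := this.1 ⟨x3, h⟩
    omega
  have y4 := gy 3 (by omega) y3
  have f4 := hG 0 4 (by omega) (by omega)
  have f5 := hG 1 4 (by omega) (by omega)
  have f6 := hG 2 4 (by omega) (by omega)
  have f7 := hG 3 4 (by omega) (by omega)
  norm_num at f4 f5 f6 f7
  have hx4 := hx 4 (by omega)
  have hy4 := hy 4 (by omega)
  by_cases K4 : K = 4
  · subst K4
    clear hf hx hy nb gx gy hG
    have iA := IPL.single G y
    have iB : IPL G x (f 2) _ _ := (IPL.single G (f 2)).cons x2 (by grind) (by grind)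
    have i2 : IPL G (f 1) (f 4) _ _ := (IPL.single G (f 4)).cons f5.2 (by grind) (by grind)
    have i3 : IPL G (f 3) (f 0) _ _ := (IPL.single G (f 0)).cons e3.2.symm (by grind) (by grind)
    refine hg.2.2.2.2 ⟨_, _, _, _, _, _, _, _, _, _, _, _, _, _, iA, iB, hx2.symm,
      ⟨iB.conn, iA.conn, iB.right, iA.right, i2, i3, f5.1, fun e => e3.1 e.symm, h1, y3, e5.2, f6.2, e2.2.symm, f4.2.symm,
      ⟨?_, ?_⟩, ⟨?_, ?_⟩, ⟨?_, ?_⟩, ⟨?_, ?_⟩, ⟨?_, ?_⟩, ⟨?_, ?_⟩⟩⟩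
    all_goals clear iA iB i2 i3
    all_goals grind [G.adj_comm]
  have x4 : G.Adj x (f 4) := by
    have := nb 4 (by omega)
    by_contra h
    have := this.1 ⟨h, y4⟩
    omega
  clear hf hx hy nb gx gy hG
  have q := (((IPL.single G y).cons (x := f 1) h1.symm (by grind) (by grind)).cons (x := f 4) f5.2.symm
      (by grind) (by grind [G.adj_comm]))
  have := hg.2.2.1 _ _ (q.cons x4 (by grind) (by grind [G.adj_comm]))
  omega

theorem cp_anti (hA : AF G) (hg : Good G x y) {p : ℕ → {v : V // v ≠ y}} {k : ℕ}
    (h : HoleF (contractPair G x y)ᶜ p k) : k ≤ 3 := by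
  have hxy := hg.1
  by_contra hk
  by_cases hX : ∃ i, i ≤ k ∧ p i = ⟨x, hxy⟩
  swap
  · refine hk (hA.anti _ _ (h.map Subtype.val_injective fun i j hij hj => ?_))
    rw [compl_adj, compl_adj, cp_adj hxy]
    · simp [Subtype.val_inj]
    · exact fun e => hX ⟨i, by omega, e⟩
    · exact fun e => hX ⟨j, by omega, e⟩
  obtain ⟨i, hi, hX⟩ := hX
  obtain ⟨q, hq, h0⟩ := h.rotTo hi
  rw [hX] at h0
  clear hX hi h p i
  obtain ⟨k3, hp⟩ := hq
  have nX : ∀ i, 1 ≤ i → i ≤ k → q i ≠ ⟨x, hxy⟩ := fun i h1 h2 e =>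
    (hp 0 i (by omega) h2).1 (by rw [h0, e])
  have hf : IsIP Gᶜ (fun i => (q (i + 1)).1) (k - 1) := by
    intro i j hij hj
    have := hp (i + 1) (j + 1) (by omega) (by omega)
    refine ⟨fun e => this.1 (Subtype.ext e), ?_⟩
    rw [compl_adj] at this ⊢
    rw [cp_adj hxy (nX _ (by omega) (by omega)) (nX _ (by omega) (by omega))]
    simp only [ne_eq, Subtype.val_inj]
    rw [this.2]
    omega
  have nb : ∀ i, i ≤ k - 1 → ((¬ G.Adj x (q (i + 1)).1 ∧ ¬ G.Adj y (q (i + 1)).1) ↔ i = 0 ∨ i = k - 1) := by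
    intro i hi
    have := hp 0 (i + 1) (by omega) (by omega)
    rw [h0, compl_adj, cp_adjX hxy (nX _ (by omega) (by omega))] at this
    have h2 := this.2
    rw [← not_or]
    have hh := (nX (i + 1) (by omega) (by omega)).symm
    constructor
    · intro h
      have := h2.1 ⟨hh, h⟩
      omega
    · intro h
      exact (h2.2 (by omega)).2
  have hx : ∀ i, i ≤ k - 1 → (q (i + 1)).1 ≠ x := fun i hi e => nX (i + 1) (by omega) (by omega) (Subtype.ext e)
  have hy : ∀ i, i ≤ k - 1 → (q (i + 1)).1 ≠ y := fun i hi => (q (i + 1)).2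
  by_cases h1 : G.Adj y (q 2).1
  · exact anti_key hA hg (by omega) hf hx hy nb h1
  by_cases h2 : G.Adj x (q 2).1
  · exact anti_key hA hg.symm (by omega) hf hy hx (fun i hi => by rw [← nb i hi]; tauto) h2
  have := (nb 1 (by omega)).1 ⟨h2, h1⟩
  omega

end Artemis

namespace Artemis
variable {V W : Type*} {G : SimpleGraph V} {H : SimpleGraph W} {x y : V}

theorem OneE.map {f : W → V} (hf : Function.Injective f) {a b : W} {S R : Set W} (h : OneE H a b S R)
    (hadj : ∀ u ∈ S, ∀ v ∈ R, (G.Adj (f u) (f v) ↔ H.Adj u v)) :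
    OneE G (f a) (f b) (f '' S) (f '' R) := by
  obtain ⟨h1, h2⟩ := h
  refine ⟨?_, ?_⟩
  · rintro _ ⟨u, hu, rfl⟩ ⟨v, hv, e⟩
    exact h1 u hu (hf e ▸ hv)
  · rintro _ ⟨u, hu, rfl⟩ _ ⟨v, hv, rfl⟩ e
    obtain ⟨rfl, rfl⟩ := h2 u hu v hv ((hadj u hu v hv).1 e)
    exact ⟨rfl, rfl⟩

theorem NoE.map {f : W → V} (hf : Function.Injective f) {S R : Set W} (h : NoE H S R)
    (hadj : ∀ u ∈ S, ∀ v ∈ R, (G.Adj (f u) (f v) ↔ H.Adj u v)) : NoE G (f '' S) (f '' R) := by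
  obtain ⟨h1, h2⟩ := h
  refine ⟨?_, ?_⟩
  · rintro _ ⟨u, hu, rfl⟩ ⟨v, hv, e⟩
    exact h1 u hu (hf e ▸ hv)
  · rintro _ ⟨u, hu, rfl⟩ _ ⟨v, hv, rfl⟩ e
    exact h2 u hu v hv ((hadj u hu v hv).1 e)

/-- bundled prism -/
structure PrD (G : SimpleGraph V) (a1 a2 a3 b1 b2 b3 : V) (k1 k2 k3 : ℕ) (S1 S2 S3 : Set V) : Prop where
  h1 : IPL G a1 b1 k1 S1
  h2 : IPL G a2 b2 k2 S2
  h3 : IPL G a3 b3 k3 S3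
  a12 : G.Adj a1 a2
  a23 : G.Adj a2 a3
  a13 : G.Adj a1 a3
  b12 : G.Adj b1 b2
  b23 : G.Adj b2 b3
  b13 : G.Adj b1 b3
  n1 : a1 ≠ b1
  n2 : a2 ≠ b2
  n3 : a3 ≠ b3
  t12 : TwoE G a1 b1 a2 b2 S1 S2
  t13 : TwoE G a1 b1 a3 b3 S1 S3
  t23 : TwoE G a2 b2 a3 b3 S2 S3

section perm
variable {a1 a2 a3 b1 b2 b3 : V} {k1 k2 k3 : ℕ} {S1 S2 S3 : Set V}

theorem PrD.swap12 (d : PrD G a1 a2 a3 b1 b2 b3 k1 k2 k3 S1 S2 S3) :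
    PrD G a2 a1 a3 b2 b1 b3 k2 k1 k3 S2 S1 S3 :=
  ⟨d.h2, d.h1, d.h3, d.a12.symm, d.a13, d.a23, d.b12.symm, d.b13, d.b23, d.n2, d.n1, d.n3, d.t12.symm,
    d.t23, d.t13⟩

theorem PrD.swap13 (d : PrD G a1 a2 a3 b1 b2 b3 k1 k2 k3 S1 S2 S3) :
    PrD G a3 a2 a1 b3 b2 b1 k3 k2 k1 S3 S2 S1 :=
  ⟨d.h3, d.h2, d.h1, d.a23.symm, d.a12.symm, d.a13.symm, d.b23.symm, d.b12.symm, d.b13.symm, d.n3, d.n2, d.n1,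
    d.t23.symm, d.t13.symm, d.t12.symm⟩

theorem PrD.flip (d : PrD G a1 a2 a3 b1 b2 b3 k1 k2 k3 S1 S2 S3) :
    PrD G b1 b2 b3 a1 a2 a3 k1 k2 k3 S1 S2 S3 :=
  ⟨d.h1.symm, d.h2.symm, d.h3.symm, d.b12, d.b23, d.b13, d.a12, d.a23, d.a13, d.n1.symm, d.n2.symm, d.n3.symm,
    d.t12.swap, d.t13.swap, d.t23.swap⟩

theorem PrD.prismF (d : PrD G a1 a2 a3 b1 b2 b3 k1 k2 k3 S1 S2 S3) : PrismF G :=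
  ⟨a1, a2, a3, b1, b2, b3, k1, k2, k3, S1, S2, S3, d.h1, d.h2, d.h3, d.a12, d.a23, d.a13, d.b12, d.b23, d.b13,
    d.n1, d.n2, d.n3, d.t12, d.t13, d.t23⟩

end perm

variable {a1 a2 a3 b1 b2 b3 p q : V} {i m k2 k3 : ℕ} {A B P2 P3 : Set V}

/-- prism after contraction, the contracted vertex being a corner -/
structure Cor (G : SimpleGraph V) (x y a2 a3 q b1 b2 b3 : V) (m k2 k3 : ℕ) (B P2 P3 : Set V) : Prop where
  hB : IPL G q b1 m B
  h2 : IPL G a2 b2 k2 P2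
  h3 : IPL G a3 b3 k3 P3
  n2 : a2 ≠ b2
  n3 : a3 ≠ b3
  a23 : G.Adj a2 a3
  b12 : G.Adj b1 b2
  b23 : G.Adj b2 b3
  b13 : G.Adj b1 b3
  eB2 : OneE G b1 b2 B P2
  eB3 : OneE G b1 b3 B P3
  e23 : TwoE G a2 b2 a3 b3 P2 P3
  nB : ∀ u ∈ B, u ≠ x ∧ u ≠ y
  nP2 : ∀ u ∈ P2, u ≠ x ∧ u ≠ y
  nP3 : ∀ u ∈ P3, u ≠ x ∧ u ≠ y
  bB : ∀ u ∈ B, (G.Adj x u ∨ G.Adj y u) ↔ u = q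
  bP2 : ∀ u ∈ P2, (G.Adj x u ∨ G.Adj y u) ↔ u = a2
  bP3 : ∀ u ∈ P3, (G.Adj x u ∨ G.Adj y u) ↔ u = a3

theorem Cor.symm (c : Cor G x y a2 a3 q b1 b2 b3 m k2 k3 B P2 P3) :
    Cor G y x a2 a3 q b1 b2 b3 m k2 k3 B P2 P3 :=
  { c with
    nB := fun u hu => (c.nB u hu).symm, nP2 := fun u hu => (c.nP2 u hu).symm
    nP3 := fun u hu => (c.nP3 u hu).symm
    bB := fun u hu => by rw [or_comm]; exact c.bB u hu
    bP2 := fun u hu => by rw [or_comm]; exact c.bP2 u hu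
    bP3 := fun u hu => by rw [or_comm]; exact c.bP3 u hu }

theorem Cor.swap (c : Cor G x y a2 a3 q b1 b2 b3 m k2 k3 B P2 P3) :
    Cor G x y a3 a2 q b1 b3 b2 m k3 k2 B P3 P2 :=
  ⟨c.hB, c.h3, c.h2, c.n3, c.n2, c.a23.symm, c.b13, c.b23.symm, c.b12, c.eB3, c.eB2, c.e23.symm, c.nB,
    c.nP3, c.nP2, c.bB, c.bP3, c.bP2⟩

theorem Cor.all (hA : AF G) (c : Cor G x y a2 a3 q b1 b2 b3 m k2 k3 B P2 P3) (x2 : G.Adj x a2)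
    (x3 : G.Adj x a3) (xq : G.Adj x q) : False := by
  obtain ⟨hB, h2, h3, n2, n3, a23, b12, b23, b13, ⟨e1, e2⟩, ⟨e3, e4⟩, e23, nB, nP2, nP3, bB, bP2, bP3⟩ := c
  have d : PrD G x a2 a3 b1 b2 b3 _ k2 k3 _ P2 P3 :=
    ⟨hB.cons xq (by grind) (by grind), h2, h3, x2, a23, x3, b12, b23, b13, (nB _ hB.right).1.symm, n2, n3,
      ⟨by grind, by grind⟩, ⟨by grind, by grind⟩, e23⟩
  exact hA.prism d.prismF

set_option maxHeartbeats 1000000 in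
theorem Cor.one (hA : AF G) (hg : Good G x y) (c : Cor G x y a2 a3 q b1 b2 b3 m k2 k3 B P2 P3)
    (x3 : G.Adj x a3) (xq : ¬ G.Adj x q) (yq : G.Adj y q) (y2 : G.Adj y a2)
    (y3 : ¬ G.Adj y a3) : False := by
  obtain ⟨hB, h2, h3, n2, n3, a23, b12, b23, b13, ⟨e1, e2⟩, ⟨e3, e4⟩, ⟨e5, e6⟩, nB, nP2, nP3, bB, bP2, bP3⟩ := c
  have hna := hg.2.1
  have hne := hg.1
  have l2 := h2.left
  have l3 := h3.left
  have r := h3.append hB.symm b13.symm (by grind) (by grind [G.adj_comm])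
  have r' := (r.snoc yq.symm (by grind) (by grind)).cons (x := x) x3 (by grind) (by grind)
  have := hg.2.2.1 _ _ r'
  have l0 : IPL G a2 y _ _ := (IPL.single G y).cons y2.symm (by grind) (by grind)
  have := Nat.even_iff.1 (hA.even r l0 a23.symm yq.symm ⟨by grind, by grind [G.adj_comm]⟩ (by omega))
  omega

set_option maxHeartbeats 1000000 in
theorem Cor.two (hA : AF G) (hg : Good G x y) (c : Cor G x y a2 a3 q b1 b2 b3 m k2 k3 B P2 P3)
    (x2 : G.Adj x a2) (x3 : G.Adj x a3) (xq : ¬ G.Adj x q) (yq : G.Adj y q) : False := by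
  by_cases y2 : G.Adj y a2
  · by_cases y3 : G.Adj y a3
    · exact c.symm.all hA y2 y3 yq
    · exact c.one hA hg x3 xq yq y2 y3
  by_cases y3 : G.Adj y a3
  · exact c.swap.one hA hg x2 xq yq y3 y2
  obtain ⟨hB, h2, h3, n2, n3, a23, b12, b23, b13, ⟨e1, e2⟩, ⟨e3, e4⟩, e23, nB, nP2, nP3, bB, bP2, bP3⟩ := c
  have hna := hg.2.1
  have hne := hg.1
  have iA := IPL.single G x
  have iB : IPL G y b1 _ _ := hB.cons yq (by grind) (by grind)
  exact hg.2.2.2.1 ⟨_, _, _, _, _, _, _, _, _, _, _, _, _, _, iA, iB, (nB _ hB.right).2.symm,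
    ⟨iB.conn, iA.conn, iB.right, iA.right, h2, h3, n2, n3, x2, x3, a23, b12, b13, b23,
    ⟨by grind, by grind⟩, ⟨by grind, by grind⟩, ⟨by grind, by grind⟩, ⟨by grind, by grind⟩,
    ⟨by grind, by grind⟩, e23⟩⟩

theorem Cor.three (hA : AF G) (hg : Good G x y) (c : Cor G x y a2 a3 q b1 b2 b3 m k2 k3 B P2 P3)
    (x2 : G.Adj x a2) (x3 : ¬ G.Adj x a3) (xq : G.Adj x q) : False := by
  have y3 : G.Adj y a3 := ((c.bP3 _ c.h3.left).2 rfl).resolve_left x3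
  have hna := hg.2.1
  have hne := hg.1
  by_cases y2 : G.Adj y a2
  · by_cases yq : G.Adj y q
    · exact c.symm.all hA y2 y3 yq
    · exact c.symm.two hA hg.symm y2 y3 yq xq
  have m2 := c.nP2 _ c.h2.left
  have m3 := c.nP3 _ c.h3.left
  have a23 := c.a23
  have r := (((IPL.single G y).cons (x := a3) y3.symm (by grind) (by grind)).cons (x := a2) a23 (by grind)
    (by grind [G.adj_comm])).cons (x := x) x2 (by grind) (by grind)
  have := hg.2.2.1 _ _ r
  omega

theorem Cor.false (hA : AF G) (hg : Good G x y) (c : Cor G x y a2 a3 q b1 b2 b3 m k2 k3 B P2 P3) :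
    False := by
  have key : ∀ {x y}, Good G x y → Cor G x y a2 a3 q b1 b2 b3 m k2 k3 B P2 P3 →
      (G.Adj x a2 → G.Adj x a3 → False) ∧ (G.Adj x a2 → G.Adj x q → False) ∧
      (G.Adj x a3 → G.Adj x q → False) := by
    intro x y hg c
    refine ⟨fun h1 h2 => ?_, fun h1 h2 => ?_, fun h1 h2 => ?_⟩
    · by_cases e : G.Adj x q
      · exact c.all hA h1 h2 e
      · exact c.two hA hg h1 h2 e (((c.bB _ c.hB.left).2 rfl).resolve_left e)
    · by_cases e : G.Adj x a3
      · exact c.all hA h1 e h2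
      · exact c.three hA hg h1 e h2
    · by_cases e : G.Adj x a2
      · exact c.all hA e h1 h2
      · exact c.swap.three hA hg h1 e h2
  have k1 := key hg c
  have k2 := key hg.symm c.symm
  have z1 := (c.bB _ c.hB.left).2 rfl
  have z2 := (c.bP2 _ c.h2.left).2 rfl
  have z3 := (c.bP3 _ c.h3.left).2 rfl
  tauto

/-- prism after contraction, the contracted vertex being interior to a path -/
structure Mid (G : SimpleGraph V) (x y a1 a2 a3 p q b1 b2 b3 : V) (i m k2 k3 : ℕ) (A B P2 P3 : Set V) :
    Prop where
  hA : IPL G a1 p i A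
  hB : IPL G q b1 m B
  h2 : IPL G a2 b2 k2 P2
  h3 : IPL G a3 b3 k3 P3
  n2 : a2 ≠ b2
  n3 : a3 ≠ b3
  a12 : G.Adj a1 a2
  a23 : G.Adj a2 a3
  a13 : G.Adj a1 a3
  b12 : G.Adj b1 b2
  b23 : G.Adj b2 b3
  b13 : G.Adj b1 b3
  eAB : NoE G A B
  eA2 : OneE G a1 a2 A P2
  eA3 : OneE G a1 a3 A P3
  eB2 : OneE G b1 b2 B P2
  eB3 : OneE G b1 b3 B P3
  e23 : TwoE G a2 b2 a3 b3 P2 P3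
  nA : ∀ u ∈ A, u ≠ x ∧ u ≠ y
  nB : ∀ u ∈ B, u ≠ x ∧ u ≠ y
  nP2 : ∀ u ∈ P2, u ≠ x ∧ u ≠ y
  nP3 : ∀ u ∈ P3, u ≠ x ∧ u ≠ y
  bA : ∀ u ∈ A, (G.Adj x u ∨ G.Adj y u) ↔ u = p
  bB : ∀ u ∈ B, (G.Adj x u ∨ G.Adj y u) ↔ u = q
  bP2 : ∀ u ∈ P2, ¬ G.Adj x u ∧ ¬ G.Adj y u
  bP3 : ∀ u ∈ P3, ¬ G.Adj x u ∧ ¬ G.Adj y u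

theorem Mid.symm (c : Mid G x y a1 a2 a3 p q b1 b2 b3 i m k2 k3 A B P2 P3) :
    Mid G y x a1 a2 a3 p q b1 b2 b3 i m k2 k3 A B P2 P3 :=
  { c with
    nA := fun u hu => (c.nA u hu).symm
    nB := fun u hu => (c.nB u hu).symm, nP2 := fun u hu => (c.nP2 u hu).symm
    nP3 := fun u hu => (c.nP3 u hu).symm
    bA := fun u hu => by rw [or_comm]; exact c.bA u hu
    bB := fun u hu => by rw [or_comm]; exact c.bB u hu
    bP2 := fun u hu => (c.bP2 u hu).symm
    bP3 := fun u hu => (c.bP3 u hu).symm }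

set_option maxHeartbeats 1000000 in
theorem Mid.one (hG : AF G) (c : Mid G x y a1 a2 a3 p q b1 b2 b3 i m k2 k3 A B P2 P3)
    (xp : G.Adj x p) (xq : G.Adj x q) : False := by
  obtain ⟨hA, hB, h2, h3, n2, n3, a12, a23, a13, b12, b23, b13, ⟨e1, e2⟩, ⟨e3, e4⟩, ⟨e5, e6⟩, ⟨e7, e8⟩, ⟨e9, e10⟩, e23,
    nA, nB, nP2, nP3, bA, bB, bP2, bP3⟩ := c
  have r := (hA.snoc xp.symm (by grind) (by grind)).append hB xq (by grind) (by grind)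
  have l1 := hA.left
  have l2 := hB.right
  have d : PrD G a1 a2 a3 b1 b2 b3 _ k2 k3 _ P2 P3 :=
    ⟨r, h2, h3, a12, a23, a13, b12, b23, b13, by grind, n2, n3,
      ⟨by
        rintro u ((h0 | h) | h) h'
        · exact (nP2 _ h').1 h0
        · exact e3 _ h h'
        · exact e7 _ h h', by
        rintro u ((h0 | h) | h) v hv e
        · exact ((bP2 v hv).1 (h0 ▸ e)).elim
        · exact Or.inl (e4 u h v hv e)
        · exact Or.inr (e8 u h v hv e)⟩,
      ⟨by
        rintro u ((h0 | h) | h) h'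
        · exact (nP3 _ h').1 h0
        · exact e5 _ h h'
        · exact e9 _ h h', by
        rintro u ((h0 | h) | h) v hv e
        · exact ((bP3 v hv).1 (h0 ▸ e)).elim
        · exact Or.inl (e6 u h v hv e)
        · exact Or.inr (e10 u h v hv e)⟩, e23⟩
  exact hG.prism d.prismF

set_option maxHeartbeats 1000000 in
theorem Mid.two (hg : Good G x y) (c : Mid G x y a1 a2 a3 p q b1 b2 b3 i m k2 k3 A B P2 P3)
    (xp : G.Adj x p) (xq : ¬ G.Adj x q) (yp : ¬ G.Adj y p) (yq : G.Adj y q) : False := by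
  obtain ⟨hA, hB, h2, h3, n2, n3, a12, a23, a13, b12, b23, b13, ⟨e1, e2⟩, ⟨e3, e4⟩, ⟨e5, e6⟩, ⟨e7, e8⟩, ⟨e9, e10⟩, e23,
    nA, nB, nP2, nP3, bA, bB, bP2, bP3⟩ := c
  have hna := hg.2.1
  have hne := hg.1
  have iA : IPL G x a1 _ _ := hA.symm.cons xp (by grind) (by grind)
  have iB : IPL G y b1 _ _ := hB.cons yq (by grind) (by grind)
  exact hg.2.2.2.1 ⟨_, _, _, _, _, _, _, _, _, _, _, _, _, _, iA, iB, (nB _ hB.right).2.symm,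
    ⟨iB.conn, iA.conn, iB.right, iA.right, h2, h3, n2, n3, a12, a13, a23, b12, b13, b23,
    ⟨by grind, by grind [G.adj_comm]⟩, ⟨by grind, by grind⟩, ⟨by grind, by grind⟩, ⟨by grind, by grind⟩,
    ⟨by grind, by grind⟩, e23⟩⟩

theorem Mid.false (hG : AF G) (hg : Good G x y)
    (c : Mid G x y a1 a2 a3 p q b1 b2 b3 i m k2 k3 A B P2 P3) : False := by
  have k1 := c.one hG
  have k2 := c.symm.one hG
  have k3 := c.two hg
  have k4 := c.symm.two hg.symm
  have z1 := (c.bA _ c.hA.right).2 rfl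
  have z2 := (c.bB _ c.hB.left).2 rfl
  tauto

end Artemis

namespace Artemis
section
variable {V : Type*} {G : SimpleGraph V} {x y : V}

theorem cp_m (hxy : x ≠ y) {S R : Set {v : V // v ≠ y}} (hS : ⟨x, hxy⟩ ∉ S) (hR : ⟨x, hxy⟩ ∉ R) :
    ∀ u ∈ S, ∀ v ∈ R, (G.Adj u.1 v.1 ↔ (contractPair G x y).Adj u v) :=
  fun _ hu _ hv => cp_adj hxy (fun e => hS (e ▸ hu)) (fun e => hR (e ▸ hv))

theorem cp_n (hxy : x ≠ y) {S : Set {v : V // v ≠ y}} (hS : ⟨x, hxy⟩ ∉ S) :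
    ∀ u ∈ Subtype.val '' S, u ≠ x ∧ u ≠ y := by
  rintro _ ⟨u, hu, rfl⟩
  refine ⟨fun e => hS ?_, u.2⟩
  have : u = ⟨x, hxy⟩ := Subtype.ext e
  exact this ▸ hu

theorem cp_b (hxy : x ≠ y) {S : Set {v : V // v ≠ y}} {q : {v : V // v ≠ y}} (hS : ⟨x, hxy⟩ ∉ S)
    (h : ∀ u ∈ S, (contractPair G x y).Adj ⟨x, hxy⟩ u ↔ u = q) :
    ∀ u ∈ Subtype.val '' S, (G.Adj x u ∨ G.Adj y u) ↔ u = q.1 := by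
  rintro _ ⟨u, hu, rfl⟩
  rw [← cp_adjX hxy (fun e => hS (e ▸ hu)), h u hu, Subtype.ext_iff]

theorem cp_b0 (hxy : x ≠ y) {S : Set {v : V // v ≠ y}} (hS : ⟨x, hxy⟩ ∉ S)
    (h : ∀ u ∈ S, ¬ (contractPair G x y).Adj ⟨x, hxy⟩ u) :
    ∀ u ∈ Subtype.val '' S, ¬ G.Adj x u ∧ ¬ G.Adj y u := by
  rintro _ ⟨u, hu, rfl⟩
  rw [← not_or, ← cp_adjX hxy (fun e => hS (e ▸ hu))]
  exact h u hu

variable {a1 a2 a3 b1 b2 b3 : {v : V // v ≠ y}} {k1 k2 k3 : ℕ} {S1 S2 S3 : Set {v : V // v ≠ y}}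

theorem cp_corner (hA : AF G) (hg : Good G x y)
    (d : PrD (contractPair G x y) a1 a2 a3 b1 b2 b3 k1 k2 k3 S1 S2 S3) (ha : a1 = ⟨x, hg.1⟩) : False := by
  have hxy := hg.1
  have hf : Function.Injective (Subtype.val : {v : V // v ≠ y} → V) := Subtype.val_injective
  obtain ⟨h1, h2, h3, a12, a23, a13, b12, b23, b13, n1, n2, n3, t12, t13, t23⟩ := d
  obtain ⟨q, B, hB, eS, hX, hq, hq'⟩ := h1.tail n1
  have r1 := hB.right
  have l2 := h2.left
  have r2 := h2.right
  have l3 := h3.left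
  have r3 := h3.right
  have X2 : a1 ∉ S2 := t12.1 _ h1.left
  have X3 : a1 ∉ S3 := t13.1 _ h1.left
  have B1 : B ⊆ S1 := by rw [eS]; exact Set.subset_insert _ _
  have o2 : OneE (contractPair G x y) b1 b2 B S2 := ⟨fun u hu => t12.1 u (B1 hu), fun u hu v hv e =>
    (t12.2 u (B1 hu) v hv e).resolve_left fun h => hX (h.1 ▸ hu)⟩
  have o3 : OneE (contractPair G x y) b1 b3 B S3 := ⟨fun u hu => t13.1 u (B1 hu), fun u hu v hv e =>
    (t13.2 u (B1 hu) v hv e).resolve_left fun h => hX (h.1 ▸ hu)⟩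
  have c1 : ∀ u ∈ B, (contractPair G x y).Adj a1 u ↔ u = q :=
    fun u hu => ⟨hq' u hu, fun e => e ▸ hq⟩
  have c2 : ∀ u ∈ S2, (contractPair G x y).Adj a1 u ↔ u = a2 := fun u hu =>
    ⟨fun e => ((t12.2 _ h1.left u hu e).resolve_right fun h => n1 h.1).2, fun e => e ▸ a12⟩
  have c3 : ∀ u ∈ S3, (contractPair G x y).Adj a1 u ↔ u = a3 := fun u hu =>
    ⟨fun e => ((t13.2 _ h1.left u hu e).resolve_right fun h => n1 h.1).2, fun e => e ▸ a13⟩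
  clear B1 eS t12 t13 h1
  subst ha
  exact Cor.false hA hg ⟨hB.map hf (cp_m hxy hX hX), h2.map hf (cp_m hxy X2 X2), h3.map hf (cp_m hxy X3 X3),
    hf.ne n2, hf.ne n3, (cp_m hxy X2 X3 _ l2 _ l3).2 a23, (cp_m hxy hX X2 _ r1 _ r2).2 b12,
    (cp_m hxy X2 X3 _ r2 _ r3).2 b23, (cp_m hxy hX X3 _ r1 _ r3).2 b13,
    o2.map hf (cp_m hxy hX X2), o3.map hf (cp_m hxy hX X3), t23.map hf (cp_m hxy X2 X3),
    cp_n hxy hX, cp_n hxy X2, cp_n hxy X3, cp_b hxy hX c1, cp_b hxy X2 c2, cp_b hxy X3 c3⟩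

theorem cp_mid (hA : AF G) (hg : Good G x y)
    (d : PrD (contractPair G x y) a1 a2 a3 b1 b2 b3 k1 k2 k3 S1 S2 S3) (hX : ⟨x, hg.1⟩ ∈ S1) : False := by
  have hxy := hg.1
  by_cases ea : a1 = ⟨x, hxy⟩
  · exact cp_corner hA hg d ea
  by_cases eb : b1 = ⟨x, hxy⟩
  · exact cp_corner hA hg d.flip eb
  have hf : Function.Injective (Subtype.val : {v : V // v ≠ y} → V) := Subtype.val_injective
  obtain ⟨h1, h2, h3, a12, a23, a13, b12, b23, b13, n1, n2, n3, t12, t13, t23⟩ := d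
  obtain ⟨i, q, A', B, -, hA', hB, eS, hd, hq, hq'⟩ := h1.cut hX (Ne.symm eb)
  obtain ⟨p, A, hA1, eA, XA, hp, hp'⟩ := hA'.symm.tail (Ne.symm ea)
  have X2 := t12.1 _ hX
  have X3 := t13.1 _ hX
  have XB := hd _ hA'.right
  have A1 : A ⊆ A' := by rw [eA]; exact Set.subset_insert _ _
  have A2 : A ⊆ S1 := by rw [eS]; exact fun u hu => Or.inl (A1 hu)
  have B1 : B ⊆ S1 := by rw [eS]; exact fun u hu => Or.inr hu
  have ra := hA1.right
  have rb := hB.right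
  have la := hA'.left
  have l2 := h2.left
  have r2 := h2.right
  have l3 := h3.left
  have r3 := h3.right
  have aB : a1 ∉ B := hd _ la
  have bA : b1 ∉ A := fun h => hd _ (A1 h) rb
  have no : NoE (contractPair G x y) A B := ⟨fun u hu => hd u (A1 hu), fun u hu v hv e =>
    XA ((hq' u (A1 hu) v hv e).1 ▸ hu)⟩
  have o1 : OneE (contractPair G x y) a1 a2 A S2 := ⟨fun u hu => t12.1 u (A2 hu), fun u hu v hv e =>
    (t12.2 u (A2 hu) v hv e).resolve_right fun h => bA (h.1 ▸ hu)⟩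
  have o2 : OneE (contractPair G x y) a1 a3 A S3 := ⟨fun u hu => t13.1 u (A2 hu), fun u hu v hv e =>
    (t13.2 u (A2 hu) v hv e).resolve_right fun h => bA (h.1 ▸ hu)⟩
  have o3 : OneE (contractPair G x y) b1 b2 B S2 := ⟨fun u hu => t12.1 u (B1 hu), fun u hu v hv e =>
    (t12.2 u (B1 hu) v hv e).resolve_left fun h => aB (h.1 ▸ hu)⟩
  have o4 : OneE (contractPair G x y) b1 b3 B S3 := ⟨fun u hu => t13.1 u (B1 hu), fun u hu v hv e =>
    (t13.2 u (B1 hu) v hv e).resolve_left fun h => aB (h.1 ▸ hu)⟩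
  have c1 : ∀ u ∈ A, (contractPair G x y).Adj ⟨x, hxy⟩ u ↔ u = p :=
    fun u hu => ⟨hp' u hu, fun e => e ▸ hp⟩
  have c2 : ∀ u ∈ B, (contractPair G x y).Adj ⟨x, hxy⟩ u ↔ u = q :=
    fun u hu => ⟨fun e => (hq' _ hA'.right u hu e).2, fun e => e ▸ hq⟩
  have c3 : ∀ u ∈ S2, ¬ (contractPair G x y).Adj ⟨x, hxy⟩ u := fun u hu e =>
    (t12.2 _ hX u hu e).elim (fun h => ea h.1.symm) fun h => eb h.1.symm
  have c4 : ∀ u ∈ S3, ¬ (contractPair G x y).Adj ⟨x, hxy⟩ u := fun u hu e =>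
    (t13.2 _ hX u hu e).elim (fun h => ea h.1.symm) fun h => eb h.1.symm
  exact Mid.false hA hg ⟨hA1.symm.map hf (cp_m hxy XA XA), hB.map hf (cp_m hxy XB XB),
    h2.map hf (cp_m hxy X2 X2), h3.map hf (cp_m hxy X3 X3), hf.ne n2, hf.ne n3,
    (cp_m hxy XA X2 _ ra _ l2).2 a12, (cp_m hxy X2 X3 _ l2 _ l3).2 a23, (cp_m hxy XA X3 _ ra _ l3).2 a13,
    (cp_m hxy XB X2 _ rb _ r2).2 b12, (cp_m hxy X2 X3 _ r2 _ r3).2 b23, (cp_m hxy XB X3 _ rb _ r3).2 b13,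
    no.map hf (cp_m hxy XA XB), o1.map hf (cp_m hxy XA X2), o2.map hf (cp_m hxy XA X3),
    o3.map hf (cp_m hxy XB X2), o4.map hf (cp_m hxy XB X3), t23.map hf (cp_m hxy X2 X3),
    cp_n hxy XA, cp_n hxy XB, cp_n hxy X2, cp_n hxy X3, cp_b hxy XA c1, cp_b hxy XB c2,
    cp_b0 hxy X2 c3, cp_b0 hxy X3 c4⟩

theorem cp_prism (hA : AF G) (hg : Good G x y) : ¬ PrismF (contractPair G x y) := by
  rintro ⟨a1, a2, a3, b1, b2, b3, k1, k2, k3, S1, S2, S3, h1, h2, h3, a12, a23, a13, b12, b23, b13, n1, n2,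
    n3, t12, t13, t23⟩
  have d : PrD (contractPair G x y) a1 a2 a3 b1 b2 b3 k1 k2 k3 S1 S2 S3 :=
    ⟨h1, h2, h3, a12, a23, a13, b12, b23, b13, n1, n2, n3, t12, t13, t23⟩
  have hxy := hg.1
  have hf : Function.Injective (Subtype.val : {v : V // v ≠ y} → V) := Subtype.val_injective
  by_cases X1 : ⟨x, hxy⟩ ∈ S1
  · exact cp_mid hA hg d X1
  by_cases X2 : ⟨x, hxy⟩ ∈ S2
  · exact cp_mid hA hg d.swap12 X2
  by_cases X3 : ⟨x, hxy⟩ ∈ S3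
  · exact cp_mid hA hg d.swap13 X3
  have l1 := h1.left
  have r1 := h1.right
  have l2 := h2.left
  have r2 := h2.right
  have l3 := h3.left
  have r3 := h3.right
  have d' : PrD G a1.1 a2.1 a3.1 b1.1 b2.1 b3.1 k1 k2 k3 _ _ _ :=
    ⟨h1.map hf (cp_m hxy X1 X1), h2.map hf (cp_m hxy X2 X2), h3.map hf (cp_m hxy X3 X3),
    (cp_m hxy X1 X2 _ l1 _ l2).2 a12, (cp_m hxy X2 X3 _ l2 _ l3).2 a23, (cp_m hxy X1 X3 _ l1 _ l3).2 a13,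
    (cp_m hxy X1 X2 _ r1 _ r2).2 b12, (cp_m hxy X2 X3 _ r2 _ r3).2 b23, (cp_m hxy X1 X3 _ r1 _ r3).2 b13,
    hf.ne n1, hf.ne n2, hf.ne n3, t12.map hf (cp_m hxy X1 X2), t13.map hf (cp_m hxy X1 X3),
    t23.map hf (cp_m hxy X2 X3)⟩
  exact hA.prism d'.prismF
end
end Artemis

theorem classA_has_contractible_even_pair
    {V : Type*} [Fintype V] [DecidableEq V] (G : SimpleGraph V)
    (hG : InClassA G) (hnc : ¬ ∀ u v : V, u ≠ v → G.Adj u v) :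
    ∃ x y : V, EvenPair G x y ∧ InClassA (contractPair G x y) := by
  have hA := Artemis.AF.of_classA hG
  obtain ⟨x, y, hg⟩ := Artemis.good_pair _ V inferInstance G rfl hA (by
    by_contra h
    exact hnc fun u v huv => by_contra fun e => h ⟨u, v, huv, e⟩)
  refine ⟨x, y, ⟨hg.1, hg.2.1, fun p hp => Nat.even_iff.2 (hg.2.2.1 _ _ (Artemis.IPL.of_walk hp))⟩, ?_⟩
  exact Artemis.AF.classA ⟨fun p k h => Artemis.cp_hole hA hg h, fun p k h => Artemis.cp_anti hA hg h,
    Artemis.cp_prism hA hg⟩
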